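/- arXiv:1411.0993 — 2 statements merged into one kernel-verified Lean document; each statement's English description precedes it below -/
import Mathlib

section
/- Let F be a field of characteristic different from 2 with vcd₂(F) ≤ s. Then for all j ≥ s+1, the fundamental ideal power I^j(F(√-1)) of the Witt ring of F(√-1) is zero. -/
open scoped Classical

open scoped Classical

/-- An ordering on a field `F`, given by its positive cone `P`. -/
structure FieldOrdering (F : Type*) [Field F] where
  P : Set F
  add_mem : ∀ a b, a ∈ P → b ∈ P → a + b ∈ P
  mul_mem : ∀ a b, a ∈ P → b ∈ P → a * b ∈ P
  eq_zero_of_mem_of_neg_mem : ∀ a, a ∈ P → -a ∈ P → a = 0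
  mem_or_neg_mem : ∀ a : F, a ∈ P ∨ -a ∈ P

/-- The sign of an element with respect to an ordering. -/
noncomputable def FieldOrdering.sgn {F : Type*} [Field F] (O : FieldOrdering F) (a : F) : ℤ :=
  if a ∈ O.P then 1 else -1

/-- The generator `⟨a⟩` of the group ring `ℤ[Fˣ]`. -/
noncomputable def wittGen (F : Type*) [Field F] (a : Fˣ) : MonoidAlgebra ℤ Fˣ :=
  MonoidAlgebra.of ℤ Fˣ a

/-- The ideal of relations defining the Witt ring of a field of characteristic `≠ 2`:
`⟨a⟩ = ⟨ab²⟩`, `⟨a⟩ + ⟨b⟩ = ⟨a+b⟩ + ⟨ab(a+b)⟩` when `a + b ≠ 0`, and `⟨1⟩ + ⟨-1⟩ = 0`. -/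
noncomputable def wittIdeal (F : Type*) [Field F] : Ideal (MonoidAlgebra ℤ Fˣ) :=
  Ideal.span ({x | ∃ a b : Fˣ, x = wittGen F a - wittGen F (a * b * b)} ∪
    {x | ∃ a b c : Fˣ, (a : F) + (b : F) = (c : F) ∧
      x = wittGen F a + wittGen F b - wittGen F c - wittGen F (a * b * c)} ∪
    {wittGen F 1 + wittGen F (-1)})

/-- The Witt ring `W(F)` of a field `F` (of characteristic different from 2),
presented by generators `⟨a⟩`, `a ∈ Fˣ`, and the standard relations. -/
def WittRing (F : Type*) [Field F] : Type _ :=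
  MonoidAlgebra ℤ Fˣ ⧸ wittIdeal F

noncomputable instance (F : Type*) [Field F] : CommRing (WittRing F) :=
  inferInstanceAs (CommRing (MonoidAlgebra ℤ Fˣ ⧸ wittIdeal F))

/-- The class in the Witt ring of the rank one form `⟨a⟩`. -/
noncomputable def diagForm {F : Type*} [Field F] (a : Fˣ) : WittRing F :=
  Ideal.Quotient.mk (wittIdeal F) (wittGen F a)

/-- The fundamental ideal `I(F)` of the Witt ring: the ideal of even-rank forms,
generated by the forms `⟨1, a⟩ = 1 + ⟨a⟩`. -/
noncomputable def fundamentalIdeal (F : Type*) [Field F] : Ideal (WittRing F) :=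
  Ideal.span {x | ∃ a : Fˣ, x = 1 + diagForm a}

noncomputable example (F : Type*) [Field F] (j : ℕ) : Ideal (WittRing F) := (fundamentalIdeal F) ^ j


namespace WH
universe u
section forms
variable {K : Type u} [Field K]

/-- diagonal quadratic form -/
def Q {ι : Type*} [Fintype ι] {R : Type*} [CommRing R] (a x : ι → R) : R := ∑ i, a i * x i ^ 2
/-- diagonal bilinear form -/
def B {ι : Type*} [Fintype ι] {R : Type*} [CommRing R] (a x y : ι → R) : R :=
  ∑ i, a i * (x i * y i)
def Aniso {ι : Type*} [Fintype ι] {R : Type*} [CommRing R] (a : ι → R) : Prop :=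
  ∀ x, Q a x = 0 → x = 0

section basic
variable {ι : Type*} [Fintype ι] {R : Type*} [CommRing R] (a : ι → R)

lemma B_self (x : ι → R) : B a x x = Q a x := by
  simp [B, Q, pow_two]
lemma B_comm (x y : ι → R) : B a x y = B a y x := by
  simp [B, mul_comm (x _)]
lemma B_add_left (x y z : ι → R) : B a (x + y) z = B a x z + B a y z := by
  simp only [B, ← Finset.sum_add_distrib, Pi.add_apply]
  exact Finset.sum_congr rfl fun i _ => by ring
lemma B_smul_left (r : R) (x z : ι → R) : B a (r • x) z = r * B a x z := by
  simp only [B, Finset.mul_sum, Pi.smul_apply, smul_eq_mul]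
  exact Finset.sum_congr rfl fun i _ => by ring
lemma B_sub_left (x y z : ι → R) : B a (x - y) z = B a x z - B a y z := by
  simp only [B, ← Finset.sum_sub_distrib, Pi.sub_apply]
  exact Finset.sum_congr rfl fun i _ => by ring
lemma B_add_right (x y z : ι → R) : B a z (x + y) = B a z x + B a z y := by
  rw [B_comm, B_add_left, B_comm a x, B_comm a y]
lemma B_sub_right (x y z : ι → R) : B a z (x - y) = B a z x - B a z y := by
  rw [B_comm, B_sub_left, B_comm a x, B_comm a y]
lemma B_smul_right (r : R) (x z : ι → R) : B a z (r • x) = r * B a z x := by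
  rw [B_comm, B_smul_left, B_comm]
lemma B_zero_left (z : ι → R) : B a 0 z = 0 := by simp [B]
lemma B_zero_right (z : ι → R) : B a z 0 = 0 := by simp [B]
lemma Q_zero : Q a 0 = 0 := by simp [Q]
lemma Q_add (x y : ι → R) : Q a (x + y) = Q a x + 2 * B a x y + Q a y := by
  rw [← B_self, B_add_left, B_add_right, B_add_right, B_comm a y x, B_self, B_self]; ring
lemma Q_sub (x y : ι → R) : Q a (x - y) = Q a x - 2 * B a x y + Q a y := by
  rw [← B_self, B_sub_left, B_sub_right, B_sub_right, B_comm a y x, B_self, B_self]; ring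
lemma Q_smul (r : R) (x : ι → R) : Q a (r • x) = r ^ 2 * Q a x := by
  rw [← B_self, B_smul_left, B_smul_right, B_self]; ring
lemma Q_map {S : Type*} [CommRing S] (φ : R →+* S) (x : ι → R) :
    Q (φ ∘ a) (φ ∘ x) = φ (Q a x) := by simp [Q]
lemma B_map {S : Type*} [CommRing S] (φ : R →+* S) (x y : ι → R) :
    B (φ ∘ a) (φ ∘ x) (φ ∘ y) = φ (B a x y) := by simp [B]
end basic

open Polynomial

/-- the vector of `k`-th coefficients -/
def cf {n : ℕ} (f : Fin n → K[X]) (k : ℕ) : Fin n → K := fun i => (f i).coeff k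

lemma coeff_B_top {n : ℕ} (a : Fin n → K) (f g : Fin n → K[X]) (D E : ℕ)
    (hf : ∀ i, (f i).natDegree ≤ D) (hg : ∀ i, (g i).natDegree ≤ E) :
    (B (C ∘ a) f g).coeff (D + E) = B a (cf f D) (cf g E) := by
  simp only [B, cf, finsetSum_coeff, Function.comp, coeff_C_mul]
  refine Finset.sum_congr rfl fun i _ => ?_
  rw [coeff_mul_add_eq_of_natDegree_le (hf i) (hg i)]

lemma natDegree_B_le {n : ℕ} (a : Fin n → K) (f g : Fin n → K[X]) (D E : ℕ)
    (hf : ∀ i, (f i).natDegree ≤ D) (hg : ∀ i, (g i).natDegree ≤ E) :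
    (B (C ∘ a) f g).natDegree ≤ D + E := by
  refine natDegree_sum_le_of_forall_le _ _ fun i _ => ?_
  refine (natDegree_C_mul_le _ _).trans ?_
  exact natDegree_mul_le.trans (add_le_add (hf i) (hg i))

lemma exists_deg {n : ℕ} (f : Fin n → K[X]) (hf : f ≠ 0) :
    ∃ D, (∀ i, (f i).natDegree ≤ D) ∧ cf f D ≠ 0 ∧ ∃ i, f i ≠ 0 ∧ (f i).natDegree = D := by
  classical
  have hne : (Finset.univ.filter fun i => f i ≠ 0).Nonempty := by
    by_contra h
    apply hf
    ext1 i
    by_contra hi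
    exact h ⟨i, by simpa using hi⟩
  obtain ⟨i, hi, hmax⟩ := Finset.exists_max_image _ (fun i => (f i).natDegree) hne
  simp only [Finset.mem_filter, Finset.mem_univ, true_and] at hi hmax
  refine ⟨(f i).natDegree, fun j => ?_, fun h => ?_, i, hi, rfl⟩
  · by_cases hj : f j = 0
    · simp [hj]
    · exact hmax j hj
  · have := congrFun h i
    simp [cf] at this
    exact hi this

lemma natDegree_Q {n : ℕ} {a : Fin n → K} (ha : Aniso a) (f : Fin n → K[X]) (hf : f ≠ 0) :
    Q (C ∘ a) f ≠ 0 ∧ ∀ i, 2 * (f i).natDegree ≤ (Q (C ∘ a) f).natDegree := by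
  obtain ⟨D, hD, hc, -⟩ := exists_deg f hf
  have h1 := coeff_B_top a f f D D hD hD
  rw [B_self, B_self] at h1
  have h2 : (Q (C ∘ a) f).coeff (D + D) ≠ 0 := fun h => hc (ha _ (h1 ▸ h))
  refine ⟨fun h => h2 (by simp [h]), fun i => ?_⟩
  have := le_natDegree_of_ne_zero h2
  have := hD i
  omega

lemma aniso_poly {n : ℕ} {a : Fin n → K} (ha : Aniso a) : Aniso (C ∘ a : Fin n → K[X]) := by
  intro f hf
  by_contra h
  exact (natDegree_Q ha f h).1 hf

/-- Cassels–Pfister, with linear constraints. -/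
lemma cassels_pfister_aux {n : ℕ} {a : Fin n → K} (ha : Aniso a) (S : Set (Fin n → K)) (p : K[X]) :
    ∀ (N : ℕ) (f : Fin n → K[X]) (f0 : K[X]), f0 ≠ 0 → f0.natDegree ≤ N →
      (∀ w ∈ S, B (C ∘ a) f (C ∘ w) = 0) → Q (C ∘ a) f = p * f0 ^ 2 →
      ∃ g : Fin n → K[X], (∀ w ∈ S, B (C ∘ a) g (C ∘ w) = 0) ∧ Q (C ∘ a) g = p := by
  intro N
  induction N using Nat.strong_induction_on with
  | _ N ih =>
  intro f f0 hf0 hN hS hQ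
  set A : Fin n → K[X] := C ∘ a with hA
  set g : Fin n → K[X] := fun i => f i / f0 with hg
  set r : Fin n → K[X] := fun i => f i % f0 with hr
  have hfr : r = f - f0 • g := by
    ext1 i
    simp only [hr, hg, Pi.sub_apply, Pi.smul_apply, smul_eq_mul]
    rw [eq_sub_iff_add_eq, EuclideanDomain.mod_add_div]
  have hrdeg : ∀ i, (r i).degree < f0.degree := fun i => EuclideanDomain.mod_lt _ hf0
  have hgS : ∀ w ∈ S, B A g (C ∘ w) = 0 := by
    intro w hw
    by_contra hne
    have h1 : B A r (C ∘ w) = - (f0 * B A g (C ∘ w)) := by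
      rw [hfr, B_sub_left, B_smul_left, hS w hw, zero_sub]
    have h2 : (B A r (C ∘ w)).degree < f0.degree := by
      refine (degree_sum_le _ _).trans_lt ?_
      rw [Finset.sup_lt_iff (bot_lt_iff_ne_bot.mpr (by simpa using hf0))]
      intro i _
      have : A i * (r i * (C ∘ w) i) = C (a i * w i) * r i := by
        simp [hA]; ring
      rw [this]
      refine (degree_mul_le _ _).trans_lt ?_
      refine lt_of_le_of_lt ?_ (hrdeg i)
      calc _ ≤ 0 + (r i).degree := by gcongr; exact degree_C_le
        _ = _ := zero_add _
    rw [h1, degree_neg, degree_mul] at h2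
    have h3 : (0 : WithBot ℕ) ≤ (B A g (C ∘ w)).degree := zero_le_degree_iff.mpr hne
    have : f0.degree + 0 ≤ f0.degree + (B A g (C ∘ w)).degree := by gcongr
    rw [add_zero] at this
    exact absurd h2 (not_lt.mpr this)
  by_cases hr0 : r = 0
  · refine ⟨g, hgS, ?_⟩
    have hfg : f = f0 • g := by rw [hr0] at hfr; exact (sub_eq_zero.mp hfr.symm)
    rw [hfg, ← B_self, B_smul_left, B_smul_right, B_self] at hQ
    have : f0 ^ 2 * (Q A g - p) = 0 := by linear_combination hQ
    rcases mul_eq_zero.mp this with h | h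
    · exact absurd (pow_eq_zero_iff (two_ne_zero)|>.mp h) hf0
    · exact sub_eq_zero.mp h
  -- the descent step
  set α := Q A g - p
  set β := 2 * (B A f g - p * f0)
  set h : Fin n → K[X] := α • f - β • g
  set h0 := f0 * Q A g - 2 * B A f g + f0 * p
  have hkey : f0 * h0 = Q A r := by
    rw [hfr, Q_sub, Q_smul, B_smul_right, hQ]
    simp only [h0]
    ring
  have hh : Q A h = p * h0 ^ 2 := by
    simp only [h, Q_sub, Q_smul, B_smul_left, B_smul_right, hQ, α, β, h0]
    ring
  have hQr := natDegree_Q ha r hr0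
  have hh0 : h0 ≠ 0 := by
    rintro h'
    rw [h', mul_zero] at hkey
    exact hQr.1 hkey.symm
  have hlt : h0.natDegree < f0.natDegree := by
    obtain ⟨D, hD, -, i, hi0, hiD⟩ := exists_deg r hr0
    have h1 : (Q A r).natDegree ≤ D + D := by
      rw [← B_self]; exact natDegree_B_le a r r D D hD hD
    rw [← hkey, natDegree_mul hf0 hh0] at h1
    have h2 : D < f0.natDegree := hiD ▸ natDegree_lt_natDegree hi0 (hrdeg i)
    omega
  refine ih h0.natDegree (by omega) h h0 hh0 le_rfl ?_ hh
  intro w hw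
  simp only [h, B_sub_left, B_smul_left, hS w hw, hgS w hw, mul_zero, sub_zero]

lemma clear_denoms {n : ℕ} (f : Fin n → RatFunc K) :
    ∃ (f0 : K[X]) (g : Fin n → K[X]), f0 ≠ 0 ∧
      (algebraMap K[X] (RatFunc K)) ∘ g = (algebraMap K[X] (RatFunc K) f0) • f := by
  obtain ⟨b, hb⟩ := IsLocalization.exist_integer_multiples_of_finite (nonZeroDivisors K[X]) f
  choose g hg using hb
  refine ⟨b, g, nonZeroDivisors.ne_zero b.2, ?_⟩
  ext1 i
  simp only [Function.comp, hg, Pi.smul_apply, smul_eq_mul]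
  rw [Algebra.smul_def]

/-- the embedding of constants -/
noncomputable def cst (K : Type u) [Field K] : K →+* RatFunc K := (algebraMap K[X] (RatFunc K)).comp C

lemma cst_comp {n : ℕ} (a : Fin n → K) :
    cst K ∘ a = algebraMap K[X] (RatFunc K) ∘ (C ∘ a) := rfl

lemma algInj : Function.Injective (algebraMap K[X] (RatFunc K)) :=
  IsFractionRing.injective K[X] (RatFunc K)

lemma aniso_ratfunc {n : ℕ} {a : Fin n → K} (ha : Aniso a) : Aniso (cst K ∘ a) := by
  intro f hf
  obtain ⟨f0, g, h0, hg⟩ := clear_denoms f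
  have : Q (cst K ∘ a) (algebraMap K[X] (RatFunc K) ∘ g) = 0 := by
    rw [hg, ← B_self, B_smul_left, B_smul_right, B_self, hf]; simp
  rw [cst_comp, Q_map] at this
  have hg0 := aniso_poly ha g (algInj (by rw [this, map_zero]))
  ext1 i
  have := congrFun hg i
  simp only [hg0, Function.comp, Pi.zero_apply, map_zero, Pi.smul_apply, smul_eq_mul] at this
  rcases mul_eq_zero.mp this.symm with h | h
  · exact absurd (algInj (by rw [h, map_zero])) h0
  · exact h

lemma cassels_pfister {n : ℕ} {a : Fin n → K} (ha : Aniso a) (S : Set (Fin n → K)) (p : K[X])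
    (f : Fin n → RatFunc K) (hS : ∀ w ∈ S, B (cst K ∘ a) f (cst K ∘ w) = 0)
    (hQ : Q (cst K ∘ a) f = algebraMap K[X] (RatFunc K) p) :
    ∃ g : Fin n → K[X], (∀ w ∈ S, B (C ∘ a) g (C ∘ w) = 0) ∧ Q (C ∘ a) g = p := by
  obtain ⟨f0, g, h0, hg⟩ := clear_denoms f
  refine cassels_pfister_aux ha S p f0.natDegree g f0 h0 le_rfl ?_ ?_
  · intro w hw
    apply algInj
    rw [← B_map, ← cst_comp, ← cst_comp, hg, B_smul_left, hS w hw, mul_zero, map_zero]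
  · apply algInj
    rw [← Q_map, ← cst_comp, hg, ← B_self, B_smul_left, B_smul_right, B_self, hQ]
    simp; ring

lemma linear_of_quadratic {n : ℕ} {a : Fin n → K} (h2 : (2 : K) ≠ 0) (ha : Aniso a) (s c : K)
    (g : Fin n → K[X]) (hQ : Q (C ∘ a) g = C s + C c * X ^ 2) :
    Q a (cf g 0) = s ∧ Q a (cf g 1) = c ∧ B a (cf g 0) (cf g 1) = 0 := by
  have hdeg : ∀ i, (g i).natDegree ≤ 1 := by
    intro i
    by_cases hg : g = 0
    · simp [hg]
    have h1 := (natDegree_Q ha g hg).2 i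
    rw [hQ] at h1
    have : (C s + C c * X ^ 2 : K[X]).natDegree ≤ 2 := by compute_degree
    omega
  have hlin : g = C ∘ (cf g 0) + (X : K[X]) • (C ∘ cf g 1) := by
    ext1 i
    have := eq_X_add_C_of_natDegree_le_one (hdeg i)
    simp only [cf, Pi.add_apply, Function.comp, Pi.smul_apply, smul_eq_mul]
    conv_lhs => rw [this]
    ring
  have hex : Q (C ∘ a) g = C (Q a (cf g 0)) + C (2 * B a (cf g 0) (cf g 1)) * X
      + C (Q a (cf g 1)) * X ^ 2 := by
    conv_lhs => rw [hlin]
    rw [Q_add, Q_smul, B_smul_right, B_map, Q_map, Q_map]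
    simp only [map_mul, map_ofNat]
    ring
  rw [hQ] at hex
  have e0 := congrArg (coeff · 0) hex
  have e1 := congrArg (coeff · 1) hex
  have e2 := congrArg (coeff · 2) hex
  simp [coeff_X, coeff_C, coeff_X_pow] at e0 e1 e2
  refine ⟨e0.symm, e2.symm, ?_⟩
  tauto

/-- evaluation of a diagonal form given by a list -/
def ev {R : Type*} [CommRing R] : List R → (ℕ → R) → R
  | [], _ => 0
  | c :: l, x => c * x 0 ^ 2 + ev l (fun j => x (j + 1))

lemma ev_map {R S : Type*} [CommRing R] [CommRing S] (φ : R →+* S) (l : List R) (x : ℕ → R) :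
    ev (l.map φ) (φ ∘ x) = φ (ev l x) := by
  induction l generalizing x with
  | nil => simp [ev]
  | cons c l ih => 
    have := ih (fun j => x (j+1))
    simp only [List.map_cons, ev, Function.comp, map_add, map_mul, map_pow] at this ⊢
    rw [← this]; rfl

lemma ev_append {R : Type*} [CommRing R] (l l' : List R) (x : ℕ → R) :
    ev (l ++ l') x = ev l x + ev l' (fun j => x (j + l.length)) := by
  induction l generalizing x with
  | nil => simp [ev]
  | cons c l ih =>
    simp only [List.cons_append, ev, ih, List.length_cons]
    rw [add_assoc]
    congr 2

lemma ev_scale {R : Type*} [CommRing R] (a : R) (l : List R) (x : ℕ → R) :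
    ev (l.map (a * ·)) x = a * ev l x := by
  induction l generalizing x with
  | nil => simp [ev]
  | cons c l ih => simp only [List.map_cons, ev, ih]; ring

theorem generic_tower (K : Type u) [Field K] (h2 : (2 : K) ≠ 0) (m : ℕ) :
    ∃ (K' : Type u) (_ : Field K') (φ : K →+* K') (x : ℕ → K'),
      (∀ n (a : Fin n → K), Aniso a → Aniso (φ ∘ a)) ∧
      (∀ n (a : Fin n → K), Aniso a → ∀ (W : Submodule K (Fin n → K)) (c : K) (f : Fin n → K'),
        (∀ w ∈ W, B (φ ∘ a) f (φ ∘ w) = 0) → Q (φ ∘ a) f = φ c →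
        ∃ g : Fin n → K, (∀ w ∈ W, B a g w = 0) ∧ Q a g = c) ∧
      (∀ n (a : Fin n → K), Aniso a → ∀ (W : Submodule K (Fin n → K)) (f : Fin n → K'),
        (∀ w ∈ W, B (φ ∘ a) f (φ ∘ w) = 0) → ∀ cs : List K, cs.length = m → (∀ c ∈ cs, c ≠ 0) →
        Q (φ ∘ a) f = ev (cs.map φ) x → m + Module.finrank K W ≤ n) := by
  induction m with
  | zero =>
    refine ⟨K, inferInstance, RingHom.id K, fun _ => 0, fun n a h => h, ?_, ?_⟩
    · intro n a ha W c f hW hQ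
      exact ⟨f, hW, hQ⟩
    · intro n a ha W f _ cs _ _ _
      simpa using Submodule.finrank_le W
  | succ m ih =>
    obtain ⟨K', _, φ, x, hA, hR, hb⟩ := ih
    have h2' : (2 : K') ≠ 0 := by
      have := (map_ne_zero φ).mpr h2
      rwa [map_ofNat] at this
    refine ⟨RatFunc K', inferInstance, (cst K').comp φ,
      fun j => Nat.casesOn j (algebraMap K'[X] (RatFunc K') X) (fun j => cst K' (x j)), ?_, ?_, ?_⟩
    · intro n a ha
      exact aniso_ratfunc (hA n a ha)
    · intro n a ha W c f hW hQ
      obtain ⟨g, hg1, hg2⟩ := cassels_pfister (hA n a ha) {w' | ∃ w ∈ W, w' = φ ∘ w} (C (φ c)) f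
        (by rintro _ ⟨w, hw, rfl⟩; exact hW w hw) hQ
      refine hR n a ha W c ((evalRingHom (0 : K')) ∘ g) ?_ ?_
      · intro w hw
        have := congrArg (evalRingHom (0 : K')) (hg1 _ ⟨w, hw, rfl⟩)
        rw [← B_map, map_zero] at this
        convert this using 2 <;> (ext; simp)
      · have := congrArg (evalRingHom (0 : K')) hg2
        rw [← Q_map] at this
        convert this using 2
        · ext; simp
        · simp
    · intro n a ha W f hW cs hcs hne hQ
      obtain _ | ⟨c, cs⟩ := cs
      · simp at hcs
      have ha' := hA n a ha
      obtain ⟨g, hg1, hg2⟩ := cassels_pfister ha' {w' | ∃ w ∈ W, w' = φ ∘ w}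
        (C (ev (cs.map φ) x) + C (φ c) * X ^ 2) f
        (by rintro _ ⟨w, hw, rfl⟩; exact hW w hw) (by
          refine hQ.trans ?_
          simp only [List.map_cons, ev, map_add, map_mul, map_pow]
          rw [add_comm]
          congr 1
          change _ = cst K' _
          rw [← ev_map, List.map_map]; rfl)
      obtain ⟨hs, hc, hort⟩ := linear_of_quadratic h2' ha' _ _ g hg2
      have hcoef : ∀ k, ∀ w ∈ W, B (φ ∘ a) (cf g k) (φ ∘ w) = 0 := by
        intro k w hw
        have := congrArg (coeff · k) (hg1 _ ⟨w, hw, rfl⟩)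
        simp only [B, finsetSum_coeff, Function.comp, coeff_C_mul, coeff_mul_C, coeff_zero] at this
        exact this
      set u := cf g 0
      set v := cf g 1
      obtain ⟨w', hw'1, hw'2⟩ := hR n a ha W c v (hcoef 1) hc
      have hc0 : c ≠ 0 := hne c (by simp)
      have hw'φ : Q (φ ∘ a) (φ ∘ w') = φ c := by rw [Q_map, hw'2]
      -- reflect
      obtain ⟨u', hu'1, hu'2, hu'3⟩ : ∃ u' : Fin n → K', Q (φ ∘ a) u' = Q (φ ∘ a) u ∧
          B (φ ∘ a) u' (φ ∘ w') = 0 ∧ ∀ w ∈ W, B (φ ∘ a) u' (φ ∘ w) = 0 := by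
        by_cases hv : v = φ ∘ w'
        · exact ⟨u, rfl, hv ▸ hort, hcoef 0⟩
        set r := v - φ ∘ w' with hr
        have hr0 : Q (φ ∘ a) r ≠ 0 := fun h => hv (sub_eq_zero.mp (ha' _ h))
        have hQr : Q (φ ∘ a) r = 2 * φ c - 2 * B (φ ∘ a) v (φ ∘ w') := by
          rw [hr, Q_sub, hc, hw'φ]
          ring
        set t := 2 * B (φ ∘ a) u r / Q (φ ∘ a) r with ht
        have htr : t * Q (φ ∘ a) r = 2 * B (φ ∘ a) u r := by rw [ht]; field_simp
        refine ⟨u - t • r, ?_, ?_, ?_⟩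
        · rw [Q_sub, Q_smul, B_smul_right]
          linear_combination t * htr
        · have h1 : B (φ ∘ a) u r = - B (φ ∘ a) u (φ ∘ w') := by
            rw [hr, B_sub_right, hort, zero_sub]
          have h3 : B (φ ∘ a) r (φ ∘ w') = B (φ ∘ a) v (φ ∘ w') - φ c := by
            rw [hr, B_sub_left, B_self, hw'φ]
          have h4 : 2 * B (φ ∘ a) r (φ ∘ w') = - Q (φ ∘ a) r := by rw [h3, hQr]; ring
          rw [B_sub_left, B_smul_left]
          apply mul_left_cancel₀ h2'
          rw [h1] at htr
          linear_combination (-t) * h4 + htr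
        · intro w hw
          have h5 : B (φ ∘ a) (φ ∘ w') (φ ∘ w) = 0 := by rw [B_map, hw'1 w hw, map_zero]
          rw [B_sub_left, B_smul_left, hcoef 0 w hw, hr, B_sub_left, hcoef 1 w hw, h5]
          ring
      have hlt : W < W ⊔ Submodule.span K {w'} := by
        refine lt_of_le_of_ne le_sup_left fun h => ?_
        have : w' ∈ W := by
          rw [h]; exact Submodule.mem_sup_right (Submodule.mem_span_singleton_self w')
        have := hw'1 w' this
        rw [B_self, hw'2] at this
        exact hc0 this
      have hfin := Submodule.finrank_lt_finrank_of_lt hlt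
      have := hb n a ha (W ⊔ Submodule.span K {w'}) u' (by
        intro w hw
        obtain ⟨y, hy, z, hz, rfl⟩ := Submodule.mem_sup.mp hw
        obtain ⟨k, rfl⟩ := Submodule.mem_span_singleton.mp hz
        have e : φ ∘ (y + k • w') = φ ∘ y + φ k • (φ ∘ w') := by ext; simp
        rw [e, B_add_right, B_smul_right, hu'2, hu'3 y hy]; ring) cs (by simpa using hcs)
        (fun c hc => hne c (by simp [hc])) (by rw [hu'1, hs])
      omega
end forms
end WH
namespace WH
universe u
section hyp
variable {K : Type u} [Field K]
def Hyp {ι : Type*} [Fintype ι] (a : ι → K) : Prop :=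
  ∃ N : Submodule K (ι → K), Fintype.card ι ≤ 2 * Module.finrank K N ∧ ∀ x ∈ N, Q a x = 0

lemma Hyp.reindex {ι κ : Type*} [Fintype ι] [Fintype κ] (e : ι ≃ κ) {b : κ → K} (h : Hyp b) :
    Hyp (b ∘ e) := by
  obtain ⟨N, hN, hQ⟩ := h
  refine ⟨N.map (LinearEquiv.funCongrLeft K K e).toLinearMap, ?_, ?_⟩
  · rw [LinearEquiv.finrank_map_eq, Fintype.card_congr e]; exact hN
  · rintro _ ⟨x, hx, rfl⟩
    rw [← hQ x hx]
    simp only [Q]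
    exact Equiv.sum_comp e (fun j => b j * x j ^ 2)

lemma Q_sum {ι κ : Type*} [Fintype ι] [Fintype κ] (a : ι → K) (b : κ → K) (z : ι ⊕ κ → K) :
    Q (Sum.elim a b) z = Q a (fun i => z (.inl i)) + Q b (fun i => z (.inr i)) := by
  simp [Q]

lemma finrank_sprod {V W : Type*} [AddCommGroup V] [Module K V] [AddCommGroup W] [Module K W]
    [FiniteDimensional K V] [FiniteDimensional K W] (N : Submodule K V) (M : Submodule K W) :
    Module.finrank K (N.prod M) = Module.finrank K N + Module.finrank K M := by
  rw [← Module.finrank_prod]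
  refine LinearEquiv.finrank_eq
    { toFun := fun z => (⟨z.1.1, z.2.1⟩, ⟨z.1.2, z.2.2⟩)
      invFun := fun z => ⟨(z.1.1, z.2.1), z.1.2, z.2.2⟩
      map_add' := fun _ _ => rfl
      map_smul' := fun _ _ => rfl
      left_inv := fun _ => rfl
      right_inv := fun _ => rfl }

lemma Hyp.sum {ι κ : Type*} [Fintype ι] [Fintype κ] {a : ι → K} {b : κ → K}
    (ha : Hyp a) (hb : Hyp b) : Hyp (Sum.elim a b) := by
  obtain ⟨N, hN, hQ⟩ := ha
  obtain ⟨M, hM, hQ'⟩ := hb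
  refine ⟨(N.prod M).map (LinearEquiv.sumArrowLequivProdArrow ι κ K K).symm.toLinearMap, ?_, ?_⟩
  · rw [LinearEquiv.finrank_map_eq, Fintype.card_sum, finrank_sprod]; omega
  · rintro _ ⟨⟨x, y⟩, ⟨hx, hy⟩, rfl⟩
    rw [Q_sum]
    have h1 := hQ x hx
    have h2 := hQ' y hy
    rw [← add_zero (0 : K)]
    exact congrArg₂ (· + ·) h1 h2

lemma Hyp.scale {ι : Type*} [Fintype ι] {a : ι → K} (c : K) (ha : Hyp a) : Hyp (fun i => c * a i) := by
  obtain ⟨N, hN, hQ⟩ := ha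
  refine ⟨N, hN, fun x hx => ?_⟩
  have := hQ x hx
  simp only [Q, mul_assoc, ← Finset.mul_sum] at this ⊢
  rw [this, mul_zero]

lemma polar {ι : Type*} [Fintype ι] (h2 : (2 : K) ≠ 0) {a : ι → K} {N : Submodule K (ι → K)}
    (h : ∀ x ∈ N, Q a x = 0) {x y : ι → K} (hx : x ∈ N) (hy : y ∈ N) : B a x y = 0 := by
  have := h _ (N.add_mem hx hy)
  rw [Q_add, h x hx, h y hy] at this
  simpa [h2] using this

/-- the bilinear form as a bundled object -/
def Bl {ι : Type*} [Fintype ι] (a : ι → K) : LinearMap.BilinForm K (ι → K) :=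
  LinearMap.mk₂ K (B a) (fun x y z => B_add_left a x y z) (fun r x z => B_smul_left a r x z)
    (fun z x y => B_add_right a x y z) (fun r z x => B_smul_right a r x z)

lemma B_nondeg {ι : Type*} [Fintype ι] {a : ι → K} (ha : ∀ i, a i ≠ 0) (x : ι → K)
    (h : ∀ y, B a x y = 0) : x = 0 := by
  classical
  ext i
  have := h (Pi.single i 1)
  simpa [B, Pi.single_apply, ha i] using this

lemma Bl_nondeg {ι : Type*} [Fintype ι] {a : ι → K} (ha : ∀ i, a i ≠ 0) : (Bl a).Nondegenerate :=
  ⟨fun x h => B_nondeg ha x h, fun y h => B_nondeg ha y fun x => by rw [B_comm]; exact h x⟩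

lemma Hyp.cancel {ι κ : Type*} [Fintype ι] [Fintype κ] (h2 : (2 : K) ≠ 0) {a : ι → K} {b : κ → K}
    (ha0 : ∀ i, a i ≠ 0) (hb0 : ∀ i, b i ≠ 0)
    (hab : Hyp (Sum.elim a b)) (hb : Hyp b) : Hyp a := by
  obtain ⟨N, hN, hQ⟩ := hab
  obtain ⟨M, hM, hQ'⟩ := hb
  set e := LinearEquiv.sumArrowLequivProdArrow ι κ K K with he
  set P : Submodule K (ι ⊕ κ → K) := ((⊤ : Submodule K (ι → K)).prod M).map e.symm.toLinearMap
  set Z : Submodule K (ι ⊕ κ → K) := ((⊥ : Submodule K (ι → K)).prod M).map e.symm.toLinearMap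
  have hP : Module.finrank K P = Fintype.card ι + Module.finrank K M := by
    rw [LinearEquiv.finrank_map_eq, finrank_sprod]; simp
  have memP : ∀ z, z ∈ P → (fun j => z (.inr j)) ∈ M := by
    rintro _ ⟨⟨x, y⟩, ⟨-, hy⟩, rfl⟩; exact hy
  have memZ : ∀ z : ι ⊕ κ → K, (fun i => z (.inl i)) = 0 → (fun j => z (.inr j)) ∈ M → z ∈ Z := by
    intro z h1 h3
    refine ⟨(0, fun j => z (.inr j)), ⟨by simp, h3⟩, ?_⟩
    ext (i | j)
    · exact (congrFun h1 i).symm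
    · rfl
  have Zmem : ∀ z ∈ Z, (fun i => z (.inl i)) = 0 ∧ (fun j => z (.inr j)) ∈ M := by
    rintro _ ⟨⟨x, y⟩, ⟨hx, hy⟩, rfl⟩; exact ⟨(Submodule.mem_bot K).mp hx, hy⟩
  set ab := Sum.elim a b
  have hab0 : ∀ i, ab i ≠ 0 := by rintro (i | i); exacts [ha0 i, hb0 i]
  set S := N ⊓ Z
  have hle : N ⊔ P ≤ (Bl ab).orthogonal S := by
    refine sup_le ?_ ?_
    · intro z hz s hs
      exact polar h2 hQ hs.1 hz
    · intro z hz s hs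
      obtain ⟨h1, h3⟩ := Zmem s hs.2
      have h4 := memP z hz
      change B ab s z = 0
      have : B ab s z = B a (fun i => s (.inl i)) (fun i => z (.inl i)) +
        B b (fun i => s (.inr i)) (fun i => z (.inr i)) := by simp [B, ab]
      rw [this, h1, B_zero_left, polar h2 hQ' h3 h4, add_zero]
  have hd1 := Submodule.finrank_mono hle
  rw [LinearMap.BilinForm.finrank_orthogonal (Bl_nondeg hab0)] at hd1
  have hS := Submodule.finrank_le S
  have hd2 := Submodule.finrank_sup_add_finrank_inf_eq N P
  set p : (ι ⊕ κ → K) →ₗ[K] (ι → K) := LinearMap.funLeft K K Sum.inl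
  set T := N ⊓ P
  have hd3 := LinearMap.finrank_range_add_finrank_ker (p.domRestrict T)
  have hker : Module.finrank K (LinearMap.ker (p.domRestrict T)) ≤ Module.finrank K S := by
    rw [← Submodule.finrank_map_subtype_eq T]
    apply Submodule.finrank_mono
    rintro _ ⟨⟨z, hz⟩, hk, rfl⟩
    exact ⟨hz.1, memZ z hk (memP z hz.2)⟩
  refine ⟨LinearMap.range (p.domRestrict T), ?_, ?_⟩
  · rw [Module.finrank_fintype_fun_eq_card, Fintype.card_sum] at *
    omega
  · rintro _ ⟨⟨z, hz⟩, rfl⟩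
    have h1 := hQ z hz.1
    have h3 := hQ' _ (memP z hz.2)
    rw [Q_sum, h3, add_zero] at h1
    exact h1

lemma exists_equiv {ι κ T : Type*} [Fintype ι] [Fintype κ] (a : ι → T) (b : κ → T)
    (h : Finset.univ.val.map a = Finset.univ.val.map b) : ∃ e : ι ≃ κ, a = b ∘ e := by
  classical
  have key : ∀ t, Nonempty ({i // a i = t} ≃ {j // b j = t}) := by
    intro t
    apply Fintype.card_eq.mp
    have := congrArg (Multiset.count t) h
    rw [Multiset.count_map, Multiset.count_map] at this
    rw [Fintype.card_subtype, Fintype.card_subtype]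
    simpa [Finset.card_def, Finset.filter_val, eq_comm] using this
  have f : ∀ t, {i // a i = t} ≃ {j // b j = t} := fun t => (key t).some
  refine ⟨(Equiv.sigmaFiberEquiv a).symm.trans
    ((Equiv.sigmaCongrRight f).trans (Equiv.sigmaFiberEquiv b)), ?_⟩
  ext1 i
  exact (f (a i) ⟨i, rfl⟩).2.symm

def HypM (M : Multiset Kˣ) : Prop :=
  ∃ (n : ℕ) (a : Fin n → Kˣ), Finset.univ.val.map a = M ∧ Hyp (fun i => (a i : K))

lemma HypM.hyp {ι : Type*} [Fintype ι] {a : ι → Kˣ} (h : HypM (Finset.univ.val.map a)) :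
    Hyp (fun i => (a i : K)) := by
  obtain ⟨n, b, hb, h⟩ := h
  obtain ⟨e, rfl⟩ := exists_equiv a b hb.symm
  exact h.reindex e

lemma hypM_of {ι : Type*} [Fintype ι] {a : ι → Kˣ} (h : Hyp (fun i => (a i : K))) :
    HypM (Finset.univ.val.map a) := by
  refine ⟨Fintype.card ι, a ∘ (Fintype.equivFin ι).symm, ?_, h.reindex _⟩
  rw [← Multiset.map_map, Multiset.map_univ_val_equiv]

lemma exists_fam (M : Multiset Kˣ) : ∃ (n : ℕ) (a : Fin n → Kˣ), Finset.univ.val.map a = M := by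
  induction M using Quot.inductionOn with
  | _ l =>
    refine ⟨l.length, l.get, ?_⟩
    simp only [Fin.univ_val_map, List.ofFn_get]; rfl

lemma map_sum_univ {ι κ T : Type*} [Fintype ι] [Fintype κ] (a : ι → T) (b : κ → T) :
    Finset.univ.val.map (Sum.elim a b) = Finset.univ.val.map a + Finset.univ.val.map b := by
  have : (Finset.univ : Finset (ι ⊕ κ)).val = Finset.univ.val.map Sum.inl + Finset.univ.val.map Sum.inr := by
    rw [← Finset.univ_disjSum_univ]; rfl
  rw [this, Multiset.map_add, Multiset.map_map, Multiset.map_map]; rfl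

lemma elim_coe {ι κ : Type*} (a : ι → Kˣ) (b : κ → Kˣ) : (fun i => ((Sum.elim a b i : Kˣ) : K)) =
    Sum.elim (fun i => (a i : K)) (fun i => (b i : K)) := by
  ext (i | i) <;> rfl

lemma HypM.add {A C : Multiset Kˣ} (hA : HypM A) (hC : HypM C) : HypM (A + C) := by
  obtain ⟨n, a, rfl⟩ := exists_fam A
  obtain ⟨m, c, rfl⟩ := exists_fam C
  rw [← map_sum_univ]
  apply hypM_of
  rw [elim_coe]
  exact hA.hyp.sum hC.hyp

lemma HypM.cancel (h2 : (2 : K) ≠ 0) {A C : Multiset Kˣ} (hA : HypM (A + C)) (hC : HypM C) : HypM A := by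
  obtain ⟨n, a, rfl⟩ := exists_fam A
  obtain ⟨m, c, rfl⟩ := exists_fam C
  rw [← map_sum_univ] at hA
  have := hA.hyp
  rw [elim_coe] at this
  exact hypM_of (this.cancel h2 (fun i => (a i).ne_zero) (fun i => (c i).ne_zero) hC.hyp)

lemma HypM.scale {A : Multiset Kˣ} (hA : HypM A) (g : Kˣ) : HypM (A.map (g * ·)) := by
  obtain ⟨n, a, rfl⟩ := exists_fam A
  rw [Multiset.map_map]
  apply hypM_of
  exact hA.hyp.scale (g : K)

lemma hypM_zero : HypM (0 : Multiset Kˣ) :=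
  ⟨0, Fin.elim0, by simp, ⊥, by simp, by simp [Q]⟩

lemma hypM_pair (i : K) (hi : i ^ 2 = -1) (a b : Kˣ) : HypM ({a, a * b * b} : Multiset Kˣ) := by
  refine ⟨2, ![a, a * b * b], by simp [Fin.univ_val_map]; rfl, Submodule.span K {![(b : K) , i]}, ?_, ?_⟩
  · rw [finrank_span_singleton]
    · simp
    · intro h; simpa using congrFun h 0
  · intro x hx
    obtain ⟨r, rfl⟩ := Submodule.mem_span_singleton.mp hx
    simp [Q]
    linear_combination (a : K) * b ^ 2 * r ^ 2 * hi

lemma hypM_quad (h2 : (2 : K) ≠ 0) (i : K) (hi : i ^ 2 = -1) (a b c : Kˣ) (h : (a : K) + b = c) :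
    HypM ({a, b, c, a * b * c} : Multiset Kˣ) := by
  refine ⟨4, ![a, b, c, a * b * c], by simp [Fin.univ_val_map]; rfl,
    Submodule.span K (Set.range ![![(1 : K), 1, i, 0], ![(b : K), -a, 0, i]]), ?_, ?_⟩
  · have hi0 : i ≠ 0 := by rintro rfl; simp at hi
    rw [finrank_span_eq_card]
    · simp
    · rw [LinearIndependent.pair_iff]
      intro s t hst
      have e2 := congrFun hst 2
      have e3 := congrFun hst 3
      simp [hi0] at e2 e3
      exact ⟨e2, e3⟩
  · intro x hx
    rw [Matrix.range_cons, Matrix.range_cons, Matrix.range_empty, Set.union_empty] at hx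
    obtain ⟨s, t, rfl⟩ := Submodule.mem_span_pair.mp hx
    simp [Q, Fin.sum_univ_four]
    rw [← h]
    linear_combination ((a + b : K) * s ^ 2 + a * b * (a + b) * t ^ 2) * hi

lemma hypM_double (i : K) (hi : i ^ 2 = -1) (R : Multiset Kˣ) : HypM (2 • R) := by
  induction R using Multiset.induction_on with
  | empty => simpa using hypM_zero
  | cons a R ih =>
    have : (2 • (a ::ₘ R) : Multiset Kˣ) = {a, a * 1 * 1} + 2 • R := by
      rw [← Multiset.singleton_add, nsmul_add]; congr 1; rw [two_nsmul]; simp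
    rw [this]
    exact (hypM_pair i hi a 1).add ih

/-- transfer along a quadratic extension -/
lemma Hyp.transfer {L : Type*} [Field L] [Algebra K L] {n : ℕ} (a : Fin n → K) (d : K) (δ : L)
    (hδ : δ ^ 2 = algebraMap K L d) (bas : Module.Basis (Fin 2) K L) (hb0 : bas 0 = 1) (hb1 : bas 1 = δ)
    (h : Hyp (algebraMap K L ∘ a)) : Hyp (Sum.elim a (fun i => d * a i)) := by
  obtain ⟨N, hN, hQ⟩ := h
  have : FiniteDimensional K L := Module.Basis.finiteDimensional_of_finite bas
  have hrk : Module.finrank K L = 2 := by simpa using Module.finrank_eq_card_basis bas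
  let p : (Fin n → L) →ₗ[K] (Fin n ⊕ Fin n → K) :=
    { toFun := fun w => Sum.elim (fun i => bas.repr (w i) 0) (fun i => bas.repr (w i) 1)
      map_add' := by intro x y; ext (i | i) <;> simp
      map_smul' := by intro r y; ext (i | i) <;> simp }
  have hrep : ∀ y : L, y = algebraMap K L (bas.repr y 0) + algebraMap K L (bas.repr y 1) * δ := by
    intro y
    conv_lhs => rw [← bas.sum_repr y]
    simp [Fin.sum_univ_two, hb0, hb1, Algebra.smul_def]
  have hp : Function.Injective p := by
    intro x y hxy
    ext i
    rw [hrep (x i), hrep (y i)]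
    have e0 := congrFun hxy (.inl i)
    have e1 := congrFun hxy (.inr i)
    simp only [p, LinearMap.coe_mk, AddHom.coe_mk, Sum.elim_inl, Sum.elim_inr] at e0 e1
    rw [e0, e1]
  refine ⟨(N.restrictScalars K).map p, ?_, ?_⟩
  · rw [← LinearEquiv.finrank_eq (Submodule.equivMapOfInjective p hp _)]
    have h3 : Module.finrank K (N.restrictScalars K) = Module.finrank K L * Module.finrank L N :=
      (Module.finrank_mul_finrank K L N).symm
    rw [h3, hrk, Fintype.card_sum]
    rw [Fintype.card_fin] at hN ⊢
    omega
  · rintro _ ⟨w, hw, rfl⟩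
    have h1 := hQ w hw
    have e : algebraMap K L (Q (Sum.elim a (fun i => d * a i)) (p w)) +
      algebraMap K L (2 * ∑ i, a i * (bas.repr (w i) 0 * bas.repr (w i) 1)) * δ = 0 := by
      rw [← h1]
      rw [Q_sum]
      simp only [Q, p, LinearMap.coe_mk, AddHom.coe_mk, Sum.elim_inl, Sum.elim_inr, map_add, map_sum, map_mul, map_pow,
        Function.comp, Finset.sum_mul, Finset.mul_sum, ← Finset.sum_add_distrib]
      refine Finset.sum_congr rfl fun i _ => ?_
      conv_rhs => rw [hrep (w i)]
      rw [← hδ, map_ofNat]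
      ring
    have := congrArg (fun y => bas.repr y 0) e
    have e1 : ∀ k : K, algebraMap K L k = k • bas 0 := by intro k; rw [hb0, Algebra.smul_def, mul_one]
    have e2 : ∀ k : K, algebraMap K L k * δ = k • bas 1 := by intro k; rw [hb1, Algebra.smul_def]
    rw [e1, e2] at this
    simpa using this

lemma Hyp.represents {n : ℕ} {a : Fin n → K} (ha : Aniso a) (d : K)
    (h : Hyp (Sum.elim a (fun i => d * a i))) (j : Fin n) : ∃ v, Q a v = - (d * a j) := by
  obtain ⟨N, hN, hQ⟩ := h
  rw [Fintype.card_sum, Fintype.card_fin] at hN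
  let p : N →ₗ[K] (Fin n → K) := (LinearMap.funLeft K K Sum.inr).comp N.subtype
  have hinj : Function.Injective p := by
    rw [injective_iff_map_eq_zero]
    rintro ⟨z, hz⟩ h0
    have h0' : (fun i => z (.inr i)) = 0 := h0
    have h1 := hQ z hz
    rw [Q_sum, h0', Q_zero, add_zero] at h1
    have h3 := ha _ h1
    ext (i | i)
    · exact congrFun h3 i
    · exact congrFun h0 i
  have hsurj : Function.Surjective p := by
    have h1 := LinearMap.finrank_le_finrank_of_injective hinj
    rw [Module.finrank_fintype_fun_eq_card, Fintype.card_fin] at h1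
    exact (LinearMap.injective_iff_surjective_of_finrank_eq_finrank (by simp; omega)).mp hinj
  obtain ⟨⟨z, hz⟩, hzj⟩ := hsurj (Pi.single j 1)
  have h1 := hQ z hz
  have h3 : (fun i => z (.inr i)) = Pi.single j 1 := hzj
  rw [Q_sum, h3] at h1
  refine ⟨fun i => z (.inl i), ?_⟩
  have : Q (fun i => d * a i) (Pi.single j 1) = d * a j := by
    simp [Q, Pi.single_apply]
  rw [this] at h1
  linear_combination h1
end hyp
end WH
namespace WH
universe u v
section witt
variable {K : Type u} [Field K]

noncomputable def mkW (K : Type u) [Field K] : MonoidAlgebra ℤ Kˣ →+* WittRing K :=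
  Ideal.Quotient.mk (wittIdeal K)

lemma mkW_gen (a : Kˣ) : mkW K (wittGen K a) = diagForm a := rfl

lemma mkW_surj : Function.Surjective (mkW K) := Ideal.Quotient.mk_surjective

lemma mkW_zero (z : MonoidAlgebra ℤ Kˣ) : mkW K z = 0 ↔ z ∈ wittIdeal K :=
  Ideal.Quotient.eq_zero_iff_mem

lemma diag_mul (a b : Kˣ) : diagForm (a * b) = diagForm a * diagForm b := by
  simp only [← mkW_gen, ← map_mul, wittGen]

lemma diag_one : diagForm (1 : Kˣ) = 1 := by
  simp only [← mkW_gen, map_one, wittGen]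

lemma diag_sq (a b : Kˣ) : diagForm (a * b * b) = diagForm a := by
  symm
  rw [← sub_eq_zero, ← mkW_gen, ← mkW_gen, ← map_sub, mkW_zero]
  exact Ideal.subset_span (Or.inl (Or.inl ⟨a, b, rfl⟩))

lemma diag_add (a b c : Kˣ) (h : (a : K) + b = c) :
    diagForm a + diagForm b = diagForm c + diagForm (a * b * c) := by
  rw [← sub_eq_zero]
  simp only [← mkW_gen]
  rw [← map_add, ← map_add, ← map_sub, mkW_zero]
  exact Ideal.subset_span (Or.inl (Or.inr ⟨a, b, c, h, by ring⟩))

lemma diag_one_neg_one : diagForm (1 : Kˣ) + diagForm (-1) = 0 := by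
  simp only [← mkW_gen]
  rw [← map_add, mkW_zero]
  exact Ideal.subset_span (Or.inr rfl)

lemma diag_neg (a : Kˣ) : diagForm (-a) = - diagForm a := by
  have h := diag_one_neg_one (K := K)
  have : diagForm (-a) = diagForm (-1) * diagForm a := by rw [← diag_mul]; simp
  rw [this]
  rw [diag_one] at h
  linear_combination diagForm a * h

noncomputable def wmap0 {L : Type v} [Field L] (φ : K →+* L) : MonoidAlgebra ℤ Kˣ →+* WittRing L :=
  (mkW L).comp (MonoidAlgebra.mapDomainRingHom ℤ (Units.map (φ : K →* L)))

lemma wmap0_gen {L : Type v} [Field L] (φ : K →+* L) (a : Kˣ) :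
    wmap0 φ (wittGen K a) = diagForm (Units.map (φ : K →* L) a) := by
  rw [← mkW_gen, wmap0, RingHom.comp_apply]
  congr 1
  simp [wittGen]

lemma wmap0_ker {L : Type v} [Field L] (φ : K →+* L) (z : MonoidAlgebra ℤ Kˣ)
    (hz : z ∈ wittIdeal K) : wmap0 φ z = 0 := by
  have hle : wittIdeal K ≤ RingHom.ker (wmap0 φ) := by
    refine Ideal.span_le.mpr ?_
    rintro x ((⟨a, b, rfl⟩ | ⟨a, b, c, h, rfl⟩) | h)
    · rw [SetLike.mem_coe, RingHom.mem_ker, map_sub, wmap0_gen, wmap0_gen, map_mul, map_mul]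
      exact sub_eq_zero.mpr (diag_sq _ _).symm
    · rw [SetLike.mem_coe, RingHom.mem_ker]
      have := diag_add (Units.map (φ : K →* L) a) (Units.map (φ : K →* L) b)
        (Units.map (φ : K →* L) c) (by simp [← h])
      simp only [map_sub, map_add, wmap0_gen, map_mul] at this ⊢
      linear_combination this
    · rw [Set.mem_singleton_iff.mp h, SetLike.mem_coe, RingHom.mem_ker, map_add, wmap0_gen,
        wmap0_gen]
      have : Units.map (φ : K →* L) (-1) = -1 := by ext; simp
      rw [this, map_one]
      exact diag_one_neg_one
  exact hle hz

/-- functoriality -/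
noncomputable def wmap {L : Type v} [Field L] (φ : K →+* L) : WittRing K →+* WittRing L :=
  Ideal.Quotient.lift (wittIdeal K) (wmap0 φ) (wmap0_ker φ)

lemma wmap_diag {L : Type v} [Field L] (φ : K →+* L) (a : Kˣ) :
    wmap φ (diagForm a) = diagForm (Units.map (φ : K →* L) a) := by
  refine (Ideal.Quotient.lift_mk (wittIdeal K) _ _).trans ?_
  exact wmap0_gen φ a

lemma exists_sum (z : WittRing K) : ∃ (n : ℕ) (a : Fin n → Kˣ), z = ∑ i, diagForm (a i) := by
  have hadd : ∀ x y : WittRing K, (∃ (n : ℕ) (a : Fin n → Kˣ), x = ∑ i, diagForm (a i)) →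
     (∃ (n : ℕ) (a : Fin n → Kˣ), y = ∑ i, diagForm (a i)) →
     (∃ (n : ℕ) (a : Fin n → Kˣ), x + y = ∑ i, diagForm (a i)) := by
    rintro _ _ ⟨n, a, rfl⟩ ⟨m, b, rfl⟩
    exact ⟨n + m, Fin.append a b, by simp [Fin.sum_univ_add]⟩
  have hneg : ∀ x : WittRing K, (∃ (n : ℕ) (a : Fin n → Kˣ), x = ∑ i, diagForm (a i)) →
     (∃ (n : ℕ) (a : Fin n → Kˣ), -x = ∑ i, diagForm (a i)) := by
    rintro _ ⟨n, a, rfl⟩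
    exact ⟨n, fun i => - a i, by simp [diag_neg]⟩
  obtain ⟨z, rfl⟩ := mkW_surj z
  induction z using MonoidAlgebra.induction_on with
  | of m => exact ⟨1, fun _ => m, by simp; rfl⟩
  | add x y hx hy => rw [map_add]; exact hadd _ _ hx hy
  | smul r x hx =>
    rw [map_zsmul]
    induction r using Int.induction_on with
    | zero => exact ⟨0, Fin.elim0, by simp⟩
    | succ r ih => rw [add_smul, one_smul]; exact hadd _ _ ih hx
    | pred r ih => rw [sub_smul, one_smul, sub_eq_add_neg]; exact hadd _ _ ih (hneg _ hx)

lemma extract : ∀ (n : ℕ) (a : Fin (n + 1) → Kˣ) (x : Fin (n + 1) → K) (c : Kˣ),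
    Q (fun i => (a i : K)) x = c →
    ∃ b : Fin n → Kˣ, ∑ i, diagForm (a i) = diagForm c + ∑ i, diagForm (b i) := by
  intro n
  induction n with
  | zero =>
    intro a x c h
    simp [Q] at h
    have hx : x 0 ≠ 0 := by intro h0; simp [h0] at h; exact c.ne_zero h.symm
    refine ⟨Fin.elim0, ?_⟩
    have : c = a 0 * Units.mk0 _ hx * Units.mk0 _ hx := by ext; simp [← h]; ring
    simp [this, diag_sq]
  | succ n ih =>
    intro a x c h
    have hs : Q (fun i => (a i : K)) x = a 0 * x 0 ^ 2 +
      Q (fun i => ((Fin.tail a i : Kˣ) : K)) (Fin.tail x) := by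
      simp only [Q]; rw [Fin.sum_univ_succ]; rfl
    rw [hs] at h
    have hsum : ∑ i, diagForm (a i) = diagForm (a 0) + ∑ i, diagForm (Fin.tail a i) := by
      rw [Fin.sum_univ_succ]; rfl
    rw [hsum]
    by_cases ht : Q (fun i => ((Fin.tail a i : Kˣ) : K)) (Fin.tail x) = 0
    · rw [ht, add_zero] at h
      have hx : x 0 ≠ 0 := by intro h0; simp [h0] at h; exact c.ne_zero h.symm
      refine ⟨Fin.tail a, ?_⟩
      have : c = a 0 * Units.mk0 _ hx * Units.mk0 _ hx := by ext; simp [← h]; ring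
      rw [this, diag_sq]
    · obtain ⟨b, hb⟩ := ih (Fin.tail a) (Fin.tail x) (Units.mk0 _ ht) rfl
      rw [hb]
      by_cases hx : x 0 = 0
      · have hc : c = Units.mk0 _ ht := by ext; simp [← h, hx]
        refine ⟨Fin.cons (a 0) b, ?_⟩
        rw [Fin.sum_univ_succ]
        simp only [Fin.cons_zero, Fin.cons_succ, ← hc]
        ring
      · have := diag_add (a 0 * Units.mk0 _ hx * Units.mk0 _ hx) (Units.mk0 _ ht) c (by simp [← h]; ring)
        rw [diag_sq] at this
        refine ⟨Fin.cons (a 0 * Units.mk0 _ hx * Units.mk0 _ hx * (Units.mk0 _ ht) * c) b, ?_⟩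
        rw [Fin.sum_univ_succ]
        simp only [Fin.cons_zero, Fin.cons_succ]
        linear_combination this

lemma reduce : ∀ (n : ℕ) (a : Fin n → Kˣ) (x : Fin n → K), x ≠ 0 → Q (fun i => (a i : K)) x = 0 →
    ∃ m < n, ∃ b : Fin m → Kˣ, ∑ i, diagForm (a i) = ∑ i, diagForm (b i) := by
  intro n
  induction n with
  | zero => intro a x hx; exact absurd (Subsingleton.elim _ _) hx
  | succ n ih =>
    intro a x hx h
    have hs : Q (fun i => (a i : K)) x = a 0 * x 0 ^ 2 +
      Q (fun i => ((Fin.tail a i : Kˣ) : K)) (Fin.tail x) := by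
      simp only [Q]; rw [Fin.sum_univ_succ]; rfl
    rw [hs] at h
    have hsum : ∑ i, diagForm (a i) = diagForm (a 0) + ∑ i, diagForm (Fin.tail a i) := by
      rw [Fin.sum_univ_succ]; rfl
    rw [hsum]
    by_cases h0 : x 0 = 0
    · have hx' : Fin.tail x ≠ 0 := by
        intro ht
        apply hx
        ext i
        refine Fin.cases h0 (fun j => congrFun ht j) i
      rw [h0] at h
      obtain ⟨m, hm, b, hb⟩ := ih (Fin.tail a) (Fin.tail x) hx' (by simpa using h)
      refine ⟨m + 1, by omega, Fin.cons (a 0) b, ?_⟩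
      rw [hb, Fin.sum_univ_succ]; simp
    · set c : Kˣ := a 0 * Units.mk0 _ h0 * Units.mk0 _ h0
      obtain _ | n := n
      · simp [Q] at h
        exact absurd h h0
      obtain ⟨b, hb⟩ := extract n (Fin.tail a) (Fin.tail x) (-c) (by
        simp [c]; linear_combination h)
      refine ⟨n, by omega, b, ?_⟩
      rw [hb, diag_neg, diag_sq]; ring

lemma exists_aniso (n : ℕ) (a : Fin n → Kˣ) : ∃ m ≤ n, ∃ b : Fin m → Kˣ,
    Aniso (fun i => (b i : K)) ∧ ∑ i, diagForm (a i) = ∑ i, diagForm (b i) := by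
  induction n using Nat.strong_induction_on with
  | _ n ih =>
  by_cases h : Aniso (fun i => (a i : K))
  · exact ⟨n, le_rfl, a, h, rfl⟩
  · simp only [Aniso, not_forall] at h
    obtain ⟨x, hx, h0⟩ := h
    obtain ⟨m, hm, b, hb⟩ := reduce n a x h0 hx
    obtain ⟨k, hk, c, hc, hc'⟩ := ih m hm b
    exact ⟨k, by omega, c, hc, hb.trans hc'⟩

/-- sum of generators in the group ring -/
noncomputable def gs (M : Multiset Kˣ) : MonoidAlgebra ℤ Kˣ := (M.map (wittGen K)).sum

lemma gs_add (M N : Multiset Kˣ) : gs (M + N) = gs M + gs N := by simp [gs]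

lemma gs_scale (g : Kˣ) (M : Multiset Kˣ) : gs (M.map (g * ·)) = wittGen K g * gs M := by
  simp only [gs, Multiset.map_map, ← Multiset.sum_map_mul_left]
  congr 1
  refine Multiset.map_congr rfl fun x _ => ?_
  simp [wittGen]

lemma gs_coeff [DecidableEq Kˣ] (M : Multiset Kˣ) (g : Kˣ) : (gs M).coeff g = M.count g := by
  induction M using Multiset.induction_on with
  | empty => simp [gs]
  | cons a M ih =>
    rw [← Multiset.singleton_add, gs_add, Multiset.count_add]
    simp only [MonoidAlgebra.coeff_add, Finsupp.add_apply, ih, Nat.cast_add]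
    congr 1
    simp [gs, wittGen, Multiset.count_singleton, Finsupp.single_apply, eq_comm]

def Good (z : MonoidAlgebra ℤ Kˣ) : Prop := ∃ M : Multiset Kˣ, HypM M ∧ ∃ y, z = gs M + 2 * y

lemma Good.add {z w : MonoidAlgebra ℤ Kˣ} (hz : Good z) (hw : Good w) : Good (z + w) := by
  obtain ⟨M, hM, y, rfl⟩ := hz
  obtain ⟨N, hN, x, rfl⟩ := hw
  exact ⟨M + N, hM.add hN, y + x, by rw [gs_add]; ring⟩

lemma Good.neg {z : MonoidAlgebra ℤ Kˣ} (hz : Good z) : Good (-z) := by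
  obtain ⟨M, hM, y, rfl⟩ := hz
  exact ⟨M, hM, -y - gs M, by ring⟩

lemma Good.smul {z : MonoidAlgebra ℤ Kˣ} (hz : Good z) (r : MonoidAlgebra ℤ Kˣ) : Good (r * z) := by
  induction r using MonoidAlgebra.induction_on with
  | of m =>
    obtain ⟨M, hM, y, rfl⟩ := hz
    exact ⟨M.map (m * ·), hM.scale m, wittGen K m * y, by rw [gs_scale]; simp only [wittGen]; ring⟩
  | add x y hx hy => rw [add_mul]; exact hx.add hy
  | smul r x hx =>
    rw [smul_mul_assoc]
    induction r using Int.induction_on with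
    | zero => exact ⟨0, hypM_zero, 0, by simp [gs]⟩
    | succ r ih => rw [add_smul, one_smul]; exact ih.add hx
    | pred r ih => rw [sub_smul, one_smul, sub_eq_add_neg]; exact ih.add hx.neg

lemma good_of_mem (h2 : (2 : K) ≠ 0) (i : K) (hi : i ^ 2 = -1) (z : MonoidAlgebra ℤ Kˣ) (hz : z ∈ wittIdeal K) :
    Good z := by
  induction hz using Submodule.span_induction with
  | mem x h =>
    rcases h with (⟨a, b, rfl⟩ | ⟨a, b, c, h, rfl⟩) | h
    · exact ⟨_, hypM_pair i hi a b, - wittGen K (a * b * b), by simp [gs]; ring⟩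
    · exact ⟨_, hypM_quad h2 i hi a b c h, - wittGen K c - wittGen K (a * b * c), by simp [gs]; ring⟩
    · have hi0 : i ≠ 0 := by rintro rfl; simp at hi
      refine ⟨_, hypM_pair i hi 1 (Units.mk0 i hi0), 0, ?_⟩
      have : (1 * Units.mk0 i hi0 * Units.mk0 i hi0 : Kˣ) = -1 := by
        ext; simp [← hi, pow_two]
      rw [Set.mem_singleton_iff.mp h, this]; simp [gs]
  | zero => exact ⟨0, hypM_zero, 0, by simp [gs]⟩
  | add x y _ _ hx hy => exact hx.add hy
  | smul r x _ hx => exact hx.smul r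

lemma hypM_of_good (h2 : (2 : K) ≠ 0) (i : K) (hi : i ^ 2 = -1) (M : Multiset Kˣ) (h : Good (gs M)) :
    HypM M := by
  classical
  obtain ⟨N, hN, y, hy⟩ := h
  refine HypM.cancel h2 (C := N) ?_ hN
  obtain ⟨R, hR⟩ := Multiset.exists_smul_of_dvd_count (M + N) (k := 2) (by
    intro g _
    have h1 := congrArg (fun z : MonoidAlgebra ℤ Kˣ => z.coeff g) hy
    simp only [two_mul, MonoidAlgebra.coeff_add, Finsupp.add_apply, gs_coeff] at h1
    rw [Multiset.count_add]
    omega)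
  rw [hR]
  exact hypM_double i hi R

theorem hyp_of_zero (h2 : (2 : K) ≠ 0) (i : K) (hi : i ^ 2 = -1) {n : ℕ} (a : Fin n → Kˣ)
    (h : ∑ j, diagForm (a j) = 0) : Hyp (fun j => (a j : K)) := by
  have : gs (Finset.univ.val.map a) ∈ wittIdeal K := by
    apply Ideal.Quotient.eq_zero_iff_mem.mp
    refine Eq.trans ?_ h
    simp only [gs, Multiset.map_map]
    exact map_sum (Ideal.Quotient.mk (wittIdeal K)) (fun j => wittGen K (a j)) Finset.univ
  exact (hypM_of_good h2 i hi _ (good_of_mem h2 i hi _ this)).hyp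

end witt
end WH
namespace WH
universe u v
section pfister
variable {K : Type u} [Field K]

def pf : List Kˣ → List K
  | [] => [1]
  | a :: t => pf t ++ (pf t).map ((a : K) * ·)

noncomputable def pfW (t : List Kˣ) : WittRing K := (t.map (fun a => 1 + diagForm a)).prod

lemma pfW_cons (a : Kˣ) (t : List Kˣ) : pfW (a :: t) = (1 + diagForm a) * pfW t := by
  simp [pfW]

lemma pf_length (t : List Kˣ) : (pf t).length = 2 ^ t.length := by
  induction t with
  | nil => simp [pf]
  | cons a t ih => simp [pf, ih, pow_succ]; ring

lemma pf_ne (t : List Kˣ) : ∀ c ∈ pf t, c ≠ 0 := by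
  induction t with
  | nil => simp [pf]
  | cons a t ih =>
    intro c hc
    simp only [pf, List.mem_append, List.mem_map] at hc
    rcases hc with hc | ⟨b, hb, rfl⟩
    · exact ih c hc
    · exact mul_ne_zero a.ne_zero (ih b hb)

lemma pf_map {L : Type v} [Field L] (ψ : K →+* L) (t : List Kˣ) :
    pf (t.map (Units.map (ψ : K →* L))) = (pf t).map ψ := by
  induction t with
  | nil => simp [pf]
  | cons a t ih => 
    simp only [pf, List.map_cons, ih, List.map_append, List.map_map]
    congr 1
    apply List.map_congr_left
    intro b _
    simp

lemma pfW_map {L : Type v} [Field L] (ψ : K →+* L) (t : List Kˣ) :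
    pfW (t.map (Units.map (ψ : K →* L))) = wmap ψ (pfW t) := by
  induction t with
  | nil => simp [pfW]
  | cons a t ih => rw [List.map_cons, pfW_cons, pfW_cons, ih, map_mul, map_add, map_one, wmap_diag]

lemma diag_self_mul (a : Kˣ) : diagForm a * diagForm a = 1 := by
  have := diag_sq (1 : Kˣ) a
  rw [one_mul, diag_mul, diag_one] at this
  exact this

lemma round (t : List Kˣ) : ∀ (x : ℕ → K) (c : Kˣ), ev (pf t) x = c →
    diagForm c * pfW t = pfW t := by
  induction t with
  | nil =>
    intro x c h
    simp [pf, ev] at h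
    have hx : x 0 ≠ 0 := by intro h0; simp [h0] at h; exact c.ne_zero h.symm
    have : c = 1 * Units.mk0 _ hx * Units.mk0 _ hx := by ext; simp [← h, pow_two]
    rw [this, diag_sq, diag_one, one_mul]
  | cons a t ih =>
    intro x c h
    rw [pf, ev_append, ev_scale] at h
    rw [pfW_cons]
    by_cases hu : ev (pf t) x = 0
    · rw [hu, zero_add] at h
      have hv : ev (pf t) (fun j => x (j + (pf t).length)) ≠ 0 := by
        intro h0; rw [h0, mul_zero] at h; exact c.ne_zero h.symm
      have h1 := ih _ (Units.mk0 _ hv) rfl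
      have hc : c = a * Units.mk0 _ hv := by ext; simp [← h]
      rw [hc, diag_mul]
      have := diag_self_mul a
      linear_combination (diagForm a + 1) * diagForm a * h1 + (pfW t) * this
    · have h1 := ih _ (Units.mk0 _ hu) rfl
      by_cases hv : ev (pf t) (fun j => x (j + (pf t).length)) = 0
      · rw [hv, mul_zero, add_zero] at h
        have hc : c = Units.mk0 _ hu := by ext; simp [← h]
        rw [hc]
        linear_combination (diagForm a + 1) * h1
      · have h2 := ih _ (Units.mk0 _ hv) rfl
        have := diag_add (Units.mk0 _ hu) (a * Units.mk0 _ hv) c (by simp [← h])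
        simp only [diag_mul] at this
        generalize diagForm (Units.mk0 _ hu) = U at *
        generalize diagForm (Units.mk0 _ hv) = V at *
        generalize diagForm a = A at *
        generalize diagForm c = C at *
        generalize pfW t = σ at *
        -- U σ = σ, V σ = σ, U + A V = C + U A V C
        linear_combination -σ * this + (1 - A * V * C) * h1 + (A - A * C) * h2

lemma kill (t : List Kˣ) (a : Kˣ) (x : ℕ → K) (δ : K) (hδ : δ ≠ 0)
    (h : (a : K) * ev (pf t) x = -δ ^ 2) : pfW (a :: t) = 0 := by
  have hs : ev (pf t) x ≠ 0 := by
    intro h0; rw [h0, mul_zero, eq_comm, neg_eq_zero] at h; exact hδ (pow_eq_zero_iff two_ne_zero |>.mp h)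
  have h1 := round t x (Units.mk0 _ hs) rfl
  have h3 : a * Units.mk0 _ hs = -(1 * Units.mk0 δ hδ * Units.mk0 δ hδ) := by
    ext; simp [h, pow_two]
  have h4 := congrArg diagForm h3
  rw [diag_mul, diag_neg, diag_sq, diag_one] at h4
  rw [pfW_cons]
  linear_combination (-diagForm a) * h1 + pfW t * h4

lemma hyp_not_aniso {n : ℕ} (hn : 0 < n) {a : Fin n → K} (ha : Aniso a) (h : Hyp a) : False := by
  obtain ⟨N, hN, hQ⟩ := h
  have : N = ⊥ := by
    rw [eq_bot_iff]; intro x hx; exact ha x (hQ x hx)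
  rw [this] at hN
  simp at hN
  omega

lemma step (h2 : (2 : K) ≠ 0) (i : K) (hi : i ^ 2 = -1) {n : ℕ} (hn : 0 < n) (a : Fin n → Kˣ)
    (ha : Aniso (fun j => (a j : K))) (a₁ : Kˣ) (t : List Kˣ) (ht : n < 2 ^ t.length) :
    ∃ (L : Type u) (_ : Field L) (ψ : K →+* L), wmap ψ (pfW (a₁ :: t)) = 0 ∧
      wmap ψ (∑ j, diagForm (a j)) ≠ 0 := by
  obtain ⟨K', _, φ, x, p1, -, p3⟩ := generic_tower K h2 (2 ^ t.length)
  have p3' : ∀ (b : Kˣ) (f : Fin n → K'),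
      Q (φ ∘ (fun j => (a j : K))) f ≠ φ b * ev ((pf t).map φ) x := by
    intro b f hf
    have := p3 n _ ha ⊥ f (by simp [B]) ((pf t).map ((b : K) * ·)) (by simp [pf_length]) (by
      intro c hc
      obtain ⟨c', hc', rfl⟩ := List.mem_map.mp hc
      exact mul_ne_zero b.ne_zero (pf_ne t _ hc')) (by
      rw [hf, ← ev_scale, List.map_map, List.map_map]
      congr 1
      apply List.map_congr_left
      intro c _
      simp)
    simp at this
    omega
  set s := ev ((pf t).map φ) x with hs
  set d : K' := - (φ a₁ * s) with hd
  have hφ2 : (2 : K') ≠ 0 := by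
    have := (map_ne_zero φ).mpr h2
    rwa [map_ofNat] at this
  have hd0 : d ≠ 0 := by
    intro h0
    apply p3' a₁ 0
    have : φ a₁ * s = 0 := by simpa [hd] using h0
    rw [this]; simp [Q]
  have hAK : Aniso (φ ∘ fun j => (a j : K)) := p1 n _ ha
  by_cases hsq : ∃ δ : K', δ ^ 2 = d
  · obtain ⟨δ, hδ⟩ := hsq
    refine ⟨K', inferInstance, φ, ?_, ?_⟩
    · rw [← pfW_map, List.map_cons]
      refine kill _ _ x δ (by rintro rfl; apply hd0; rw [← hδ]; simp) ?_
      rw [pf_map, hδ, hd]; simp [hs]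
    · intro h0
      rw [map_sum] at h0
      simp only [wmap_diag] at h0
      have := hyp_of_zero hφ2 (φ i) (by rw [← map_pow, hi]; simp) _ h0
      exact hyp_not_aniso hn hAK this
  · have hirr : Irreducible (Polynomial.X ^ 2 - Polynomial.C d : Polynomial K') := by
      apply X_pow_sub_C_irreducible_of_prime Nat.prime_two
      intro b hb
      exact hsq ⟨b, hb⟩
    have : Fact (Irreducible (Polynomial.X ^ 2 - Polynomial.C d : Polynomial K')) := ⟨hirr⟩
    have hdeg : (Polynomial.X ^ 2 - Polynomial.C d : Polynomial K').natDegree = 2 :=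
      Polynomial.natDegree_X_pow_sub_C
    let L := AdjoinRoot (Polynomial.X ^ 2 - Polynomial.C d : Polynomial K')
    let δ : L := AdjoinRoot.root _
    let pb := AdjoinRoot.powerBasis hirr.ne_zero
    have hδ : δ ^ 2 = algebraMap K' L d := by
      have := AdjoinRoot.eval₂_root (Polynomial.X ^ 2 - Polynomial.C d : Polynomial K')
      simp only [Polynomial.eval₂_sub, Polynomial.eval₂_pow, Polynomial.eval₂_X, Polynomial.eval₂_C] at this
      exact sub_eq_zero.mp this
    have hdim : pb.dim = 2 := hdeg
    let bas : Module.Basis (Fin 2) K' L := pb.basis.reindex (finCongr hdim)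
    have hb0 : bas 0 = 1 := by
      simp [bas, Module.Basis.reindex_apply, PowerBasis.basis_eq_pow]
    have hb1 : bas 1 = δ := by
      simp [bas, Module.Basis.reindex_apply, PowerBasis.basis_eq_pow]
      rfl
    have hL2 : (2 : L) ≠ 0 := by
      have := (map_ne_zero (algebraMap K' L)).mpr hφ2
      rwa [map_ofNat] at this
    refine ⟨L, inferInstance, (algebraMap K' L).comp φ, ?_, ?_⟩
    · rw [← pfW_map, List.map_cons]
      refine kill _ _ (algebraMap K' L ∘ x) δ ?_ ?_
      · intro h0
        rw [h0] at hδ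
        apply hd0
        apply (algebraMap K' L).injective
        rw [← hδ]; simp
      · have hd' : algebraMap K' L d = -(algebraMap K' L (φ a₁) * algebraMap K' L s) := by
          rw [← map_mul, ← map_neg]
        rw [pf_map, hδ, hd', RingHom.coe_comp, ← List.map_map, ev_map]
        exact (neg_neg (algebraMap K' L (φ a₁) * algebraMap K' L s)).symm
    · intro h0
      rw [map_sum] at h0
      simp only [wmap_diag] at h0
      have hH := hyp_of_zero hL2 (algebraMap K' L (φ i)) (by
        rw [← map_pow, ← map_pow, hi]; simp) _ h0
      have hT := Hyp.transfer (φ ∘ fun j => (a j : K)) d δ hδ bas hb0 hb1 hH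
      obtain ⟨v, hv⟩ := Hyp.represents hAK d hT ⟨0, hn⟩
      apply p3' (a ⟨0, hn⟩ * a₁) v
      rw [hv, hd]
      simp
      ring


theorem main_claim (k : ℕ) : ∀ (l : ℕ) (K : Type u) [Field K] (_ : (2 : K) ≠ 0) (i : K) (_ : i ^ 2 = -1)
    (R : List (List Kˣ)) (_ : R.length = l) (_ : ∀ r ∈ R, r.length = k + 1)
    (n : ℕ) (_ : 0 < n) (_ : n < 2 ^ k) (a : Fin n → Kˣ) (_ : Aniso (fun j => (a j : K))),
    ∑ j, diagForm (a j) ∉ Ideal.span {z | ∃ r ∈ R, z = pfW r} := by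
  intro l
  induction l with
  | zero =>
    intro K _ h2 i hi R hR _ n hn _ a ha hmem
    have : R = [] := List.length_eq_zero_iff.mp hR
    subst this
    simp at hmem
    exact hyp_not_aniso hn ha (hyp_of_zero h2 i hi a hmem)
  | succ l ih =>
    intro K _ h2 i hi R hR hk n hn hnk a ha hmem
    obtain _ | ⟨r, R⟩ := R
    · simp at hR
    obtain _ | ⟨a₁, t⟩ := r
    · have := hk [] (by simp)
      simp at this
    have htk : t.length = k := by simpa using hk (a₁ :: t) (by simp)
    obtain ⟨L, _, ψ, hkill, hne⟩ := step h2 i hi hn a ha a₁ t (by rw [htk]; exact hnk)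
    have hmem' : wmap ψ (∑ j, diagForm (a j)) ∈ Ideal.span
        {z | ∃ r ∈ R.map (fun r => r.map (Units.map (ψ : K →* L))), z = pfW r} := by
      have := Ideal.mem_map_of_mem (wmap ψ) hmem
      rw [Ideal.map_span] at this
      refine Ideal.span_le.mpr ?_ this
      rintro _ ⟨_, ⟨r, hr, rfl⟩, rfl⟩
      rcases List.mem_cons.mp hr with rfl | hr
      · rw [hkill]; exact zero_mem _
      · exact Ideal.subset_span ⟨_, List.mem_map_of_mem hr, (pfW_map ψ r).symm⟩
    have hsum : wmap ψ (∑ j, diagForm (a j)) = ∑ j, diagForm (Units.map (ψ : K →* L) (a j)) := by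
      rw [map_sum]; simp only [wmap_diag]
    obtain ⟨m, hm, b, hb, hab⟩ := exists_aniso n (fun j => Units.map (ψ : K →* L) (a j))
    rw [hsum, hab] at hmem' hne
    have hm0 : 0 < m := by
      rcases Nat.eq_zero_or_pos m with rfl | h
      · simp at hne
      · exact h
    refine ih L ?_ (ψ i) (by rw [← map_pow, hi]; simp) _ ?_ ?_ m hm0 (by omega) b hb hmem'
    · have := (map_ne_zero ψ).mpr h2
      rwa [map_ofNat] at this
    · simpa using hR
    · intro r hr
      obtain ⟨r', hr', rfl⟩ := List.mem_map.mp hr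
      simpa using hk r' (List.mem_cons_of_mem _ hr')

open scoped Pointwise in
lemma list_of_pow {k : ℕ} {z : WittRing K} (hz : z ∈ {x : WittRing K | ∃ a : Kˣ, x = 1 + diagForm a} ^ k) :
    ∃ r : List Kˣ, r.length = k ∧ z = pfW r := by
  induction k generalizing z with
  | zero => exact ⟨[], rfl, by simpa [pfW] using hz⟩
  | succ k ih =>
    rw [pow_succ'] at hz
    obtain ⟨_, ⟨a, rfl⟩, y, hy, rfl⟩ := Set.mem_mul.mp hz
    obtain ⟨r, hr, rfl⟩ := ih hy
    exact ⟨a :: r, by simp [hr], (pfW_cons a r).symm⟩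

lemma exists_list {k : ℕ} {z : WittRing K} (hz : z ∈ (fundamentalIdeal K) ^ k) :
    ∃ R : List (List Kˣ), (∀ r ∈ R, r.length = k) ∧ z ∈ Ideal.span {z | ∃ r ∈ R, z = pfW r} := by
  rw [fundamentalIdeal, Ideal.span, Submodule.span_pow] at hz
  induction hz using Submodule.span_induction with
  | mem x h =>
    obtain ⟨r, hr, rfl⟩ := list_of_pow h
    exact ⟨[r], by simpa using hr, Ideal.subset_span ⟨r, by simp, rfl⟩⟩
  | zero => exact ⟨[], by simp, zero_mem _⟩
  | add x y _ _ hx hy =>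
    obtain ⟨R, hR, hx⟩ := hx
    obtain ⟨S, hS, hy⟩ := hy
    refine ⟨R ++ S, ?_, add_mem ?_ ?_⟩
    · intro r hr
      rcases List.mem_append.mp hr with h | h
      · exact hR r h
      · exact hS r h
    · refine Ideal.span_mono ?_ hx
      rintro _ ⟨r, hr, rfl⟩; exact ⟨r, List.mem_append_left _ hr, rfl⟩
    · refine Ideal.span_mono ?_ hy
      rintro _ ⟨r, hr, rfl⟩; exact ⟨r, List.mem_append_right _ hr, rfl⟩
  | smul c x _ hx =>
    obtain ⟨R, hR, hx⟩ := hx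
    exact ⟨R, hR, Ideal.mul_mem_left _ _ hx⟩

theorem eq_zero_of_mem_all (h2 : (2 : K) ≠ 0) (i : K) (hi : i ^ 2 = -1) (j : ℕ) (z : WittRing K)
    (hz : ∀ k, j ≤ k → z ∈ (fundamentalIdeal K) ^ k) : z = 0 := by
  obtain ⟨n₀, a₀, rfl⟩ := exists_sum z
  obtain ⟨n, -, a, ha, hab⟩ := exists_aniso n₀ a₀
  rw [hab] at hz ⊢
  rcases Nat.eq_zero_or_pos n with rfl | hn
  · simp
  exfalso
  obtain ⟨R, hR, hmem⟩ := exists_list (hz (max j n + 1) (by omega))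
  refine main_claim (max j n) R.length K h2 i hi R rfl hR n hn ?_ a ha hmem
  exact lt_of_lt_of_le n.lt_two_pow_self (Nat.pow_le_pow_right (by norm_num) (le_max_right _ _))

end pfister
end WH
/-- Let `F` be a field of characteristic `≠ 2` with `vcd₂(F) ≤ s`.  Then for
all `j ≥ s + 1` the power `Iʲ(F(√-1))` of the fundamental ideal of the Witt ring of
`E = F(√-1)` is zero.  The hypothesis `vcd₂(F) = cd₂(F(√-1)) ≤ s` is encoded by the vanishing
of the mod-2 Galois cohomology `H^j(E, ℤ/2)` for `j ≥ s + 1`, together with the exact sequences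
`0 → I^{j+1}(E) → I^j(E) → H^j(E, ℤ/2)` provided by the Milnor conjecture. -/
theorem fundamentalIdeal_pow_sqrt_neg_one_eq_bot
    (F : Type*) [Field F] (h2 : (2 : F) ≠ 0)
    (E : Type*) [Field E] [Algebra F E] (i : E) (hi : i ^ 2 = -1)
    (hgen : Algebra.adjoin F ({i} : Set E) = ⊤)
    (s : ℕ)
    (H : ℕ → Type*) [∀ j, AddCommGroup (H j)]
    (e : ∀ j : ℕ, ↥((fundamentalIdeal E) ^ j) →+ H j)
    (hMilnor : ∀ (j : ℕ) (x : ↥((fundamentalIdeal E) ^ j)),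
      e j x = 0 ↔ (x : WittRing E) ∈ (fundamentalIdeal E) ^ (j + 1))
    (hvcd : ∀ j : ℕ, s + 1 ≤ j → ∀ h : H j, h = 0) :
    ∀ j : ℕ, s + 1 ≤ j → (fundamentalIdeal E) ^ j = ⊥ := by
  have h2E : (2 : E) ≠ 0 := by
    have := (map_ne_zero (algebraMap F E)).mpr h2
    rwa [map_ofNat] at this
  intro j hj
  rw [eq_bot_iff]
  intro z hz
  refine (Submodule.mem_bot _).mpr (WH.eq_zero_of_mem_all h2E i hi j z ?_)
  intro k hk
  induction k, hk using Nat.le_induction with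
  | base => exact hz
  | succ k hk ih => exact (hMilnor k ⟨z, ih⟩).mp (hvcd k (by omega) _)
end

section
/- Let F be a field of characteristic different from 2 and s ≥ 0. Then I^j(F(√-1)) = 0 for all j ≥ s+1 if and only if for all j ≥ s+1 the group I^j(F) is torsion free and 2·I^{j-1}(F) = I^j(F). -/
open scoped Classical

open scoped Classical

noncomputable example (F : Type*) [Field F] (j : ℕ) : Ideal (WittRing F) := (fundamentalIdeal F) ^ j


namespace WR

section basics
variable {F : Type*} [Field F]

lemma diag_mul (a b : Fˣ) : (diagForm a : WittRing F) * diagForm b = diagForm (a * b) := by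
  unfold diagForm wittGen
  rw [map_mul (MonoidAlgebra.of ℤ Fˣ) a b]
  exact (map_mul (Ideal.Quotient.mk (wittIdeal F)) _ _).symm

lemma diag_one : (diagForm (1 : Fˣ) : WittRing F) = 1 := by
  unfold diagForm wittGen
  rw [map_one (MonoidAlgebra.of ℤ Fˣ)]
  exact map_one (Ideal.Quotient.mk (wittIdeal F))

lemma diag_sq (a b : Fˣ) : (diagForm (a * b * b) : WittRing F) = diagForm a := by
  unfold diagForm
  symm
  refine (Ideal.Quotient.eq (I := wittIdeal F)).2 ?_
  exact Ideal.subset_span (Or.inl (Or.inl ⟨a, b, rfl⟩))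

lemma diag_neg_one : (1 : WittRing F) + diagForm (-1 : Fˣ) = 0 := by
  rw [← diag_one]
  unfold diagForm
  refine (Ideal.Quotient.eq_zero_iff_mem (I := wittIdeal F)
    (a := wittGen F 1 + wittGen F (-1))).2 ?_
  exact Ideal.subset_span (Or.inr rfl)

lemma diag_add (a b c : Fˣ) (h : (a : F) + b = c) :
    (diagForm a : WittRing F) + diagForm b = diagForm c + diagForm (a * b * c) := by
  have := (Ideal.Quotient.eq_zero_iff_mem (I := wittIdeal F)
    (a := wittGen F a + wittGen F b - wittGen F c - wittGen F (a * b * c))).2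
    (Ideal.subset_span (Or.inl (Or.inr ⟨a, b, c, h, rfl⟩)))
  have h2 : (diagForm a : WittRing F) + diagForm b - diagForm c - diagForm (a * b * c) = 0 := this
  linear_combination h2

/-- total version of the rank one class, with value zero at zero -/
noncomputable def dg (x : F) : WittRing F := if h : x ≠ 0 then diagForm (Units.mk0 x h) else 0

lemma dg_zero : dg (0 : F) = 0 := by simp [dg]

lemma dg_unit (a : Fˣ) : dg (a : F) = diagForm a := by
  simp [dg]

lemma dg_one : dg (1 : F) = 1 := by
  rw [← diag_one, ← dg_unit]; simp

lemma dg_mul (x y : F) : dg (x * y) = dg x * dg y := by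
  by_cases hx : x = 0
  · simp [hx, dg_zero]
  by_cases hy : y = 0
  · simp [hy, dg_zero]
  lift x to Fˣ using IsUnit.mk0 _ hx
  lift y to Fˣ using IsUnit.mk0 _ hy
  rw [dg_unit, dg_unit, diag_mul, ← dg_unit]; simp

lemma dg_sq (x : F) (hx : x ≠ 0) : dg x * dg x = 1 := by
  lift x to Fˣ using IsUnit.mk0 _ hx
  rw [dg_unit, diag_mul]
  have := diag_sq (F := F) 1 x
  rw [one_mul] at this
  rw [this, diag_one]

lemma dg_neg_one : dg (-1 : F) = -1 := by
  have := diag_neg_one (F := F)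
  rw [← dg_unit] at this
  simp only [Units.val_neg, Units.val_one] at this
  linear_combination this

lemma dg_neg (x : F) : dg (-x) = - dg x := by
  rw [neg_eq_neg_one_mul, dg_mul, dg_neg_one]; ring

lemma dg_add (x y : F) (h : x + y ≠ 0) : dg x + dg y = dg (x + y) * (1 + dg x * dg y) := by
  by_cases hx : x = 0
  · simp [hx, dg_zero]
  by_cases hy : y = 0
  · simp [hy, dg_zero]
  have := diag_add (Units.mk0 x hx) (Units.mk0 y hy) (Units.mk0 _ h) rfl
  rw [← dg_unit, ← dg_unit, ← dg_unit, ← dg_unit] at this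
  simp only [Units.val_mk0, Units.val_mul, dg_mul] at this
  linear_combination this

/-- binary roundness -/
lemma dg_binary (c x y : F) (h : x ^ 2 + c * y ^ 2 ≠ 0) :
    dg (x ^ 2 + c * y ^ 2) * (1 + dg c) = 1 + dg c := by
  have key := dg_add _ _ h
  by_cases hx : x = 0
  · subst hx
    have hy : y ≠ 0 := by rintro rfl; simp at h
    have hc : c ≠ 0 := by rintro rfl; simp at h
    have e : (0:F) ^ 2 + c * y ^ 2 = c * (y * y) := by ring
    rw [e, dg_mul, dg_mul, dg_sq y hy]
    linear_combination dg_sq c hc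
  by_cases hy : y = 0
  · subst hy
    have e : x ^ 2 + c * (0:F) ^ 2 = x * x := by ring
    rw [e, dg_mul, dg_sq x hx, one_mul]
  have e1 : dg (x ^ 2) = 1 := by rw [pow_two, dg_mul, dg_sq x hx]
  have e2 : dg (c * y ^ 2) = dg c := by rw [pow_two, dg_mul, dg_mul, dg_sq y hy, mul_one]
  rw [e1, e2] at key
  linear_combination -key

end basics

section res
variable {F E : Type*} [Field F] [Field E]

/-- functoriality of the group ring -/
noncomputable def resA (σ : F →+* E) : MonoidAlgebra ℤ Fˣ →+* MonoidAlgebra ℤ Eˣ :=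
  MonoidAlgebra.mapDomainRingHom ℤ (Units.map (σ : F →* E))

lemma resA_gen (σ : F →+* E) (a : Fˣ) :
    resA σ (wittGen F a) = wittGen E (Units.map (σ : F →* E) a) := by
  simp [resA, wittGen]

lemma resA_mem (σ : F →+* E) (x : MonoidAlgebra ℤ Fˣ) (hx : x ∈ wittIdeal F) :
    resA σ x ∈ wittIdeal E := by
  have : wittIdeal F ≤ (wittIdeal E).comap (resA σ) := by
    refine Ideal.span_le.2 ?_
    rintro x ((⟨a, b, rfl⟩ | ⟨a, b, c, h, rfl⟩) | rfl)
    · refine Ideal.subset_span (Or.inl (Or.inl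
        ⟨Units.map (σ : F →* E) a, Units.map (σ : F →* E) b, ?_⟩))
      simp only [map_sub, resA_gen, map_mul]
    · refine Ideal.subset_span (Or.inl (Or.inr
        ⟨Units.map (σ : F →* E) a, Units.map (σ : F →* E) b, Units.map (σ : F →* E) c, ?_, ?_⟩))
      · simp [← h]
      · simp only [map_sub, map_add, resA_gen, map_mul]
    · refine Ideal.subset_span (Or.inr ?_)
      simp only [map_add, resA_gen, map_one, Set.mem_singleton_iff]
      congr 2
      ext; simp
  exact this hx

/-- restriction homomorphism of Witt rings -/
noncomputable def res (σ : F →+* E) : WittRing F →+* WittRing E :=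
  Ideal.quotientMap (wittIdeal E) (resA σ) (fun x hx => resA_mem σ x hx)

lemma res_diag (σ : F →+* E) (a : Fˣ) :
    res σ (diagForm a) = diagForm (Units.map (σ : F →* E) a) := by
  unfold res diagForm
  rw [← resA_gen]
  exact Ideal.quotientMap_mk

lemma res_dg (σ : F →+* E) (x : F) : res σ (dg x) = dg (σ x) := by
  by_cases hx : x = 0
  · simp [hx, dg_zero]
  lift x to Fˣ using IsUnit.mk0 _ hx
  rw [dg_unit, res_diag, ← dg_unit]; simp

lemma res_fund (σ : F →+* E) (n : ℕ) (x : WittRing F) (hx : x ∈ fundamentalIdeal F ^ n) :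
    res σ x ∈ fundamentalIdeal E ^ n := by
  have h : (fundamentalIdeal F).map (res σ) ≤ fundamentalIdeal E := by
    rw [Ideal.map_le_iff_le_comap]
    refine Ideal.span_le.2 ?_
    rintro x ⟨a, rfl⟩
    refine Ideal.subset_span ⟨Units.map (σ : F →* E) a, ?_⟩
    rw [map_add, map_one, res_diag]
  have h2 := Ideal.mem_map_of_mem (res σ) hx
  rw [Ideal.map_pow] at h2
  exact Ideal.pow_right_mono h n h2

lemma wr_induction {p : WittRing F → Prop} (x : WittRing F)
    (h0 : ∀ a : Fˣ, p (diagForm a)) (hadd : ∀ x y, p x → p y → p (x + y))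
    (hneg : ∀ x, p x → p (-x)) : p x := by
  obtain ⟨y, rfl⟩ := Ideal.Quotient.mk_surjective (I := wittIdeal F) x
  have hz : p 0 := by
    have := hadd _ _ (h0 1) (hneg _ (h0 1))
    rwa [add_neg_cancel] at this
  induction y using MonoidAlgebra.induction_on with
  | of a => exact h0 a
  | add a b ha hb => exact hadd _ _ ha hb
  | smul r a ha =>
    have e : (Ideal.Quotient.mk (wittIdeal F) (r • a) : WittRing F)
        = r • (Ideal.Quotient.mk (wittIdeal F) a : WittRing F) :=
      map_zsmul (Ideal.Quotient.mk (wittIdeal F)) r a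
    change p (Ideal.Quotient.mk (wittIdeal F) (r • a) : WittRing F)
    rw [e]
    induction r using Int.induction_on with
    | zero => rw [zero_smul]; exact hz
    | succ n ih => rw [add_smul, one_smul]; exact hadd _ _ (ih (map_zsmul _ _ _)) ha
    | pred n ih =>
      rw [sub_smul, one_smul, sub_eq_add_neg]
      exact hadd _ _ (ih (map_zsmul _ _ _)) (hneg _ ha)

end res
end WR

namespace WR
section met
variable {F : Type*} [Field F]
open Module

lemma rk_sub {V W : Type*} [AddCommGroup V] [Module F V] [FiniteDimensional F V]
    [AddCommGroup W] [Module F W] (f : V →ₗ[F] W) (N : Submodule F V) :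
    finrank F (N.map f) + finrank F (N ⊓ LinearMap.ker f : Submodule F V) = finrank F N := by
  have h := LinearMap.finrank_range_add_finrank_ker (f.domRestrict N)
  rw [LinearMap.range_domRestrict] at h
  rw [← h]
  congr 1
  rw [LinearMap.ker_domRestrict, LinearEquiv.finrank_eq (Submodule.equivSubtypeMap N _),
    Submodule.map_comap_subtype]

lemma cancel_abs {V U : Type*} [AddCommGroup V] [Module F V] [FiniteDimensional F V]
    [AddCommGroup U] [Module F U] [FiniteDimensional F U]
    (B : V → V → F) (C : LinearMap.BilinForm F U) (hC : C.Nondegenerate)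
    (hB0 : ∀ x, B 0 x = 0)
    (L : Submodule F (V × U)) (hL : ∀ p ∈ L, ∀ q ∈ L, B p.1 q.1 + C p.2 q.2 = 0)
    (M : Submodule F U) (hM : ∀ p ∈ M, ∀ q ∈ M, C p q = 0) :
    ∃ L' : Submodule F V, (∀ p ∈ L', ∀ q ∈ L', B p q = 0) ∧
      finrank F L + finrank F M ≤ finrank F L' + finrank F U := by
  obtain ⟨R, hR⟩ : ∃ R : Submodule F U, R = L.comap (LinearMap.inr F V U) ⊓ M := ⟨_, rfl⟩
  obtain ⟨P, hP⟩ : ∃ P : Submodule F U, P = C.orthogonal R := ⟨_, rfl⟩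
  have hPd : finrank F P = finrank F U - finrank F R := by
    rw [hP]; exact LinearMap.BilinForm.finrank_orthogonal hC R
  have hRle : finrank F R ≤ finrank F U := Submodule.finrank_le R
  have hMP : M ≤ P := by
    intro m hm
    rw [hP, LinearMap.BilinForm.mem_orthogonal_iff]
    intro r hr
    rw [hR] at hr
    exact hM _ hr.2 _ hm
  have hLP : ∀ l ∈ L, l.2 ∈ P := by
    intro l hl
    rw [hP, LinearMap.BilinForm.mem_orthogonal_iff]
    intro r hr
    rw [hR] at hr
    have h1 : ((0 : V), r) ∈ L := hr.1
    have := hL _ h1 _ hl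
    simp only [hB0, zero_add] at this
    exact this
  obtain ⟨N, hN⟩ : ∃ N : Submodule F (V × U), N = L ⊓ M.comap (LinearMap.snd F V U) := ⟨_, rfl⟩
  have a1 := rk_sub (M.mkQ ∘ₗ LinearMap.snd F V U) L
  have a2 : L ⊓ LinearMap.ker (M.mkQ ∘ₗ LinearMap.snd F V U) = N := by
    rw [hN, LinearMap.ker_comp, Submodule.ker_mkQ]
  have a3 := rk_sub M.mkQ P
  rw [Submodule.ker_mkQ, inf_eq_right.2 hMP] at a3
  have a4 : L.map (M.mkQ ∘ₗ LinearMap.snd F V U) ≤ P.map M.mkQ := by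
    rintro _ ⟨l, hl, rfl⟩
    exact ⟨l.2, hLP l hl, rfl⟩
  have a5 := Submodule.finrank_mono a4
  have a6 := rk_sub (LinearMap.fst F V U) N
  have a7 : N ⊓ LinearMap.ker (LinearMap.fst F V U) ≤ R.map (LinearMap.inr F V U) := by
    rintro ⟨v, u⟩ ⟨h1, h2⟩
    have h3 : v = 0 := h2
    subst h3
    rw [hN] at h1
    refine ⟨u, ?_, rfl⟩
    rw [hR]
    exact ⟨h1.1, h1.2⟩
  have a8 := (Submodule.finrank_mono a7).trans (Submodule.finrank_map_le _ _)
  rw [a2] at a1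
  refine ⟨N.map (LinearMap.fst F V U), ?_, ?_⟩
  · rintro _ ⟨a, ha, rfl⟩ _ ⟨b, hb, rfl⟩
    rw [hN] at ha hb
    have := hL _ ha.1 _ hb.1
    have h5 : C a.2 b.2 = 0 := hM _ ha.2 _ hb.2
    rw [h5, add_zero] at this
    exact this
  · omega

variable {ι κ : Type} [Fintype ι] [Fintype κ]

/-- diagonal bilinear form -/
def bf (a : ι → F) (x y : ι → F) : F := ∑ i, a i * x i * y i

/-- the diagonal form has a lagrangian -/
def Met (a : ι → F) : Prop :=
  ∃ L : Submodule F (ι → F), (∀ x ∈ L, ∀ y ∈ L, bf a x y = 0) ∧ Fintype.card ι ≤ 2 * finrank F L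

lemma bf_sum (a : ι → F) (b : κ → F) (x y : ι ⊕ κ → F) :
    bf (Sum.elim a b) x y = bf a (x ∘ Sum.inl) (y ∘ Sum.inl) + bf b (x ∘ Sum.inr) (y ∘ Sum.inr) := by
  simp [bf, Fintype.sum_sum_type]

lemma Met.equiv {a : ι → F} {b : κ → F} (e : ι ≃ κ) (h : ∀ i, b (e i) = a i) (hm : Met a) :
    Met b := by
  obtain ⟨L, h1, h2⟩ := hm
  refine ⟨L.map (LinearEquiv.funCongrLeft F F e.symm).toLinearMap, ?_, ?_⟩
  · rintro _ ⟨x, hx, rfl⟩ _ ⟨y, hy, rfl⟩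
    rw [← h1 x hx y hy]
    unfold bf
    rw [← Equiv.sum_comp e]
    refine Finset.sum_congr rfl fun i _ => ?_
    simp [h, LinearEquiv.funCongrLeft, LinearMap.funLeft]
  · rw [LinearEquiv.finrank_map_eq, ← Fintype.card_congr e]; exact h2

lemma Met.add {a : ι → F} {b : κ → F} (ha : Met a) (hb : Met b) : Met (Sum.elim a b) := by
  obtain ⟨L, h1, h2⟩ := ha
  obtain ⟨M, h3, h4⟩ := hb
  set f : (L × M) →ₗ[F] (ι ⊕ κ → F) :=
    (LinearEquiv.sumArrowLequivProdArrow ι κ F F).symm.toLinearMap ∘ₗ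
      (LinearMap.prodMap L.subtype M.subtype) with hf
  have hfi : Function.Injective f := by
    rw [hf, LinearMap.coe_comp]
    refine (LinearEquiv.injective _).comp ?_
    rintro ⟨x, y⟩ ⟨x', y'⟩ h
    simp at h
    exact Prod.ext h.1 h.2
  refine ⟨LinearMap.range f, ?_, ?_⟩
  · rintro _ ⟨x, rfl⟩ _ ⟨y, rfl⟩
    rw [bf_sum]
    have e1 := h1 _ x.1.2 _ y.1.2
    have e2 := h3 _ x.2.2 _ y.2.2
    have : bf a (f x ∘ Sum.inl) (f y ∘ Sum.inl) = bf a x.1.1 y.1.1 := rfl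
    rw [this, e1]
    have : bf b (f x ∘ Sum.inr) (f y ∘ Sum.inr) = bf b x.2.1 y.2.1 := rfl
    rw [this, e2, add_zero]
  · rw [LinearMap.finrank_range_of_inj hfi, Module.finrank_prod, Fintype.card_sum]
    omega

/-- bundled diagonal bilinear form -/
noncomputable def bL (a : ι → F) : LinearMap.BilinForm F (ι → F) :=
  Matrix.toBilin' (Matrix.diagonal a)

lemma bL_apply (a : ι → F) (x y : ι → F) : bL a x y = bf a x y := by
  simp only [bL, bf, Matrix.toBilin'_apply, Matrix.diagonal_apply]
  refine Finset.sum_congr rfl fun i _ => ?_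
  rw [Finset.sum_eq_single i]
  · rw [if_pos rfl]; ring
  · intro j _ hj; simp [hj.symm]
  · simp

lemma bL_nondeg (a : ι → F) (h : ∀ i, a i ≠ 0) : (bL a).Nondegenerate := by
  apply Matrix.Nondegenerate.toBilin'
  apply Matrix.nondegenerate_of_det_ne_zero
  rw [Matrix.det_diagonal]
  exact Finset.prod_ne_zero_iff.2 fun i _ => h i

lemma Met.cancel {a : ι → F} {b : κ → F} (hb0 : ∀ i, b i ≠ 0) (hab : Met (Sum.elim a b))
    (hb : Met b) : Met a := by
  obtain ⟨L, h1, h2⟩ := hab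
  obtain ⟨M, h3, h4⟩ := hb
  obtain ⟨L', h5, h6⟩ := cancel_abs (bf a) (bL b) (bL_nondeg b hb0) (by simp [bf])
    (L.map (LinearEquiv.sumArrowLequivProdArrow ι κ F F).toLinearMap) (by
      rintro _ ⟨x, hx, rfl⟩ _ ⟨y, hy, rfl⟩
      rw [bL_apply, ← h1 x hx y hy, bf_sum]
      rfl) M (by
      intro x hx y hy
      rw [bL_apply]; exact h3 x hx y hy)
  refine ⟨L', h5, ?_⟩
  rw [LinearEquiv.finrank_map_eq] at h6
  rw [Fintype.card_sum] at h2
  have : finrank F (κ → F) = Fintype.card κ := Module.finrank_fintype_fun_eq_card F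
  omega

lemma Met.of_inj {a : ι → F} {n : ℕ} (f : (Fin n → F) →ₗ[F] (ι → F)) (hf : Function.Injective f)
    (h : ∀ x y, bf a (f x) (f y) = 0) (hc : Fintype.card ι ≤ 2 * n) : Met a := by
  refine ⟨LinearMap.range f, ?_, ?_⟩
  · rintro _ ⟨x, rfl⟩ _ ⟨y, rfl⟩
    exact h x y
  · rw [LinearMap.finrank_range_of_inj hf]; simpa using hc

lemma Met.self_neg (a : ι → F) : Met (Sum.elim a (-a)) := by
  refine ⟨LinearMap.range ((LinearEquiv.sumArrowLequivProdArrow ι ι F F).symm.toLinearMap ∘ₗ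
    (LinearMap.prod LinearMap.id LinearMap.id)), ?_, ?_⟩
  · rintro _ ⟨x, rfl⟩ _ ⟨y, rfl⟩
    rw [bf_sum]
    have : ∀ x : ι → F, ((LinearEquiv.sumArrowLequivProdArrow ι ι F F).symm.toLinearMap ∘ₗ
      (LinearMap.prod LinearMap.id LinearMap.id)) x ∘ Sum.inl = x := fun x => rfl
    rw [this, this]
    have : ∀ x : ι → F, ((LinearEquiv.sumArrowLequivProdArrow ι ι F F).symm.toLinearMap ∘ₗ
      (LinearMap.prod LinearMap.id LinearMap.id)) x ∘ Sum.inr = x := fun x => rfl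
    rw [this, this]
    simp [bf]
  · rw [LinearMap.finrank_range_of_inj]
    · simp; omega
    · rw [LinearMap.coe_comp]
      refine (LinearEquiv.injective _).comp ?_
      intro x y h
      simpa using h

lemma Met.neg {a : ι → F} (h : Met a) : Met (-a) := by
  obtain ⟨L, h1, h2⟩ := h
  refine ⟨L, fun x hx y hy => ?_, h2⟩
  have := h1 x hx y hy
  unfold bf at *
  simp only [Pi.neg_apply, neg_mul, Finset.sum_neg_distrib, this, neg_zero]

end met
end WR

namespace WR
section faith
universe u
variable {F : Type u} [Field F]

lemma met2 (a b x y : F) (hx : x ≠ 0) (h : a * x ^ 2 + b * y ^ 2 = 0) :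
    Met (Sum.elim (fun _ : Unit => a) (fun _ : Unit => b)) := by
  refine Met.of_inj (n := 1)
    { toFun := fun t => Sum.elim (fun _ => t 0 * x) (fun _ => t 0 * y)
      map_add' := ?_
      map_smul' := ?_ } ?_ ?_ ?_
  · intro s t; ext (i | i) <;> simp [add_mul]
  · intro s t; ext (i | i) <;> simp [mul_assoc]
  · intro s t hst
    have := congrFun hst (Sum.inl ())
    simp [hx] at this
    ext i; fin_cases i; exact this
  · intro s t
    simp [bf]
    linear_combination s 0 * t 0 * h
  · simp

lemma met4 (e a b c : F) (h : a + b = c) :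
    Met (Sum.elim (Sum.elim (fun _ : Unit => e * a) (fun _ : Unit => e * b))
      (-(Sum.elim (fun _ : Unit => e * c) (fun _ : Unit => e * (a * b * c))))) := by
  refine Met.of_inj (n := 2)
    { toFun := fun t => Sum.elim (Sum.elim (fun _ => t 0 + b * t 1) (fun _ => t 0 - a * t 1))
        (Sum.elim (fun _ => t 0) (fun _ => t 1))
      map_add' := ?_
      map_smul' := ?_ } ?_ ?_ ?_
  · intro s t; ext ((i | i) | (i | i)) <;> simp <;> ring
  · intro s t; ext ((i | i) | (i | i)) <;> simp <;> ring
  · intro s t hst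
    have h1 := congrFun hst (Sum.inr (Sum.inl ()))
    have h2 := congrFun hst (Sum.inr (Sum.inr ()))
    simp at h1 h2
    ext i; fin_cases i
    · exact h1
    · exact h2
  · intro s t
    subst h
    simp [bf, Fintype.sum_sum_type]
    ring
  · simp

/-- nondegenerate diagonal forms -/
structure DF (F : Type u) [Field F] where
  ι : Type
  ft : Fintype ι
  a : ι → F
  nz : ∀ i, a i ≠ 0

attribute [instance] DF.ft

/-- Witt equivalence -/
def DF.rel (X Y : DF F) : Prop := Met (Sum.elim X.a (-Y.a))

lemma DF.rel_of_equiv {X Y : DF F} (e : X.ι ≃ Y.ι) (h : ∀ i, Y.a (e i) = X.a i) : X.rel Y :=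
  (Met.self_neg X.a).equiv (Equiv.sumCongr (Equiv.refl _) e) (by
    rintro (i | i) <;> simp [h])

lemma DF.rel_refl (X : DF F) : X.rel X := Met.self_neg _

lemma DF.rel_symm {X Y : DF F} (h : X.rel Y) : Y.rel X :=
  h.neg.equiv (Equiv.sumComm _ _) (by rintro (i | i) <;> simp)

lemma DF.rel_trans {X Y Z : DF F} (h : X.rel Y) (h' : Y.rel Z) : X.rel Z := by
  have h1 : Met (Sum.elim (-Z.a) Y.a) := h'.equiv (Equiv.sumComm _ _) (by rintro (i | i) <;> simp)
  have h2 : Met (Sum.elim (-Y.a) Y.a) :=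
    (Met.self_neg Y.a).equiv (Equiv.sumComm _ _) (by rintro (i | i) <;> simp)
  have h3 := h.add h1
  refine Met.cancel (b := Sum.elim (-Y.a) Y.a) ?_ ?_ h2
  · rintro (i | i) <;> simp [Y.nz]
  · exact h3.equiv (Equiv.sumSumSumComm _ _ _ _) (by rintro ((i | i) | (i | i)) <;> simp)

instance DF.setoid : Setoid (DF F) := ⟨DF.rel, DF.rel_refl, DF.rel_symm, DF.rel_trans⟩

/-- Witt group of diagonal forms -/
def WQ (F : Type u) [Field F] := Quotient (DF.setoid (F := F))

/-- sum -/
def DF.add (X Y : DF F) : DF F :=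
  ⟨X.ι ⊕ Y.ι, inferInstance, Sum.elim X.a Y.a, by rintro (i | i) <;> simp [X.nz, Y.nz]⟩

/-- negative -/
def DF.neg (X : DF F) : DF F := ⟨X.ι, X.ft, -X.a, by intro i; simp [X.nz]⟩

/-- zero -/
def DF.zero : DF F := ⟨Empty, inferInstance, Empty.elim, by rintro ⟨⟩⟩

instance : Zero (WQ F) := ⟨Quotient.mk _ DF.zero⟩
instance : Neg (WQ F) := ⟨Quotient.map DF.neg (by
  intro X Y h
  exact (Met.neg h).equiv (Equiv.refl _) (by rintro (i | i) <;> rfl))⟩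
instance : Add (WQ F) := ⟨Quotient.map₂ DF.add (by
  intro X Y h X' Y' h'
  exact (Met.add h h').equiv (Equiv.sumSumSumComm _ _ _ _)
    (by rintro ((i | i) | (i | i)) <;> rfl))⟩

instance : AddCommGroup (WQ F) where
  add_assoc := by
    rintro ⟨X⟩ ⟨Y⟩ ⟨Z⟩
    exact Quotient.sound (DF.rel_of_equiv (Equiv.sumAssoc _ _ _)
      (by rintro ((i | i) | i) <;> rfl))
  add_comm := by
    rintro ⟨X⟩ ⟨Y⟩
    exact Quotient.sound (DF.rel_of_equiv (Equiv.sumComm _ _) (by rintro (i | i) <;> rfl))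
  zero_add := by
    rintro ⟨X⟩
    exact Quotient.sound (DF.rel_of_equiv (Equiv.emptySum Empty _)
      (by rintro (⟨⟨⟩⟩ | i); rfl))
  add_zero := by
    rintro ⟨X⟩
    exact Quotient.sound (DF.rel_of_equiv (Equiv.sumEmpty _ Empty)
      (by rintro (i | ⟨⟨⟩⟩); rfl))
  neg_add_cancel := by
    rintro ⟨X⟩
    refine Quotient.sound ?_
    exact (Met.self_neg X.a).equiv ((Equiv.sumComm _ _).trans (Equiv.sumEmpty _ Empty).symm)
      (by rintro (i | i) <;> rfl)
  nsmul := nsmulRec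
  zsmul := zsmulRec

/-- rank one class -/
def wq (x : F) (hx : x ≠ 0) : WQ F := Quotient.mk _ ⟨Unit, inferInstance, fun _ => x, fun _ => hx⟩

/-- comparison map -/
noncomputable def psi : MonoidAlgebra ℤ Fˣ →+ WQ F :=
  (Finsupp.liftAddHom (fun a : Fˣ => (zmultiplesHom (WQ F)) (wq (a : F) a.ne_zero))).comp
    (MonoidAlgebra.coeffAddEquiv (R := ℤ) (M := Fˣ)).toAddMonoidHom

lemma psi_gen (a : Fˣ) : psi (wittGen F a) = wq (a : F) a.ne_zero := by
  have : (MonoidAlgebra.coeffAddEquiv (R := ℤ) (M := Fˣ)) (wittGen F a) = Finsupp.single a 1 := rfl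
  simp [psi, this]

lemma psi_ideal (x : MonoidAlgebra ℤ Fˣ) (hx : x ∈ wittIdeal F) : ∀ r, psi (r * x) = 0 := by
  have key : ∀ x : MonoidAlgebra ℤ Fˣ, (∀ c : Fˣ, psi (wittGen F c * x) = 0) →
      ∀ r, psi (r * x) = 0 := by
    intro x h r
    induction r using MonoidAlgebra.induction_on with
    | of a => exact h a
    | add a b ha hb => rw [add_mul, map_add, ha, hb, add_zero]
    | smul r a ha => rw [smul_mul_assoc, map_zsmul, ha, smul_zero]
  have gm : ∀ a b : Fˣ, wittGen F a * wittGen F b = wittGen F (a * b) := fun a b =>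
    (map_mul (MonoidAlgebra.of ℤ Fˣ) a b).symm
  unfold wittIdeal at hx
  induction hx using Submodule.span_induction with
  | mem x hx =>
    apply key
    intro e
    rcases hx with ((⟨a, b, rfl⟩ | ⟨a, b, c, h, rfl⟩) | rfl)
    · rw [mul_sub, gm, gm, map_sub, psi_gen, psi_gen, sub_eq_zero]
      refine Quotient.sound ?_
      refine met2 _ _ (b : F) 1 b.ne_zero ?_
      simp only [Units.val_mul, Pi.neg_apply]
      ring
    · rw [mul_sub, mul_sub, mul_add, gm, gm, gm, gm, map_sub, map_sub, map_add, psi_gen, psi_gen,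
        psi_gen, psi_gen, sub_sub, sub_eq_zero]
      refine Quotient.sound ?_
      exact met4 (e : F) a b c h
    · rw [mul_add, gm, gm, map_add, psi_gen, psi_gen]
      have : wq ((e * 1 : Fˣ) : F) (e * 1).ne_zero = - wq ((e * -1 : Fˣ) : F) (e * -1).ne_zero := by
        refine Quotient.sound ?_
        refine met2 _ _ (1 : F) 1 one_ne_zero ?_
        simp [DF.neg]
        change (e : F) + (- -(-(e : F))) = 0
        ring
      rw [this, neg_add_cancel]
  | zero => intro r; rw [mul_zero, map_zero]
  | add x y _ _ hx hy => intro r; rw [mul_add, map_add, hx, hy, add_zero]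
  | smul a x _ hx => intro r; rw [smul_eq_mul, ← mul_assoc]; exact hx _

/-- class -/
def wmk (X : DF F) : WQ F := Quotient.mk _ X

lemma wq_sum : ∀ (ι : Type) [Fintype ι] (a : ι → F) (h : ∀ i, a i ≠ 0),
    ∑ i, wq (a i) (h i) = wmk (⟨ι, inferInstance, a, h⟩ : DF F) := by
  intro ι _
  refine Fintype.induction_empty_option (P := fun ι _ => ∀ (a : ι → F) (h : ∀ i, a i ≠ 0),
    ∑ i, wq (a i) (h i) = wmk (⟨ι, inferInstance, a, h⟩ : DF F)) ?_ ?_ ?_ ι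
  · intro α β _ e ih a h
    let _ := Fintype.ofEquiv β e.symm
    refine ((e.sum_comp (fun i => wq (a i) (h i))).symm.trans
      (ih (a ∘ e) (fun i => h _))).trans (Quotient.sound ?_)
    exact DF.rel_of_equiv e (fun i => rfl)
  · intro a h
    rw [Fintype.sum_empty]
    exact Quotient.sound (DF.rel_of_equiv (Equiv.equivOfIsEmpty Empty PEmpty) (by rintro ⟨⟩))
  · intro α _ ih a h
    rw [Fintype.sum_option, ih (fun i => a (some i)), add_comm]
    exact Quotient.sound (DF.rel_of_equiv (Equiv.optionEquivSumPUnit.{0} α).symm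
      (by rintro (i | i) <;> rfl))

lemma faith {ι : Type} [Fintype ι] (a : ι → F) (h : ∀ i, a i ≠ 0) (hs : ∑ i, dg (a i) = 0) :
    Met a := by
  have e1 : ∀ i, dg (a i) = diagForm (Units.mk0 (a i) (h i)) := fun i => by
    rw [← dg_unit]; rfl
  have e2 : (Ideal.Quotient.mk (wittIdeal F)) (∑ i, wittGen F (Units.mk0 (a i) (h i))) = 0 := by
    rw [map_sum]
    simp only [e1] at hs
    exact hs
  have e3 := psi_ideal _ (Ideal.Quotient.eq_zero_iff_mem.1 e2) 1
  rw [one_mul, map_sum] at e3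
  simp only [psi_gen, Units.val_mk0] at e3
  rw [wq_sum] at e3
  have e4 := Quotient.exact e3
  exact Met.equiv (Equiv.sumEmpty _ Empty) (by rintro (i | ⟨⟨⟩⟩); rfl) e4

end faith
end WR
namespace WR
section values
variable {F : Type*} [Field F]
open Module

lemma inter {V U : Type*} [AddCommGroup V] [Module F V] [FiniteDimensional F V]
    [AddCommGroup U] [Module F U] (L : Submodule F V) (f : U →ₗ[F] V) (hf : Function.Injective f)
    (h : finrank F V < finrank F L + finrank F U) : ∃ u ≠ 0, f u ∈ L := by
  by_contra hc
  push Not at hc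
  have hd : Disjoint L (LinearMap.range f) := by
    rw [Submodule.disjoint_def]
    rintro _ hx ⟨u, rfl⟩
    by_contra h0
    exact hc u (fun hu => h0 (by rw [hu, map_zero])) hx
  have := Submodule.finrank_add_finrank_le_of_disjoint hd
  rw [LinearMap.finrank_range_of_inj hf] at this
  omega

variable {ι κ : Type} [Fintype ι] [Fintype κ]

lemma bf_add_l (a : ι → F) (x y z : ι → F) : bf a (x + y) z = bf a x z + bf a y z := by
  simp only [bf, Pi.add_apply, mul_add, add_mul, Finset.sum_add_distrib]

lemma bf_comm (a : ι → F) (x y : ι → F) : bf a x y = bf a y x := by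
  simp only [bf]; exact Finset.sum_congr rfl fun i _ => by ring

lemma bf_smul_l (a : ι → F) (c : F) (x y : ι → F) : bf a (c • x) y = c * bf a x y := by
  simp only [bf, Pi.smul_apply, smul_eq_mul, Finset.mul_sum]
  exact Finset.sum_congr rfl fun i _ => by ring

lemma bf_add_r (a : ι → F) (x y z : ι → F) : bf a z (x + y) = bf a z x + bf a z y := by
  rw [bf_comm, bf_add_l, bf_comm a x, bf_comm a y]

lemma bf_smul_r (a : ι → F) (c : F) (x y : ι → F) : bf a x (c • y) = c * bf a x y := by
  rw [bf_comm, bf_smul_l, bf_comm]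

lemma bf_zero_l (a : ι → F) (x : ι → F) : bf a 0 x = 0 := by simp [bf]
lemma bf_zero_r (a : ι → F) (x : ι → F) : bf a x 0 = 0 := by simp [bf]

lemma bf_fneg (a : ι → F) (x y : ι → F) : bf (-a) x y = - bf a x y := by
  simp [bf]

lemma bf_fmul (c : F) (a : ι → F) (x y : ι → F) : bf (fun i => c * a i) x y = c * bf a x y := by
  simp only [bf, Finset.mul_sum]
  exact Finset.sum_congr rfl fun i _ => by ring

/-- isotropic diagonal form -/
def Iso (a : ι → F) : Prop := ∃ x ≠ 0, bf a x x = 0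

lemma Met.iso {a : ι → F} (h : Met a) (hc : 0 < Fintype.card ι) : Iso a := by
  obtain ⟨L, h1, h3⟩ := h
  have : L ≠ ⊥ := by
    rintro rfl
    rw [finrank_bot] at h3; omega
  obtain ⟨x, hx, hx0⟩ := Submodule.exists_mem_ne_zero_of_ne_bot this
  exact ⟨x, hx0, h1 x hx x hx⟩

lemma valV (X : ι → F) (Y : κ → F) (hX : ∀ i, X i ≠ 0) (hY : ∀ i, Y i ≠ 0)
    (hc : Fintype.card ι = Fintype.card κ) (hs : ∑ i, dg (X i) = ∑ i, dg (Y i))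
    (ha : ¬ Iso X) (v : κ → F) (hv : bf Y v v ≠ 0) : ∃ x, bf X x x = bf Y v v := by
  have hm : Met (Sum.elim X (-Y)) := by
    refine faith _ ?_ ?_
    · rintro (i | i) <;> simp [hX, hY]
    · simp [Fintype.sum_sum_type, dg_neg, hs]
  obtain ⟨L, h1, h3⟩ := hm
  have hv0 : v ≠ 0 := by rintro rfl; exact hv (bf_zero_l _ _)
  let f : ((ι → F) × F) →ₗ[F] (ι ⊕ κ → F) :=
    { toFun := fun p => Sum.elim p.1 (p.2 • v)
      map_add' := by intro p q; ext (i | i) <;> simp [add_mul]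
      map_smul' := by intro c p; ext (i | i) <;> simp [mul_assoc] }
  have hf : Function.Injective f := by
    rw [← LinearMap.ker_eq_bot, LinearMap.ker_eq_bot']
    rintro ⟨x, c⟩ h
    have e1 : x = 0 := funext fun i => congrFun h (Sum.inl i)
    have e2 : c • v = 0 := funext fun i => congrFun h (Sum.inr i)
    rw [smul_eq_zero] at e2
    rw [e1, e2.resolve_right hv0]; rfl
  obtain ⟨⟨x, c⟩, hne, hmem⟩ := inter L f hf (by
    rw [Module.finrank_prod, Module.finrank_fintype_fun_eq_card,
      Module.finrank_fintype_fun_eq_card, Module.finrank_self]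
    rw [Fintype.card_sum] at h3 ⊢
    omega)
  have h4 := h1 _ hmem _ hmem
  rw [bf_sum] at h4
  have e1 : f (x, c) ∘ Sum.inl = x := rfl
  have e2 : f (x, c) ∘ Sum.inr = c • v := rfl
  rw [e1, e2, bf_fneg, bf_smul_l, bf_smul_r] at h4
  have hc0 : c ≠ 0 := by
    rintro rfl
    refine ha ⟨x, ?_, by simpa using h4⟩
    rintro rfl; exact hne rfl
  refine ⟨c⁻¹ • x, ?_⟩
  rw [bf_smul_l, bf_smul_r]
  field_simp
  linear_combination h4

lemma valV2 (h2 : (2 : F) ≠ 0) (X : ι → F) (K : κ → F) (hX : ∀ i, X i ≠ 0) (hK : ∀ i, K i ≠ 0)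
    (hc : Fintype.card κ = Fintype.card ι + 1) (p : F)
    (hs : 1 + ∑ i, dg (X i) = dg p * ∑ i, dg (K i)) (ha : ¬ Iso X) (u v : κ → F) (hp : p ≠ 0)
    (hu : bf K u u = p) (hv : bf K v v ≠ 0) (huv : bf K u v = 0) :
    ∃ x, bf X x x = p * bf K v v := by
  have hm : Met (Sum.elim (Sum.elim (fun _ : Unit => (1 : F)) X) (-(fun i => p * K i))) := by
    refine faith _ ?_ ?_
    · rintro ((i | i) | i) <;> simp [hX, hK, hp]
    · simp [Fintype.sum_sum_type, dg_neg, dg_one, dg_mul, ← Finset.mul_sum, hs]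
  obtain ⟨L, h1, h3⟩ := hm
  have hv0 : v ≠ 0 := by rintro rfl; exact hv (bf_zero_l _ _)
  by_contra hcon
  push Not at hcon
  have key : ∀ s : F, s * s = 1 →
      Sum.elim (Sum.elim (fun _ : Unit => s) (0 : ι → F)) (p⁻¹ • u) ∈ L := by
    intro s hs1
    have hs0 : s ≠ 0 := by rintro rfl; simp at hs1
    let f : (F × (ι → F) × F) →ₗ[F] ((Unit ⊕ ι) ⊕ κ → F) :=
      { toFun := fun q => Sum.elim (Sum.elim (fun _ => q.1 * s) q.2.1) ((q.1 * p⁻¹) • u + q.2.2 • v)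
        map_add' := by intro p q; ext ((i | i) | i) <;> simp <;> ring
        map_smul' := by intro c p; ext ((i | i) | i) <;> simp <;> ring }
    have hf : Function.Injective f := by
      rw [← LinearMap.ker_eq_bot, LinearMap.ker_eq_bot']
      rintro ⟨c, x, t⟩ h
      have e0 : c * s = 0 := congrFun h (Sum.inl (Sum.inl ()))
      have e1 : x = 0 := funext fun i => congrFun h (Sum.inl (Sum.inr i))
      have e2 : (c * p⁻¹) • u + t • v = 0 := funext fun i => congrFun h (Sum.inr i)
      have e3 : c = 0 := (mul_eq_zero.1 e0).resolve_right hs0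
      rw [e3, zero_mul, zero_smul, zero_add, smul_eq_zero] at e2
      rw [e1, e3, e2.resolve_right hv0]; rfl
    obtain ⟨⟨c, x, t⟩, hne, hmem⟩ := inter L f hf (by
      rw [Module.finrank_prod, Module.finrank_prod, Module.finrank_fintype_fun_eq_card,
        Module.finrank_fintype_fun_eq_card, Module.finrank_self]
      rw [Fintype.card_sum, Fintype.card_sum] at h3 ⊢
      simp only [Fintype.card_unit] at *
      omega)
    have h4 := h1 _ hmem _ hmem
    rw [bf_sum, bf_sum] at h4
    have e1 : (f (c, x, t) ∘ Sum.inl) ∘ Sum.inr = x := rfl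
    have e2 : f (c, x, t) ∘ Sum.inr = (c * p⁻¹) • u + t • v := rfl
    have e0 : (f (c, x, t) ∘ Sum.inl) ∘ Sum.inl = fun _ => c * s := rfl
    rw [e0, e1, e2, bf_fneg, bf_fmul] at h4
    simp only [bf_add_l, bf_add_r, bf_smul_l, bf_smul_r, hu, huv, bf_comm K v u] at h4
    have e3 : bf (fun _ : Unit => (1 : F)) (fun _ => c * s) (fun _ => c * s) = c * c := by
      simp [bf]; linear_combination c * c * hs1
    rw [e3] at h4
    have h5 : bf X x x = t * t * (p * bf K v v) := by
      field_simp at h4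
      linear_combination h4
    have ht : t = 0 := by
      by_contra ht
      refine hcon (t⁻¹ • x) ?_
      rw [bf_smul_l, bf_smul_r, h5]
      field_simp
    subst ht
    have hx : x = 0 := by
      by_contra hx
      exact ha ⟨x, hx, by rw [h5]; ring⟩
    subst hx
    have hc0 : c ≠ 0 := by rintro rfl; exact hne rfl
    have h6 := L.smul_mem c⁻¹ hmem
    convert h6 using 1
    ext ((i | i) | i)
    · simp [f]; field_simp
    · simp [f]
    · simp [f]; field_simp
  have k1 := key 1 (by ring)
  have k2 := key (-1) (by ring)
  have h4 := h1 _ k1 _ k2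
  rw [bf_sum, bf_sum] at h4
  simp only [Sum.elim_comp_inl, Sum.elim_comp_inr] at h4
  rw [bf_fneg, bf_fmul, bf_smul_l, bf_smul_r, bf_zero_l, hu] at h4
  simp [bf] at h4
  field_simp at h4
  apply h2
  linear_combination -h4

end values
end WR
namespace WR
section pfister
variable {F : Type*} [Field F]

/-- class of a Pfister form -/
noncomputable def pf : List Fˣ → WittRing F
  | [] => 1
  | a :: l => (1 + dg (a : F)) * pf l

lemma pf_nil : pf ([] : List Fˣ) = 1 := rfl
lemma pf_cons (a : Fˣ) (l : List Fˣ) : pf (a :: l) = (1 + dg (a : F)) * pf l := rfl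
lemma pf_append (l m : List Fˣ) : pf (l ++ m) = pf l * pf m := by
  induction l with
  | nil => simp [pf_nil]
  | cons a l ih => rw [List.cons_append, pf_cons, ih, pf_cons, mul_assoc]

/-- index type -/
def PI : List Fˣ → Type
  | [] => Unit
  | _ :: l => PI l ⊕ PI l

instance PIft : ∀ l : List Fˣ, Fintype (PI l)
  | [] => inferInstanceAs (Fintype Unit)
  | _ :: l => letI := PIft l; inferInstanceAs (Fintype (PI l ⊕ PI l))

/-- diagonal entries -/
def pfam : ∀ l : List Fˣ, PI l → F
  | [] => fun _ => 1
  | a :: l => Sum.elim (pfam l) (fun i => (a : F) * pfam l i)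

/-- index type of relative pure part -/
def PU (base : List Fˣ) : List Fˣ → Type
  | [] => Empty
  | _ :: m => PU base m ⊕ PI (m ++ base)

instance PUft (base : List Fˣ) : ∀ l : List Fˣ, Fintype (PU base l)
  | [] => inferInstanceAs (Fintype Empty)
  | _ :: m => letI := PUft base m; inferInstanceAs (Fintype (PU base m ⊕ PI (m ++ base)))

/-- entries of relative pure part -/
def pu (base : List Fˣ) : ∀ l : List Fˣ, PU base l → F
  | [] => Empty.elim
  | a :: m => Sum.elim (pu base m) (fun i => (a : F) * pfam (m ++ base) i)

/-- vector constructor -/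
def vmk (a : Fˣ) {l : List Fˣ} (x y : PI l → F) : PI (a :: l) → F := Sum.elim x y
/-- vector constructor -/
def vmku (base : List Fˣ) (a : Fˣ) {l : List Fˣ} (x : PU base l → F) (y : PI (l ++ base) → F) :
    PU base (a :: l) → F := Sum.elim x y

lemma vmk_surj (a : Fˣ) {l : List Fˣ} (z : PI (a :: l) → F) : ∃ x y : PI l → F, z = vmk a x y :=
  ⟨fun i => z (Sum.inl i), fun i => z (Sum.inr i), by
    funext i; rcases i with i | i <;> rfl⟩

lemma vmku_surj (base : List Fˣ) (a : Fˣ) {l : List Fˣ} (z : PU base (a :: l) → F) :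
    ∃ x y, z = vmku base a x y :=
  ⟨fun i => z (Sum.inl i), fun i => z (Sum.inr i), by
    funext i; rcases i with i | i <;> rfl⟩

lemma vmk_zero (a : Fˣ) {l : List Fˣ} (x y : PI l → F) : vmk a x y = 0 ↔ x = 0 ∧ y = 0 := by
  constructor
  · intro h
    exact ⟨funext fun i => congrFun h (Sum.inl i), funext fun i => congrFun h (Sum.inr i)⟩
  · rintro ⟨rfl, rfl⟩
    funext i; rcases i with i | i <;> rfl

lemma vmku_zero (base : List Fˣ) (a : Fˣ) {l : List Fˣ} (x : PU base l → F) (y) :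
    vmku base a x y = 0 ↔ x = 0 ∧ y = 0 := by
  constructor
  · intro h
    exact ⟨funext fun i => congrFun h (Sum.inl i), funext fun i => congrFun h (Sum.inr i)⟩
  · rintro ⟨rfl, rfl⟩
    funext i; rcases i with i | i <;> rfl

lemma bf_vmk (a : Fˣ) {l : List Fˣ} (x y x' y' : PI l → F) :
    bf (pfam (a :: l)) (vmk a x y) (vmk a x' y') = bf (pfam l) x x' + a * bf (pfam l) y y' := by
  rw [← bf_fmul]
  exact bf_sum (pfam l) (fun i => (a : F) * pfam l i) (Sum.elim x y) (Sum.elim x' y')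

lemma bf_vmku (base : List Fˣ) (a : Fˣ) {l : List Fˣ} (x : PU base l → F) (y)
    (x' : PU base l → F) (y') :
    bf (pu base (a :: l)) (vmku base a x y) (vmku base a x' y') =
      bf (pu base l) x x' + a * bf (pfam (l ++ base)) y y' := by
  rw [← bf_fmul]
  exact bf_sum (pu base l) (fun i => (a : F) * pfam (l ++ base) i) (Sum.elim x y) (Sum.elim x' y')

lemma bf_nil (x y : PI ([] : List Fˣ) → F) : bf (pfam []) x y = x () * y () := by
  have : bf (pfam []) x y = ∑ i : Unit, 1 * x i * y i := rfl
  rw [this]; simp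

lemma bf_pu_nil (base : List Fˣ) (x y : PU base [] → F) : bf (pu base []) x y = 0 := by
  have : bf (pu base []) x y = ∑ i : Empty, pu base [] i * x i * y i := rfl
  rw [this]; simp

lemma pfam_ne : ∀ (l : List Fˣ) (i : PI l), pfam l i ≠ 0
  | [], _ => one_ne_zero
  | a :: l, i => by
    rcases i with i | i
    · exact pfam_ne l i
    · exact mul_ne_zero a.ne_zero (pfam_ne l i)

lemma pu_ne (base : List Fˣ) : ∀ (l : List Fˣ) (i : PU base l), pu base l i ≠ 0
  | [], i => i.elim
  | a :: l, i => by
    rcases i with i | i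
    · exact pu_ne base l i
    · exact mul_ne_zero a.ne_zero (pfam_ne _ i)

lemma sum_pfam : ∀ l : List Fˣ, ∑ i, dg (pfam l i) = pf l
  | [] => by
    have : ∑ i, dg (pfam ([] : List Fˣ) i) = ∑ i : Unit, dg (1 : F) := rfl
    rw [this]; simp [dg_one, pf_nil]
  | a :: l => by
    have : ∑ i, dg (pfam (a :: l) i) = ∑ i : PI l, dg (pfam l i) + ∑ i : PI l, dg (a * pfam l i) :=
      Fintype.sum_sum_type (fun i => dg (pfam (a :: l) i))
    rw [this]
    simp only [dg_mul, ← Finset.mul_sum, sum_pfam l, pf_cons]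
    ring

lemma sum_pu (base : List Fˣ) : ∀ l : List Fˣ, ∑ i, dg (pu base l i) = pf (l ++ base) - pf base
  | [] => by
    have : ∑ i, dg (pu base ([] : List Fˣ) i) = ∑ i : Empty, dg (pu base [] i) := rfl
    rw [this]; simp
  | a :: l => by
    have : ∑ i, dg (pu base (a :: l) i) =
        ∑ i : PU base l, dg (pu base l i) + ∑ i : PI (l ++ base), dg (a * pfam (l ++ base) i) :=
      Fintype.sum_sum_type (fun i => dg (pu base (a :: l) i))
    rw [this]
    simp only [dg_mul, ← Finset.mul_sum, sum_pfam, sum_pu base l, pf_cons, List.cons_append]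
    ring

lemma card_PI : ∀ l : List Fˣ, Fintype.card (PI l) = 2 ^ l.length
  | [] => rfl
  | a :: l => by
    have : Fintype.card (PI (a :: l)) = Fintype.card (PI l) + Fintype.card (PI l) :=
      Fintype.card_sum
    rw [this, card_PI l, List.length_cons, pow_succ]; ring

lemma card_PU (base : List Fˣ) : ∀ l : List Fˣ,
    Fintype.card (PU base l) + 2 ^ base.length = 2 ^ (l.length + base.length)
  | [] => by
    have : Fintype.card (PU base ([] : List Fˣ)) = 0 := rfl
    rw [this]; simp
  | a :: l => by
    have : Fintype.card (PU base (a :: l)) = Fintype.card (PU base l) + Fintype.card (PI (l ++ base)) :=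
      Fintype.card_sum
    have h := card_PU base l
    rw [this, card_PI, List.length_cons, List.length_append]
    rw [show l.length + 1 + base.length = (l.length + base.length) + 1 by ring, pow_succ]
    omega

lemma exists_one : ∀ l : List Fˣ, ∃ v, bf (pfam l) v v = 1
  | [] => ⟨fun _ => 1, by rw [bf_nil]; simp⟩
  | a :: l => by
    obtain ⟨v, hv⟩ := exists_one l
    exact ⟨vmk a v 0, by rw [bf_vmk, hv, bf_zero_l]; ring⟩

lemma exists_pu (base : List Fˣ) (a : Fˣ) (l : List Fˣ) : ∃ v, bf (pu base (a :: l)) v v = a := by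
  obtain ⟨v, hv⟩ := exists_one (l ++ base)
  exact ⟨vmku base a 0 v, by rw [bf_vmku, hv, bf_zero_l]; ring⟩

lemma pu_embed (base : List Fˣ) : ∀ (l : List Fˣ) (x : PU base l → F),
    ∃ y, bf (pfam (l ++ base)) y y = bf (pu base l) x x ∧ (y = 0 → x = 0)
  | [], x => ⟨0, by rw [bf_pu_nil, bf_zero_l], fun _ => funext fun i => i.elim⟩
  | a :: l, z => by
    obtain ⟨x, y, rfl⟩ := vmku_surj base a z
    obtain ⟨w, h1, h3⟩ := pu_embed base l x
    refine ⟨vmk a w y, ?_, ?_⟩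
    · rw [bf_vmku, ← h1]; exact bf_vmk a w y w y
    · intro h
      rw [vmku_zero]
      have := (vmk_zero a w y).1 h
      exact ⟨h3 this.1, this.2⟩

lemma iso_pu (base l : List Fˣ) (h : Iso (pu base l)) : Iso (pfam (l ++ base)) := by
  obtain ⟨x, h0, h1⟩ := h
  obtain ⟨y, h3, h4⟩ := pu_embed base l x
  exact ⟨y, fun h => h0 (h4 h), h3.trans h1⟩

lemma decomp_aux (base : List Fˣ) : ∀ (l : List Fˣ) (y : PI (l ++ base) → F),
    ∃ t x, bf (pfam (l ++ base)) y y = bf (pfam base) t t + bf (pu base l) x x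
  | [], y => ⟨y, 0, by rw [bf_zero_l, add_zero]; rfl⟩
  | a :: l, z => by
    obtain ⟨x, y, hz⟩ := vmk_surj a (l := l ++ base) z
    obtain ⟨t, w, h1⟩ := decomp_aux base l x
    refine ⟨t, vmku base a w y, ?_⟩
    rw [bf_vmku, ← add_assoc, ← h1, hz]
    exact bf_vmk a x y x y

lemma decomp (l : List Fˣ) (y : PI l → F) :
    ∃ t x, bf (pfam l) y y = t ^ 2 + bf (pu [] l) x x := by
  have := decomp_aux [] l
  rw [List.append_nil] at this
  obtain ⟨t, x, h⟩ := this y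
  exact ⟨t (), x, by rw [h, bf_nil]; ring⟩

lemma iso_pu_nil (l : List Fˣ) (h : Iso (pu [] l)) : Iso (pfam l) := by
  have := iso_pu [] l h
  rwa [List.append_nil] at this

lemma round_iso : ∀ l : List Fˣ,
    (∀ x, bf (pfam l) x x ≠ 0 → dg (bf (pfam l) x x) * pf l = pf l) ∧ (Iso (pfam l) → pf l = 0)
  | [] => by
    constructor
    · intro x hx
      rw [bf_nil] at *
      rw [dg_mul, dg_sq _ (left_ne_zero_of_mul hx), one_mul]
    · rintro ⟨x, h0, h1⟩
      rw [bf_nil] at h1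
      exact absurd (funext fun i => mul_self_eq_zero.1 h1) h0
  | a :: l => by
    obtain ⟨ih1, ih2⟩ := round_iso l
    by_cases hi : Iso (pfam l)
    · have : pf (a :: l) = 0 := by rw [pf_cons, ih2 hi, mul_zero]
      simp [this]
    have ha := dg_sq (a : F) a.ne_zero
    constructor
    · intro z hz
      obtain ⟨x, y, rfl⟩ := vmk_surj a z
      rw [bf_vmk] at *
      have hx := ih1 x
      have hy := ih1 y
      generalize bf (pfam l) x x = t at *
      generalize bf (pfam l) y y = s at *
      rw [pf_cons]
      by_cases ht : t = 0
      · subst ht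
        have hs : s ≠ 0 := by rintro rfl; simp at hz
        rw [zero_add, dg_mul]
        linear_combination (dg (a:F) + dg (a:F) * dg (a:F)) * hy hs + pf l * ha
      by_cases hs : s = 0
      · subst hs
        rw [mul_zero, add_zero]
        linear_combination (1 + dg (a:F)) * hx ht
      have h := dg_add _ _ hz
      rw [dg_mul] at h
      linear_combination - pf l * h + hx ht + dg (a:F) * hy hs
        - dg (t + a * s) * dg (a:F) * (dg s * hx ht + hy hs)
    · rintro ⟨z, h0, h1⟩
      obtain ⟨x, y, rfl⟩ := vmk_surj a z
      rw [bf_vmk] at *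
      have hx : x ≠ 0 := by
        rintro rfl
        rw [bf_zero_l, zero_add] at h1
        have h2 := (mul_eq_zero.1 h1).resolve_left a.ne_zero
        refine hi ⟨y, ?_, h2⟩
        rintro rfl
        exact h0 ((vmk_zero _ _ _).2 ⟨rfl, rfl⟩)
      have hx0 : bf (pfam l) x x ≠ 0 := fun h => hi ⟨x, hx, h⟩
      have e : (a : F) * bf (pfam l) y y = - bf (pfam l) x x := by linear_combination h1
      have hy0 : bf (pfam l) y y ≠ 0 := by
        intro h; rw [h, mul_zero] at e; exact hx0 (neg_eq_zero.1 e.symm)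
      have e2 := congrArg dg e
      rw [dg_mul, dg_neg] at e2
      rw [pf_cons]
      linear_combination pf l * e2 - ih1 x hx0 - dg (a : F) * ih1 y hy0

lemma pf_round (l : List Fˣ) (x) (h : bf (pfam l) x x ≠ 0) : dg (bf (pfam l) x x) * pf l = pf l :=
  (round_iso l).1 x h
lemma pf_iso {l : List Fˣ} (h : Iso (pfam l)) : pf l = 0 := (round_iso l).2 h

lemma iso_of_pf {l : List Fˣ} (h : pf l = 0) : Iso (pfam l) :=
  (faith (pfam l) (pfam_ne l) ((sum_pfam l).trans h)).iso (by rw [card_PI]; positivity)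

lemma rpgen (base : List Fˣ) (q : WittRing F) (N : ℕ)
    (Habs : ∀ (m g : List Fˣ) (t : F), m.length + g.length + 1 = N → t ≠ 0 →
      dg t * pf (m ++ base) = pf (m ++ base) → dg t * (q * pf m * pf g) = q * pf m * pf g) :
    ∀ (h g : List Fˣ) (x), h.length + g.length = N → bf (pu base h) x x ≠ 0 →
      ∃ h'' : List Fˣ, h''.length + 1 = h.length ∧
        q * pf h * pf g = q * (1 + dg (bf (pu base h) x x)) * pf h'' * pf g
  | [], g, x, _, hb => absurd (bf_pu_nil base x x) hb
  | a :: m, g, z, hN, hb => by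
    obtain ⟨x, y, rfl⟩ := vmku_surj base a z
    rw [bf_vmku] at *
    have hround := pf_round (m ++ base) y
    have IH := fun g' hg' => rpgen base q N Habs m g' x hg'
    generalize bf (pu base m) x x = b at *
    generalize bf (pfam (m ++ base)) y y = t at *
    rw [List.length_cons] at hN
    by_cases ht : t = 0
    · subst ht
      rw [mul_zero, add_zero] at *
      obtain ⟨h'', h1, h3⟩ := IH (a :: g) (by rw [List.length_cons]; omega) hb
      refine ⟨a :: h'', by simp [h1], ?_⟩
      rw [pf_cons] at *
      rw [pf_cons]
      linear_combination h3
    have hA := Habs m g t (by omega) ht (hround ht)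
    by_cases hb0 : b = 0
    · subst hb0
      rw [zero_add, dg_mul]
      refine ⟨m, rfl, ?_⟩
      rw [pf_cons]
      linear_combination -dg (a:F) * hA
    have hat : (a : F) * t ≠ 0 := mul_ne_zero a.ne_zero ht
    obtain ⟨h'', h1, h3⟩ := IH (Units.mk0 _ hat :: g) (by rw [List.length_cons]; omega) hb0
    refine ⟨Units.mk0 _ (mul_ne_zero hb0 hat) :: h'', by simp [h1], ?_⟩
    have h4 := dg_add _ _ hb
    simp only [pf_cons, Units.val_mk0, dg_mul] at *
    linear_combination -dg (a:F) * hA + h3 + q * pf h'' * pf g * h4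

lemma pure_sub (k : List Fˣ) (x) (hb : bf (pu [] k) x x ≠ 0) :
    ∃ m : List Fˣ, m.length + 1 = k.length ∧ pf k = (1 + dg (bf (pu [] k) x x)) * pf m := by
  obtain ⟨m, h1, h3⟩ := rpgen [] 1 k.length (by
    intro m g t _ _ h
    rw [List.append_nil] at h
    linear_combination pf g * h) k [] x (by simp) hb
  refine ⟨m, h1, ?_⟩
  rw [pf_nil] at h3
  linear_combination h3

lemma pP2 (h2 : (2 : F) ≠ 0) (k : List Fˣ) (u v) (hu : bf (pfam k) u u ≠ 0)
    (hv : bf (pfam k) v v ≠ 0) (huv : bf (pfam k) u v = 0) :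
    pf k = 0 ∨ ∃ m : List Fˣ, m.length + 1 = k.length ∧
      pf k = (1 + dg (bf (pfam k) u u * bf (pfam k) v v)) * pf m := by
  by_cases hi : Iso (pfam k)
  · exact Or.inl (pf_iso hi)
  right
  have hc := card_PU [] k
  obtain ⟨x, hx⟩ := valV2 h2 (pu [] k) (pfam k) (pu_ne _ _) (pfam_ne _) (by
    rw [card_PI]; simp at hc; omega) (bf (pfam k) u u) (by
    rw [sum_pfam, sum_pu, pf_round k u hu, List.append_nil, pf_nil]; ring)
    (fun h => hi (iso_pu_nil k h)) u v hu rfl hv huv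
  have := pure_sub k x (by rw [hx]; exact mul_ne_zero hu hv)
  rw [hx] at this
  exact this

end pfister
end WR
namespace WR
section ideals
variable {F : Type*} [Field F]

lemma fund_span (n : ℕ) :
    fundamentalIdeal F ^ n = Ideal.span {x | ∃ l : List Fˣ, l.length = n ∧ x = pf l} := by
  induction n with
  | zero =>
    rw [pow_zero, Ideal.one_eq_top, eq_comm, Ideal.eq_top_iff_one]
    exact Ideal.subset_span ⟨[], rfl, rfl⟩
  | succ n ih =>
    rw [pow_succ', ih]
    unfold fundamentalIdeal
    rw [Ideal.span_mul_span']
    congr 1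
    ext x
    constructor
    · rintro ⟨_, ⟨a, rfl⟩, _, ⟨l, hl, rfl⟩, rfl⟩
      exact ⟨a :: l, by simp [hl], by rw [pf_cons, dg_unit]⟩
    · rintro ⟨l, hl, rfl⟩
      match l, hl with
      | a :: l, hl =>
        exact ⟨_, ⟨a, rfl⟩, _, ⟨l, by simpa using hl, rfl⟩, by rw [pf_cons, dg_unit]⟩

lemma pf_mem (l : List Fˣ) : pf l ∈ fundamentalIdeal F ^ l.length := by
  rw [fund_span]; exact Ideal.subset_span ⟨l, rfl, rfl⟩

lemma fund_ind (n : ℕ) {p : WittRing F → Prop} (hz : p 0)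
    (h : ∀ (c : Fˣ) (l : List Fˣ), l.length = n → p (dg (c : F) * pf l))
    (hadd : ∀ x y, p x → p y → p (x + y)) (hneg : ∀ x, p x → p (-x))
    (x : WittRing F) (hx : x ∈ fundamentalIdeal F ^ n) : p x := by
  have key : ∀ r, p (r * x) := by
    rw [fund_span] at hx
    induction hx using Submodule.span_induction with
    | mem x hx =>
      obtain ⟨l, hl, rfl⟩ := hx
      intro r
      refine wr_induction (p := fun r => p (r * pf l)) r ?_ ?_ ?_
      · intro a; rw [← dg_unit]; exact h a l hl
      · intro x y hx hy; rw [add_mul]; exact hadd _ _ hx hy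
      · intro x hx; rw [neg_mul]; exact hneg _ hx
    | zero => intro r; rw [mul_zero]; exact hz
    | add x y _ _ hx hy => intro r; rw [mul_add]; exact hadd _ _ (hx r) (hy r)
    | smul a x _ hx => intro r; rw [smul_eq_mul, ← mul_assoc]; exact hx _
  have := key 1
  rwa [one_mul] at this

lemma two_pf (l : List Fˣ) : 2 * pf l = pf ((1 : Fˣ) :: l) := by
  rw [pf_cons, Units.val_one, dg_one]; ring

end ideals

section ext
variable {F E : Type*} [Field F] [Field E]

/-- the quadratic extension data, in the case of a genuine extension -/
structure Ext (s : F →+* E) (i : E) : Prop where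
  h2 : (2 : F) ≠ 0
  hi : i ^ 2 = -1
  hE : ∀ e : E, ∃ x y : F, e = s x + i * s y
  hns : ∀ j : F, j ^ 2 ≠ -1

variable {s : F →+* E} {i : E}

lemma Ext.uniq (X : Ext s i) {x y : F} (h : s x + i * s y = 0) : x = 0 ∧ y = 0 := by
  have hy : y = 0 := by
    by_contra hy
    have hy' : s y ≠ 0 := by simpa using hy
    refine X.hns (x / y) (s.injective ?_)
    have h1 : i = - (s x / s y) := by field_simp; linear_combination h
    have := X.hi
    rw [h1] at this
    simp only [map_pow, map_div₀, map_neg, map_one]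
    linear_combination this
  subst hy
  simp at h
  exact ⟨h, rfl⟩

lemma Ext.uniq' (X : Ext s i) {x y x' y' : F} (h : s x + i * s y = s x' + i * s y') :
    x = x' ∧ y = y' := by
  have := X.uniq (x := x - x') (y := y - y') (by simp only [map_sub]; linear_combination h)
  exact ⟨sub_eq_zero.1 this.1, sub_eq_zero.1 this.2⟩

lemma Ext.norm_ne (X : Ext s i) {x y : F} (h : ¬ (x = 0 ∧ y = 0)) : x ^ 2 + y ^ 2 ≠ 0 := by
  intro h0
  by_cases hy : y = 0
  · subst hy
    refine h ⟨?_, rfl⟩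
    simpa using h0
  · refine X.hns (x / y) ?_
    field_simp
    linear_combination h0

lemma dg_norm {x y : F} (h : x ^ 2 + y ^ 2 ≠ 0) : dg (x ^ 2 + y ^ 2) * 2 = 2 := by
  have := dg_binary 1 x y (by simpa using h)
  rw [dg_one, one_mul] at this
  linear_combination this

lemma res_pf (s : F →+* E) (l : List Fˣ) :
    res s (pf l) = pf (l.map (Units.map (s : F →* E))) := by
  induction l with
  | nil => simp [pf_nil]
  | cons a l ih => rw [List.map_cons, pf_cons, pf_cons, map_mul, ih, map_add, map_one, res_dg]; rfl

lemma Ext.split (X : Ext s i) {ι : Type} [Fintype ι] (a : ι → F) (x : ι → E) :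
    ∃ u v : ι → F, (x = 0 ↔ u = 0 ∧ v = 0) ∧ bf (fun j => s (a j)) x x =
      s (bf a u u - bf a v v) + i * s (2 * bf a u v) := by
  choose u v huv using fun j => X.hE (x j)
  refine ⟨u, v, ?_, ?_⟩
  · constructor
    · rintro rfl
      constructor
      · funext j; exact (X.uniq (huv j).symm).1
      · funext j; exact (X.uniq (huv j).symm).2
    · rintro ⟨rfl, rfl⟩
      funext j; simp [huv]
  · simp only [bf, map_sub, map_sum, map_mul, Finset.mul_sum, ← Finset.sum_sub_distrib,
      ← Finset.sum_add_distrib]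
    refine Finset.sum_congr rfl fun j _ => ?_
    rw [huv j]
    simp only [map_ofNat]
    linear_combination s (a j) * s (v j) ^ 2 * X.hi

lemma res_sum (s : F →+* E) (k : List Fˣ) : ∑ j, dg (s (pfam k j)) = res s (pf k) := by
  rw [← sum_pfam, map_sum]
  exact Finset.sum_congr rfl fun j _ => (res_dg s _).symm

lemma Ext.st1 (X : Ext s i) (k : List Fˣ) (h : Iso (fun j => s (pfam k j))) :
    pf k = 0 ∨ ∃ m : List Fˣ, m.length + 1 = k.length ∧ pf k = 2 * pf m := by
  obtain ⟨x, hx0, hx⟩ := h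
  obtain ⟨u, v, h1, h3⟩ := X.split (pfam k) x
  rw [hx] at h3
  obtain ⟨h4, h5⟩ := X.uniq h3.symm
  have h5 := (mul_eq_zero.1 h5).resolve_left X.h2
  by_cases hu : bf (pfam k) u u = 0
  · left
    apply pf_iso
    by_cases hu0 : u = 0
    · refine ⟨v, fun hv => hx0 (h1.2 ⟨hu0, hv⟩), ?_⟩
      linear_combination hu - h4
    · exact ⟨u, hu0, hu⟩
  · have hv : bf (pfam k) v v = bf (pfam k) u u := by linear_combination -h4
    rcases pP2 X.h2 k u v hu (by rwa [hv]) h5 with h | ⟨m, hm, h⟩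
    · exact Or.inl h
    · refine Or.inr ⟨m, hm, ?_⟩
      rw [hv, dg_mul, dg_sq _ hu] at h
      rw [h]; ring

lemma Ext.st1' (X : Ext s i) (k : List Fˣ) (h : res s (pf k) = 0) :
    pf k = 0 ∨ ∃ m : List Fˣ, m.length + 1 = k.length ∧ pf k = 2 * pf m := by
  refine X.st1 k (Met.iso (faith _ ?_ ?_) ?_)
  · intro j; simpa using pfam_ne k j
  · rw [res_sum, h]
  · rw [card_PI]; positivity

lemma Ext.keyS (X : Ext s i) (k : List Fˣ) (α β : F) (hw : α ^ 2 + β ^ 2 ≠ 0)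
    (h : dg (s α + i * s β) * res s (pf k) = res s (pf k)) :
    dg (α ^ 2 + β ^ 2) * pf k = pf k := by
  by_cases hi : Iso (fun j => s (pfam k j))
  · rcases X.st1 k hi with h0 | ⟨m, _, h0⟩
    · simp [h0]
    · rw [h0]; linear_combination pf m * dg_norm hw
  have hz : s α + i * s β ≠ 0 := by
    intro h
    obtain ⟨rfl, rfl⟩ := X.uniq h
    simp at hw
  obtain ⟨v1, hv1⟩ := exists_one k
  have hv1' : bf (fun j => (s α + i * s β) * s (pfam k j)) (fun j => s (v1 j)) (fun j => s (v1 j))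
      = s α + i * s β := by
    rw [bf_fmul (s α + i * s β) (fun j => s (pfam k j))]
    have : bf (fun j => s (pfam k j)) (fun j => s (v1 j)) (fun j => s (v1 j)) = s 1 := by
      rw [← hv1]; simp [bf]
    rw [this]; simp
  obtain ⟨x, hx⟩ := valV (fun j => s (pfam k j)) (fun j => (s α + i * s β) * s (pfam k j))
    (by intro j; simpa using pfam_ne k j)
    (by intro j; exact mul_ne_zero hz (by simpa using pfam_ne k j)) rfl
    (by simp only [dg_mul, ← Finset.mul_sum, res_sum, h]) hi _ (by rw [hv1']; exact hz)
  rw [hv1'] at hx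
  obtain ⟨u, v, h1, h3⟩ := X.split (pfam k) x
  rw [hx] at h3
  obtain ⟨hα, hβ⟩ := X.uniq' h3
  have hsq : ∀ t : F, α ^ 2 + β ^ 2 = t * t → dg (α ^ 2 + β ^ 2) * pf k = pf k := by
    intro t ht
    have : t ≠ 0 := by rintro rfl; rw [mul_zero] at ht; exact hw ht
    rw [ht, dg_mul, dg_sq t this, one_mul]
  by_cases hu0 : u = 0
  · subst hu0
    rw [bf_zero_l, mul_zero] at hβ
    exact hsq α (by rw [hβ]; ring)
  have hp : bf (pfam k) u u ≠ 0 := by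
    intro hp
    have : pf k = 0 := pf_iso ⟨u, hu0, hp⟩
    have hne : (fun j => s (u j)) ≠ 0 := by
      intro h
      apply hu0
      funext j
      have := congrFun h j
      simpa using this
    refine hi ⟨fun j => s (u j), hne, ?_⟩
    have : bf (fun j => s (pfam k j)) (fun j => s (u j)) (fun j => s (u j)) = s (bf (pfam k) u u) := by
      simp [bf]
    rw [this, hp, map_zero]
  obtain ⟨p, hpd⟩ : ∃ p, p = bf (pfam k) u u := ⟨_, rfl⟩
  obtain ⟨c, hcd⟩ : ∃ c, c = bf (pfam k) u v / p := ⟨_, rfl⟩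
  rw [← hpd] at hp
  have huv : bf (pfam k) u v = c * p := by rw [hcd]; field_simp
  obtain ⟨v', hv'⟩ : ∃ v', v' = v + (-c) • u := ⟨_, rfl⟩
  have huv' : bf (pfam k) u v' = 0 := by
    rw [hv', bf_add_r, bf_smul_r, huv, ← hpd]; ring
  have hvv' : bf (pfam k) v v = c ^ 2 * p + bf (pfam k) v' v' := by
    rw [hv']
    simp only [bf_add_r, bf_add_l, bf_smul_r, bf_smul_l, bf_comm (pfam k) v u, huv, ← hpd]
    ring
  obtain ⟨δ, hδ⟩ : ∃ δ, δ = bf (pfam k) v' v' / p := ⟨_, rfl⟩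
  have hρ : bf (pfam k) v' v' = δ * p := by rw [hδ]; field_simp
  rw [hvv', ← hpd, hρ] at hα
  rw [huv] at hβ
  have hweq : α ^ 2 + β ^ 2 = p * p * ((1 + c ^ 2 - δ) ^ 2 + δ * (2 * c) ^ 2) := by
    rw [hα, hβ]; ring
  by_cases hδ0 : δ = 0
  · exact hsq (p * (1 + c ^ 2)) (by rw [hweq, hδ0]; ring)
  have hb := dg_binary δ (1 + c ^ 2 - δ) (2 * c) (by
    intro h; rw [h, mul_zero] at hweq; exact hw hweq)
  rcases pP2 X.h2 k u v' (by rwa [← hpd]) (by rw [hρ]; exact mul_ne_zero hδ0 hp) huv' with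
    h0 | ⟨m, _, h0⟩
  · simp [h0]
  · rw [← hpd, hρ, show p * (δ * p) = p * p * δ by ring, dg_mul, dg_mul, dg_sq p hp, one_mul] at h0
    rw [hweq, dg_mul, dg_mul, dg_sq p hp, one_mul, h0]
    linear_combination pf m * hb

lemma Ext.stA (X : Ext s i) (n : ℕ) (H : ∀ l : List Eˣ, n ≤ l.length → pf l = 0)
    (D : List Fˣ) (hD : n ≤ D.length) (h : 2 * pf D = 0) : pf D = 0 := by
  by_contra hne
  have hi : ¬ Iso (pfam D) := fun h => hne (pf_iso h)
  rw [two_pf] at h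
  obtain ⟨z, hz0, hz⟩ := iso_of_pf h
  obtain ⟨u, v, rfl⟩ := vmk_surj 1 z
  rw [bf_vmk, Units.val_one, one_mul] at hz
  have hu0 : u ≠ 0 := by
    rintro rfl
    rw [bf_zero_l, zero_add] at hz
    refine hi ⟨v, ?_, hz⟩
    rintro rfl
    exact hz0 ((vmk_zero _ _ _).2 ⟨rfl, rfl⟩)
  have hα : bf (pfam D) u u ≠ 0 := fun h => hi ⟨u, hu0, h⟩
  obtain ⟨α, hαd⟩ : ∃ p, p = bf (pfam D) u u := ⟨_, rfl⟩
  obtain ⟨β, hβd⟩ : ∃ p, p = bf (pfam D) u v := ⟨_, rfl⟩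
  rw [← hαd] at hα hz
  obtain ⟨v', hv'⟩ : ∃ v', v' = v + (-(β / α)) • u := ⟨_, rfl⟩
  have huv' : bf (pfam D) u v' = 0 := by
    rw [hv', bf_add_r, bf_smul_r, ← hβd, ← hαd]; field_simp; ring
  have hw : α ^ 2 + β ^ 2 ≠ 0 := X.norm_ne (fun h => hα h.1)
  have hvv' : bf (pfam D) v' v' = -(α ^ 2 + β ^ 2) / α := by
    rw [hv']
    simp only [bf_add_r, bf_add_l, bf_smul_r, bf_smul_l, bf_comm (pfam D) v u, ← hβd, ← hαd]
    field_simp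
    linear_combination α * hz
  rcases pP2 X.h2 D u v' (by rwa [← hαd])
    (by rw [hvv']; exact div_ne_zero (neg_ne_zero.2 hw) hα) huv' with h0 | ⟨m, hm, h0⟩
  · exact hne h0
  rw [hvv', ← hαd, mul_div_cancel₀ _ hα, dg_neg] at h0
  have hzz : s α + i * s β ≠ 0 := fun h => hα (X.uniq h).1
  have h1 := H (Units.mk0 _ (neg_ne_zero.2 hzz) :: m.map (Units.map (s : F →* E)))
    (by simp; omega)
  rw [pf_cons, Units.val_mk0, dg_neg, ← res_pf] at h1
  have h3 := X.keyS m α β hw (by linear_combination -h1)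
  apply hne
  rw [h0]
  linear_combination -h3

end ext
end WR
namespace WR
section good
variable {F : Type*} [Field F]

/-- abstract properties of Pfister forms of large fold -/
structure Good (F : Type*) [Field F] (n : ℕ) : Prop where
  A : ∀ D : List Fˣ, n ≤ D.length → 2 * pf D = 0 → pf D = 0
  S1 : ∀ D : List Fˣ, n ≤ D.length → pf D = 0 ∨ ∃ m : List Fˣ, m.length + 1 = D.length ∧ pf D = 2 * pf m

variable {n : ℕ}

lemma Good.halve (G : Good F n) : ∀ bs p h : List Fˣ, h.length = bs.length →
    n ≤ p.length + h.length → 2 * (pf p * pf h) = 2 * (pf p * pf bs) →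
    pf p * pf h = pf p * pf bs
  | [], p, h, hl, _, _ => by
    rw [List.length_nil, List.length_eq_zero_iff] at hl
    rw [hl]
  | b :: bs, p, h, hl, hn, he => by
    have hA : ∀ l : List Fˣ, l.length = h.length → 2 * (pf p * pf l) = 0 → pf p * pf l = 0 := by
      intro l hl h0
      rw [← pf_append] at h0 ⊢
      exact G.A _ (by rw [List.length_append, hl]; exact hn) h0
    by_cases hi : Iso (pu (1 :: p) h)
    · have h0 := pf_iso (iso_pu _ _ hi)
      rw [pf_append, pf_cons, Units.val_one, dg_one] at h0
      have h1 : 2 * (pf p * pf h) = 0 := by linear_combination h0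
      rw [hA h rfl h1, hA (b :: bs) hl.symm (he.symm.trans h1)]
    · obtain ⟨v, hv⟩ := exists_pu (1 :: p) b bs
      have c1 := card_PU (1 :: p) h
      have c2 := card_PU (1 :: p) (b :: bs)
      rw [hl] at c1
      obtain ⟨x, hx⟩ := valV (pu (1 :: p) h) (pu (1 :: p) (b :: bs)) (pu_ne _ _) (pu_ne _ _)
        (by omega) (by
          rw [sum_pu, sum_pu, pf_append, pf_append, pf_cons 1, Units.val_one, dg_one]
          linear_combination he) hi v (by rw [hv]; exact b.ne_zero)
      rw [hv] at hx
      obtain ⟨h'', h1, h3⟩ := rpgen (1 :: p) (pf p) h.length (by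
        intro m g t hlen ht hr
        rw [pf_append, pf_cons, Units.val_one, dg_one] at hr
        have := G.A (Units.mk0 (-t) (neg_ne_zero.2 ht) :: (p ++ (m ++ g)))
          (by simp only [List.length_cons, List.length_append]; omega) (by
            rw [pf_cons, pf_append, pf_append, Units.val_mk0, dg_neg]
            linear_combination -pf g * hr)
        rw [pf_cons, pf_append, pf_append, Units.val_mk0, dg_neg] at this
        linear_combination -this) h [] x (by simp) (by rw [hx]; exact b.ne_zero)
      rw [hx, pf_nil] at h3
      rw [pf_cons] at he ⊢
      have := Good.halve G bs (b :: p) h'' (by simp at hl; omega) (by simp; omega) (by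
        rw [pf_cons]; linear_combination he - 2 * h3)
      rw [pf_cons] at this
      linear_combination this + h3

lemma Good.halve_pow (G : Good F n) (M : ℕ) : ∀ d d' : List Fˣ, d.length = d'.length →
    n ≤ d.length → 2 ^ M * pf d = 2 ^ M * pf d' → pf d = pf d' := by
  induction M with
  | zero => intro d d' _ _ h; simpa using h
  | succ M ih =>
    intro d d' hl hn h
    have h1 := ih (1 :: d) (1 :: d') (by simp [hl]) (by simp; omega) (by
      rw [← two_pf, ← two_pf]; linear_combination h)
    rw [← two_pf, ← two_pf] at h1
    have := G.halve d' [] d hl (by simpa using hn) (by rw [pf_nil]; linear_combination h1)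
    rw [pf_nil] at this
    linear_combination this

lemma Good.A_pow (G : Good F n) (M : ℕ) : ∀ d : List Fˣ, n ≤ d.length → 2 ^ M * pf d = 0 →
    pf d = 0 := by
  induction M with
  | zero => intro d _ h; simpa using h
  | succ M ih =>
    intro d hn h
    have h1 := ih (1 :: d) (by simp; omega) (by rw [← two_pf]; linear_combination h)
    rw [← two_pf] at h1
    exact G.A d hn h1

lemma Good.tors1 (G : Good F n) (D : List Fˣ) (hD : n ≤ D.length) (N : ℕ) (hN : N ≠ 0)
    (h : (N : WittRing F) * pf D = 0) : pf D = 0 := by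
  by_contra hne
  have hi : ¬ Iso (pfam D) := fun h => hne (pf_iso h)
  have hm : Met (fun q : Fin N × PI D => pfam D q.2) := by
    refine faith _ (fun q => pfam_ne D q.2) ?_
    rw [Fintype.sum_prod_type]
    simp only [sum_pfam]
    simpa using h
  obtain ⟨x, hx0, hx⟩ := hm.iso (by
    rw [Fintype.card_prod, card_PI, Fintype.card_fin]; positivity)
  have hx' : ∑ j : Fin N, bf (pfam D) (fun q => x (j, q)) (fun q => x (j, q)) = 0 := by
    rw [← hx]; simp only [bf]; rw [Fintype.sum_prod_type]
  have key : ∀ S : Finset (Fin N), (∀ j ∈ S, (fun q => x (j, q)) = 0) ∨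
      ((∑ j ∈ S, bf (pfam D) (fun q => x (j, q)) (fun q => x (j, q))) ≠ 0 ∧ ∃ k : ℕ,
        dg (∑ j ∈ S, bf (pfam D) (fun q => x (j, q)) (fun q => x (j, q))) * (2 ^ k * pf D)
          = 2 ^ k * pf D) := by
    intro S
    induction S using Finset.induction_on with
    | empty => left; simp
    | insert j S hj ih =>
      rw [Finset.sum_insert hj]
      by_cases hj0 : (fun q => x (j, q)) = 0
      · rw [hj0, bf_zero_l, zero_add]
        rcases ih with ih | ih
        · left
          intro j' hj'
          rcases Finset.mem_insert.1 hj' with rfl | h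
          · exact hj0
          · exact ih _ h
        · exact Or.inr ih
      · right
        have hd : bf (pfam D) (fun q => x (j, q)) (fun q => x (j, q)) ≠ 0 := fun h => hi ⟨_, hj0, h⟩
        have hr := pf_round D _ hd
        generalize bf (pfam D) (fun q => x (j, q)) (fun q => x (j, q)) = d at *
        rcases ih with ih | ⟨ih1, k, ih2⟩
        · rw [Finset.sum_eq_zero (fun j' hj' => by rw [ih j' hj', bf_zero_l]), add_zero]
          exact ⟨hd, 0, by simpa using hr⟩
        · generalize ∑ j ∈ S, bf (pfam D) (fun q => x (j, q)) (fun q => x (j, q)) = y at *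
          have hs : d + y ≠ 0 := by
            intro h0
            have : d = -y := by linear_combination h0
            rw [this, dg_neg] at hr
            apply hne
            refine G.A_pow (k + 1) D hD ?_
            rw [pow_succ]
            linear_combination -ih2 - 2 ^ k * hr
          refine ⟨hs, k + 1, ?_⟩
          have := dg_add d y hs
          rw [pow_succ]
          linear_combination - 2 ^ k * pf D * this + 2 ^ k * hr + ih2
            - dg (d + y) * (dg d * ih2 + 2 ^ k * hr)
  rcases key Finset.univ with h1 | h1
  · apply hx0
    funext q
    exact congrFun (h1 q.1 (Finset.mem_univ _)) q.2
  · exact h1.1 hx'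

lemma sgn_pf (p : WittRing F) : ∀ O : List Fˣ,
    (∀ b ∈ O, dg (b : F) * p = p ∨ dg (b : F) * p = -p) → p * pf O = 2 ^ O.length * p ∨ p * pf O = 0
  | [], _ => by left; simp [pf_nil]
  | b :: O, h => by
    have ih := sgn_pf p O (fun c hc => h c (List.mem_cons_of_mem _ hc))
    rw [pf_cons, List.length_cons, pow_succ]
    rcases h b List.mem_cons_self with hb | hb
    · rcases ih with ih | ih
      · left; linear_combination pf O * hb + 2 * ih
      · right; linear_combination pf O * hb + 2 * ih
    · right; linear_combination pf O * hb

/-- formal sums -/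
noncomputable def S (L : List (ℤ × List Fˣ × List Fˣ)) : WittRing F :=
  (L.map (fun t => (t.1 : WittRing F) * pf t.2.1)).sum

lemma Good.splt (G : Good F n) (a : Fˣ) (D : List Fˣ) (hD : D.length = n) :
    ∃ P Q : List Fˣ, P.length = n ∧ Q.length = n ∧ 2 * pf P = (1 + dg (a : F)) * pf D ∧
      2 * pf Q = (1 - dg (a : F)) * pf D ∧ pf D = pf P + pf Q := by
  rcases G.S1 D hD.ge with h | ⟨m, hm, h⟩
  · exact ⟨D, D, hD, hD, by simp [h], by simp [h], by simp [h]⟩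
  · refine ⟨a :: m, -a :: m, by simp; omega, by simp; omega, ?_, ?_, ?_⟩ <;>
      rw [h] <;> simp only [pf_cons, Units.val_neg, dg_neg] <;> ring

lemma Good.torsT (G : Good F n) : ∀ (as : List Fˣ) (p : WittRing F) (M : ℕ)
    (L : List (ℤ × List Fˣ × List Fˣ)) (N : ℕ), N ≠ 0 →
    (∀ t ∈ L, t.2.1.length = n ∧ 2 ^ M * pf t.2.1 = p * pf t.2.2 ∧ t.2.2.length = n ∧
      ∀ b ∈ t.2.2, b ∈ as ∨ dg (b : F) * p = p ∨ dg (b : F) * p = -p) →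
    (N : WittRing F) * S L = 0 → S L = 0
  | [], p, M, L, N, hN, hL, h0 => by
    by_cases hall : ∀ t ∈ L, pf t.2.1 = 0
    · unfold S
      apply List.sum_eq_zero
      intro x hx
      obtain ⟨t, ht, rfl⟩ := List.mem_map.1 hx
      rw [hall t ht, mul_zero]
    · push Not at hall
      obtain ⟨t0, ht0, hne⟩ := hall
      have hcase : ∀ t ∈ L, pf t.2.1 ≠ 0 → 2 ^ M * pf t.2.1 = 2 ^ n * p := by
        intro t ht hne
        obtain ⟨h1, h3, h4, h5⟩ := hL t ht
        rcases sgn_pf p t.2.2 (fun b hb => (h5 b hb).resolve_left (by simp)) with h | h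
        · rw [h3, h, h4]
        · exact absurd (G.A_pow M _ h1.ge (h3.trans h)) hne
      have heq : ∀ t ∈ L, pf t.2.1 = 0 ∨ pf t.2.1 = pf t0.2.1 := by
        intro t ht
        by_cases hz : pf t.2.1 = 0
        · exact Or.inl hz
        · exact Or.inr (G.halve_pow M _ _ ((hL t ht).1.trans (hL t0 ht0).1.symm) (hL t ht).1.ge
            ((hcase t ht hz).trans (hcase t0 ht0 hne).symm))
      have hK : ∀ L' : List (ℤ × List Fˣ × List Fˣ), (∀ t ∈ L', pf t.2.1 = 0 ∨ pf t.2.1 = pf t0.2.1) →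
          ∃ K : ℤ, S L' = (K : WittRing F) * pf t0.2.1 := by
        intro L'
        induction L' with
        | nil => intro _; exact ⟨0, by simp [S]⟩
        | cons t L' ih =>
          intro h
          obtain ⟨K, hK⟩ := ih (fun t ht => h t (List.mem_cons_of_mem _ ht))
          have e : S (t :: L') = (t.1 : WittRing F) * pf t.2.1 + S L' := by simp [S]
          rcases h t List.mem_cons_self with h | h
          · exact ⟨K, by rw [e, h, hK]; ring⟩
          · exact ⟨t.1 + K, by rw [e, h, hK]; push_cast; ring⟩
      obtain ⟨K, hK⟩ := hK L heq
      by_cases hK0 : K = 0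
      · rw [hK, hK0]; simp
      exfalso
      apply hne
      rw [hK] at h0
      have hk0 : K.natAbs ≠ 0 := by simpa using hK0
      have hor := Int.natAbs_eq K
      revert hk0 hor
      generalize K.natAbs = k
      intro hk0 hor
      refine G.tors1 _ (hL t0 ht0).1.ge (N * k) (Nat.mul_ne_zero hN hk0) ?_
      rcases hor with h | h
      · rw [h] at h0; push_cast at h0 ⊢; linear_combination h0
      · rw [h] at h0; push_cast at h0 ⊢; linear_combination -h0
  | a :: as, p, M, L, N, hN, hL, h0 => by
    have hs : ∀ D : List Fˣ, ∃ PQ : List Fˣ × List Fˣ, D.length = n →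
      PQ.1.length = n ∧ PQ.2.length = n ∧ 2 * pf PQ.1 = (1 + dg (a : F)) * pf D ∧
      2 * pf PQ.2 = (1 - dg (a : F)) * pf D ∧ pf D = pf PQ.1 + pf PQ.2 := by
      intro D
      by_cases hD : D.length = n
      · obtain ⟨P, Q, h⟩ := G.splt a D hD
        exact ⟨(P, Q), fun _ => h⟩
      · exact ⟨([], []), fun h => absurd h hD⟩
    choose f hf using hs
    have haa := dg_sq (a : F) a.ne_zero
    have e1 : ∀ L' : List (ℤ × List Fˣ × List Fˣ), (∀ t ∈ L', t.2.1.length = n) →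
        2 * S (L'.map fun t => (t.1, (f t.2.1).1, t.2.2)) = (1 + dg (a : F)) * S L' ∧
        2 * S (L'.map fun t => (t.1, (f t.2.1).2, t.2.2)) = (1 - dg (a : F)) * S L' ∧
        S L' = S (L'.map fun t => (t.1, (f t.2.1).1, t.2.2)) +
          S (L'.map fun t => (t.1, (f t.2.1).2, t.2.2)) := by
      intro L'
      induction L' with
      | nil => intro _; simp [S]
      | cons t L' ih =>
        intro h
        obtain ⟨i1, i2, i3⟩ := ih (fun t ht => h t (List.mem_cons_of_mem _ ht))
        have e : ∀ (t) (L' : List (ℤ × List Fˣ × List Fˣ)),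
          S (t :: L') = (t.1 : WittRing F) * pf t.2.1 + S L' := by simp [S]
        obtain ⟨_, _, j1, j2, j3⟩ := hf t.2.1 (h t List.mem_cons_self)
        rw [List.map_cons, List.map_cons, e, e, e]
        refine ⟨?_, ?_, ?_⟩
        · linear_combination i1 + (t.1 : WittRing F) * j1
        · linear_combination i2 + (t.1 : WittRing F) * j2
        · linear_combination i3 + (t.1 : WittRing F) * j3
    obtain ⟨i1, i2, i3⟩ := e1 L (fun t ht => (hL t ht).1)
    have r1 := Good.torsT G as ((1 + dg (a : F)) * p) (M + 1)
      (L.map fun t => (t.1, (f t.2.1).1, t.2.2)) (N * 2) (by omega) (by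
        intro t' ht'
        obtain ⟨t, ht, rfl⟩ := List.mem_map.1 ht'
        obtain ⟨g1, g2, g3, g4⟩ := hL t ht
        obtain ⟨k1, k2, k3, k4, k5⟩ := hf t.2.1 g1
        refine ⟨k1, ?_, g3, ?_⟩
        · simp only
          rw [pow_succ]
          linear_combination 2 ^ M * k3 + (1 + dg (a : F)) * g2
        · intro b hb
          rcases g4 b hb with h | h | h
          · rcases List.mem_cons.1 h with rfl | h
            · right; left; linear_combination p * haa
            · exact Or.inl h
          · right; left; linear_combination (1 + dg (a : F)) * h
          · right; right; linear_combination (1 + dg (a : F)) * h) (by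
        push_cast; linear_combination (1 + dg (a : F)) * h0 + N * i1)
    have r2 := Good.torsT G as ((1 - dg (a : F)) * p) (M + 1)
      (L.map fun t => (t.1, (f t.2.1).2, t.2.2)) (N * 2) (by omega) (by
        intro t' ht'
        obtain ⟨t, ht, rfl⟩ := List.mem_map.1 ht'
        obtain ⟨g1, g2, g3, g4⟩ := hL t ht
        obtain ⟨k1, k2, k3, k4, k5⟩ := hf t.2.1 g1
        refine ⟨k2, ?_, g3, ?_⟩
        · simp only
          rw [pow_succ]
          linear_combination 2 ^ M * k4 + (1 - dg (a : F)) * g2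
        · intro b hb
          rcases g4 b hb with h | h | h
          · rcases List.mem_cons.1 h with rfl | h
            · right; right; linear_combination -p * haa
            · exact Or.inl h
          · right; left; linear_combination (1 - dg (a : F)) * h
          · right; right; linear_combination (1 - dg (a : F)) * h) (by
        push_cast; linear_combination (1 - dg (a : F)) * h0 + N * i2)
    rw [i3, r1, r2, add_zero]

lemma Good.tors (G : Good F n) (x : WittRing F) (hx : x ∈ fundamentalIdeal F ^ n) (N : ℕ)
    (hN : N ≠ 0) (h : (N : WittRing F) * x = 0) : x = 0 := by
  have hrep : ∃ L : List (ℤ × List Fˣ × List Fˣ),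
      (∀ t ∈ L, t.2.1.length = n ∧ t.2.2 = t.2.1) ∧ x = S L := by
    have e : ∀ (L L' : List (ℤ × List Fˣ × List Fˣ)), S (L ++ L') = S L + S L' := by simp [S]
    refine fund_ind n (p := fun x => ∃ L : List (ℤ × List Fˣ × List Fˣ),
      (∀ t ∈ L, t.2.1.length = n ∧ t.2.2 = t.2.1) ∧ x = S L) ?_ ?_ ?_ ?_ x hx
    · exact ⟨[], by simp, by simp [S]⟩
    · intro c l hl
      rcases G.S1 (c :: l) (by simp; omega) with h | ⟨m, hm, h⟩
      · refine ⟨[(-1, l, l)], by simpa using hl, ?_⟩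
        rw [pf_cons] at h
        simp [S]
        linear_combination h
      · refine ⟨[(-1, l, l), (2, m, m)], ?_, ?_⟩
        · simp at hm; simp; omega
        · rw [pf_cons] at h
          simp [S]
          linear_combination h
    · rintro _ _ ⟨L, h1, rfl⟩ ⟨L', h1', rfl⟩
      refine ⟨L ++ L', ?_, (e _ _).symm⟩
      intro t ht
      rcases List.mem_append.1 ht with h | h
      · exact h1 t h
      · exact h1' t h
    · rintro _ ⟨L, h1, rfl⟩
      refine ⟨L.map (fun t => (-t.1, t.2)), ?_, ?_⟩
      · intro t ht
        obtain ⟨t', ht', rfl⟩ := List.mem_map.1 ht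
        exact h1 t' ht'
      · clear h1
        induction L with
        | nil => simp [S]
        | cons t L ih =>
          have e : ∀ (t) (L' : List (ℤ × List Fˣ × List Fˣ)),
            S (t :: L') = (t.1 : WittRing F) * pf t.2.1 + S L' := by simp [S]
          rw [List.map_cons, e, e, ← ih]; push_cast; ring
  obtain ⟨L, h1, rfl⟩ := hrep
  refine G.torsT (L.flatMap fun t => t.2.2) 1 0 L N hN ?_ h
  intro t ht
  obtain ⟨h3, h4⟩ := h1 t ht
  refine ⟨h3, by rw [h4]; ring, by rw [h4, h3], fun b hb => Or.inl ?_⟩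
  exact List.mem_flatMap.2 ⟨t, ht, hb⟩

lemma Good.div (G : Good F n) (x : WittRing F) (hx : x ∈ fundamentalIdeal F ^ n) :
    ∃ y ∈ fundamentalIdeal F ^ (n - 1), x = 2 * y := by
  refine fund_ind n (p := fun x => ∃ y ∈ fundamentalIdeal F ^ (n - 1), x = 2 * y) ?_ ?_ ?_ ?_ x hx
  · exact ⟨0, zero_mem _, by simp⟩
  · intro c l hl
    rcases G.S1 l hl.ge with h | ⟨m, hm, h⟩
    · exact ⟨0, zero_mem _, by simp [h]⟩
    · refine ⟨dg (c : F) * pf m, Ideal.mul_mem_left _ _ ?_, by rw [h]; ring⟩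
      have := pf_mem m
      rwa [show m.length = n - 1 by omega] at this
  · rintro _ _ ⟨y, hy, rfl⟩ ⟨z, hz, rfl⟩
    exact ⟨y + z, add_mem hy hz, by ring⟩
  · rintro _ ⟨y, hy, rfl⟩
    exact ⟨-y, neg_mem hy, by ring⟩

lemma two_mem : (2 : WittRing F) ∈ fundamentalIdeal F := by
  refine Ideal.subset_span ⟨1, ?_⟩
  rw [diag_one]; norm_num

lemma two_mul_mem (n : ℕ) (hn : 1 ≤ n) (y : WittRing F) (hy : y ∈ fundamentalIdeal F ^ (n - 1)) :
    2 * y ∈ fundamentalIdeal F ^ n := by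
  have := Ideal.mul_mem_mul (two_mem (F := F)) hy
  rwa [← pow_succ', Nat.sub_add_cancel hn] at this

end good

section forward
variable {F E : Type*} [Field F] [Field E] {s : F →+* E} {i : E}

lemma Ext.good (X : Ext s i) (n : ℕ) (H : ∀ l : List Eˣ, n ≤ l.length → pf l = 0) : Good F n where
  A := X.stA n H
  S1 := fun D hD => X.st1' D (by rw [res_pf]; exact H _ (by simpa using hD))

end forward
end WR
namespace WR
section backward
variable {F E : Type*} [Field F] [Field E] {s : F →+* E} {i : E}

lemma two_eq_zero {i : E} (hi : i ^ 2 = -1) : (2 : WittRing E) = 0 := by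
  have hi0 : i ≠ 0 := by
    rintro rfl
    have : (1 : E) = 0 := by linear_combination hi
    exact one_ne_zero this
  have h1 := dg_sq i hi0
  rw [← dg_mul, ← pow_two, hi, dg_neg_one] at h1
  linear_combination -h1

lemma Ext.keyB (X : Ext s i) (k : List Fˣ)
    (hT : ∀ l : List Fˣ, l.length = k.length + 1 → 2 * pf l = 0 → pf l = 0)
    (hD : ∀ l : List Fˣ, l.length = k.length + 1 → ∃ y, pf l = 2 * y)
    (z : E) (hz : z ≠ 0) : (1 + dg z) * res s (pf k) = 0 := by
  have two := two_eq_zero X.hi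
  obtain ⟨x, y, rfl⟩ := X.hE z
  have hw : x ^ 2 + y ^ 2 ≠ 0 := X.norm_ne (by rintro ⟨rfl, rfl⟩; simp at hz)
  have hwk : dg (x ^ 2 + y ^ 2) * pf k = pf k := by
    have := hT (-(Units.mk0 _ hw) :: k) (by simp) (by
      rw [pf_cons, Units.val_neg, Units.val_mk0, dg_neg]
      linear_combination -pf k * dg_norm hw)
    rw [pf_cons, Units.val_neg, Units.val_mk0, dg_neg] at this
    linear_combination -this
  by_cases hI : Iso (pfam k)
  · rw [pf_iso hI, map_zero, mul_zero]
  obtain ⟨v1, hv1⟩ := exists_one k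
  have hv1' : bf (fun j => (x ^ 2 + y ^ 2) * pfam k j) v1 v1 = x ^ 2 + y ^ 2 := by
    rw [bf_fmul, hv1, mul_one]
  obtain ⟨u, hu⟩ := valV (pfam k) (fun j => (x ^ 2 + y ^ 2) * pfam k j) (pfam_ne k)
    (fun j => mul_ne_zero hw (pfam_ne k j)) rfl
    (by simp only [dg_mul, ← Finset.mul_sum, sum_pfam, hwk]) hI v1 (by rw [hv1']; exact hw)
  rw [hv1'] at hu
  obtain ⟨t, v, ht⟩ := decomp k u
  rw [hu] at ht
  have hpure := pure_sub k v
  obtain ⟨w', hw'⟩ : ∃ w', w' = bf (pu [] k) v v := ⟨_, rfl⟩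
  rw [← hw'] at ht hpure
  have main : ∀ t : F, x ^ 2 + y ^ 2 = t ^ 2 + w' → x + t ≠ 0 →
      (1 + dg (s x + i * s y)) * res s (pf k) = 0 := by
    intro t ht hxt
    obtain ⟨g, hg⟩ : ∃ g, g = 2 * (x + t) := ⟨_, rfl⟩
    have hg0 : g ≠ 0 := by rw [hg]; exact mul_ne_zero X.h2 hxt
    have hsg0 : s g ≠ 0 := by simpa using hg0
    have hst : s x ^ 2 + s y ^ 2 = s t ^ 2 + s w' := by
      have := congrArg s ht; simpa using this
    have hsg : s g = 2 * (s x + s t) := by rw [hg, map_mul, map_add, map_ofNat]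
    have hid : (s x + i * s y + s t) ^ 2 + s w' * 1 ^ 2 = s g * (s x + i * s y) := by
      rw [hsg]; linear_combination -hst + s y ^ 2 * X.hi
    have hne : s g * (s x + i * s y) ≠ 0 := mul_ne_zero hsg0 hz
    have e1 : dg (s g * (s x + i * s y)) * res s (pf k) = res s (pf k) := by
      by_cases hw0 : w' = 0
      · rw [← hid, hw0]
        have h0 : s x + i * s y + s t ≠ 0 := by
          intro h
          rw [← hid, h, hw0] at hne
          simp at hne
        rw [map_zero, zero_mul, add_zero, pow_two, dg_mul, dg_sq _ h0, one_mul]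
      · obtain ⟨m, _, hm⟩ := hpure hw0
        have := dg_binary (s w') (s x + i * s y + s t) 1 (by rw [hid]; exact hne)
        rw [hid] at this
        rw [hm, map_mul, map_add, map_one, res_dg]
        linear_combination res s (pf m) * this
    obtain ⟨q, hq⟩ := hD (Units.mk0 g hg0 :: k) (by simp)
    rw [pf_cons, Units.val_mk0] at hq
    have hq' := congrArg (res s) hq
    rw [map_mul, map_add, map_one, res_dg, map_mul, map_ofNat, two, zero_mul] at hq'
    rw [dg_mul] at e1
    have hgg := dg_sq _ hsg0
    linear_combination dg (s g) * e1 + hq' - dg (s x + i * s y) * res s (pf k) * hgg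

  by_cases h1 : x + t = 0
  · by_cases h3 : x + -t = 0
    · have hx : x = 0 := by
        have : 2 * x = 0 := by linear_combination h1 + h3
        exact (mul_eq_zero.1 this).resolve_left X.h2
      have ht0 : t = 0 := by rw [hx] at h1; simpa using h1
      have hwy : w' = y * y := by rw [hx, ht0] at ht; linear_combination -ht
      have hy0 : y ≠ 0 := by rintro rfl; rw [hx] at hw; simp at hw
      obtain ⟨m, _, hm⟩ := hpure (by rw [hwy]; exact mul_ne_zero hy0 hy0)
      rw [hwy, dg_mul, dg_sq y hy0] at hm
      have : res s (pf k) = 0 := by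
        rw [hm, map_mul, map_add, map_one]
        linear_combination res s (pf m) * two
      rw [this, mul_zero]
    · exact main (-t) (by rw [ht]; ring) h3
  · exact main t ht h1

/-- auxiliary ideal -/
noncomputable def JJ (s : F →+* E) (n : ℕ) : Ideal (WittRing E) :=
  Ideal.span {w | ∃ z : E, z ≠ 0 ∧ ∃ x ∈ fundamentalIdeal F ^ n, w = (1 + dg z) * res s x}

lemma one_add_mem (f : F) (hf : f ≠ 0) (n : ℕ) (x : WittRing F) (hx : x ∈ fundamentalIdeal F ^ n) :
    (1 + dg f) * x ∈ fundamentalIdeal F ^ (n + 1) := by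
  rw [pow_succ']
  refine Ideal.mul_mem_mul (Ideal.subset_span ⟨Units.mk0 f hf, ?_⟩) hx
  rw [← dg_unit, Units.val_mk0]

lemma JJ_gen (n : ℕ) (z : E) (hz : z ≠ 0) (f : F) (hf : f ≠ 0) (x : WittRing F)
    (hx : x ∈ fundamentalIdeal F ^ n) : (1 + dg z) * (1 + dg (s f)) * res s x ∈ JJ s (n + 1) := by
  refine Ideal.subset_span ⟨z, hz, (1 + dg f) * x, one_add_mem f hf n x hx, ?_⟩
  rw [map_mul, map_add, map_one, res_dg]; ring

lemma Ext.JJ_step (X : Ext s i) (n : ℕ) (z z' : E) (hz : z ≠ 0) (hz' : z' ≠ 0) (x : WittRing F)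
    (hx : x ∈ fundamentalIdeal F ^ n) : (1 + dg z') * ((1 + dg z) * res s x) ∈ JJ s (n + 1) := by
  have two := two_eq_zero X.hi
  obtain ⟨a, b, hab⟩ := X.hE z
  obtain ⟨c, d, hcd⟩ := X.hE z'
  by_cases hdet : a * d - b * c = 0
  · have hw : a ^ 2 + b ^ 2 ≠ 0 := X.norm_ne (by rintro ⟨rfl, rfl⟩; simp at hab; exact hz hab)
    obtain ⟨f, hf⟩ : ∃ f, f = (a * c + b * d) / (a ^ 2 + b ^ 2) := ⟨_, rfl⟩
    have h1 : c = f * a := by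
      rw [hf]; field_simp; linear_combination -b * hdet
    have h3 : d = f * b := by
      rw [hf]; field_simp; linear_combination a * hdet
    have hzz : z' = s f * z := by rw [hcd, hab, h1, h3, map_mul, map_mul]; ring
    have hf0 : f ≠ 0 := by rintro rfl; simp at hzz; exact hz' hzz
    have := JJ_gen (s := s) n z hz f hf0 x hx
    convert this using 1
    rw [hzz, dg_mul]
    linear_combination dg (s f) * res s x * dg_sq z hz
  · obtain ⟨Δ, hΔ⟩ : ∃ Δ, Δ = a * d - b * c := ⟨_, rfl⟩
    rw [← hΔ] at hdet
    obtain ⟨f, hf⟩ : ∃ f, f = d / Δ := ⟨_, rfl⟩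
    obtain ⟨g, hg⟩ : ∃ g, g = -b / Δ := ⟨_, rfl⟩
    have h1 : f * a + g * c = 1 := by rw [hf, hg]; field_simp; linear_combination -hΔ
    have h3 : f * b + g * d = 0 := by rw [hf, hg]; field_simp; ring
    have hs1 : s f * s a + s g * s c = 1 := by
      rw [← map_mul, ← map_mul, ← map_add, h1, map_one]
    have hs3 : s f * s b + s g * s d = 0 := by
      rw [← map_mul, ← map_mul, ← map_add, h3, map_zero]
    have hone : s f * z + s g * z' = 1 := by
      rw [hab, hcd]; linear_combination hs1 + i * hs3
    by_cases hf0 : f = 0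
    · have hg0 : g ≠ 0 := by rintro rfl; simp [hf0] at hone
      have : z' = s g⁻¹ := by
        rw [hf0, map_zero, zero_mul, zero_add] at hone
        rw [map_inv₀]; exact eq_inv_of_mul_eq_one_right hone
      have h := JJ_gen (s := s) n z hz g⁻¹ (inv_ne_zero hg0) x hx
      convert h using 1
      rw [this]; ring
    by_cases hg0 : g = 0
    · have : z = s f⁻¹ := by
        rw [hg0, map_zero, zero_mul, add_zero] at hone
        rw [map_inv₀]; exact eq_inv_of_mul_eq_one_right hone
      have h := JJ_gen (s := s) n z' hz' f⁻¹ (inv_ne_zero hf0) x hx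
      convert h using 1
      rw [this]; ring
    have hsf : s f ≠ 0 := by simpa using hf0
    have hsg : s g ≠ 0 := by simpa using hg0
    have hadd := dg_add (s f * z) (s g * z') (by rw [hone]; exact one_ne_zero)
    rw [hone, dg_one, one_mul] at hadd
    have m1 := JJ_gen (s := s) n (s f) hsf g hg0 x hx
    have m2 := JJ_gen (s := s) n (s f * z) (mul_ne_zero hsf hz) g hg0 x hx
    have m3 := JJ_gen (s := s) n (s g * z') (mul_ne_zero hsg hz') f hf0 x hx
    have := Ideal.mul_mem_left _ (dg (s f) * dg (s g)) (add_mem (add_mem m1 m2) m3)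
    convert this using 1
    rw [dg_mul, dg_mul] at hadd ⊢
    have hA := dg_sq _ hsf
    have hB := dg_sq _ hsg
    generalize dg (s f) = A at *
    generalize dg (s g) = B at *
    generalize dg z = Z at *
    generalize dg z' = Z' at *
    generalize res s x = r at *
    have e : (A + A * Z) * (B + B * Z') = (1 + A) * (1 + B) + (1 + A * Z) * (1 + B) +
        (1 + B * Z') * (1 + A) := by
      linear_combination hadd - (1 + A + B + A * Z + B * Z' - A * Z * B * Z') * two
    have e2 : (1 + Z') * (1 + Z) = A * B * ((A + A * Z) * (B + B * Z')) := by
      linear_combination -(1 + Z') * (1 + Z) * (B * B * hA + hB)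
    rw [e] at e2
    linear_combination r * e2

lemma Ext.mem_JJ (X : Ext s i) : ∀ (n : ℕ) (l : List Eˣ), l.length = n + 1 → pf l ∈ JJ s n
  | 0, l, hl => by
    match l, hl with
    | [z], _ =>
      refine Ideal.subset_span ⟨z, z.ne_zero, 1, by simp, ?_⟩
      rw [pf_cons, pf_nil, map_one]
  | n + 1, l, hl => by
    match l, hl with
    | z' :: l, hl =>
      have h := X.mem_JJ n l (by simpa using hl)
      rw [pf_cons]
      unfold JJ at h
      generalize pf l = w at h ⊢
      induction h using Submodule.span_induction with
      | mem w hw =>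
        obtain ⟨z, hz, x, hx, rfl⟩ := hw
        exact X.JJ_step n z z' hz z'.ne_zero x hx
      | zero => rw [mul_zero]; exact zero_mem _
      | add x y _ _ hx hy => rw [mul_add]; exact add_mem hx hy
      | smul a x _ hx =>
        rw [smul_eq_mul, mul_left_comm]; exact Ideal.mul_mem_left _ _ hx

lemma Ext.back (X : Ext s i) (n : ℕ)
    (hT : ∀ l : List Fˣ, l.length = n + 1 → 2 * pf l = 0 → pf l = 0)
    (hD : ∀ l : List Fˣ, l.length = n + 1 → ∃ y, pf l = 2 * y) :
    fundamentalIdeal E ^ (n + 1) = ⊥ := by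
  have hJ : JJ s n = ⊥ := by
    rw [JJ, Ideal.span_eq_bot]
    rintro _ ⟨z, hz, x, hx, rfl⟩
    refine fund_ind n (p := fun x => (1 + dg z) * res s x = 0) ?_ ?_ ?_ ?_ x hx
    · simp
    · intro c l hl
      subst hl
      rw [map_mul, mul_left_comm, X.keyB l hT hD z hz, mul_zero]
    · intro x y hx hy; rw [map_add, mul_add, hx, hy, add_zero]
    · intro x hx; rw [map_neg, mul_neg, hx, neg_zero]
  rw [fund_span, Ideal.span_eq_bot]
  rintro _ ⟨l, hl, rfl⟩
  have := X.mem_JJ n l hl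
  rw [hJ] at this
  simpa using this

lemma res_inv (σ : F →+* E) (τ : E →+* F) (h : ∀ x, τ (σ x) = x) (x : WittRing F) :
    res τ (res σ x) = x := by
  refine wr_induction (p := fun x => res τ (res σ x) = x) x ?_ ?_ ?_
  · intro a; rw [← dg_unit, res_dg, res_dg, h]
  · intro x y hx hy; rw [map_add, map_add, hx, hy]
  · intro x hx; rw [map_neg, map_neg, hx]

lemma bot_of_bot (σ : F →+* E) (τ : E →+* F) (h : ∀ x, τ (σ x) = x) (n : ℕ)
    (hb : fundamentalIdeal E ^ n = ⊥) : fundamentalIdeal F ^ n = ⊥ := by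
  rw [eq_bot_iff]
  intro x hx
  have := res_fund σ n x hx
  rw [hb, Ideal.mem_bot] at this
  rw [Ideal.mem_bot, ← res_inv σ τ h x, this, map_zero]

end backward
end WR
/-- Let `F` be a field of characteristic `≠ 2` and `s ≥ 0`, and let
`E = F(√-1)`.  Then `Iʲ(E) = 0` for all `j ≥ s + 1` if and only if for all `j ≥ s + 1` the
group `Iʲ(F)` is torsion free and `2·I^{j-1}(F) = Iʲ(F)`. -/
theorem fundamentalIdeal_pow_sqrt_neg_one_eq_bot_iff
    (F : Type*) [Field F] (h2 : (2 : F) ≠ 0)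
    (E : Type*) [Field E] [Algebra F E] (i : E) (hi : i ^ 2 = -1)
    (hgen : Algebra.adjoin F ({i} : Set E) = ⊤) (s : ℕ) :
    (∀ j : ℕ, s + 1 ≤ j → (fundamentalIdeal E) ^ j = ⊥) ↔
    (∀ j : ℕ, s + 1 ≤ j →
      (∀ x ∈ (fundamentalIdeal F) ^ j, ∀ n : ℤ, n • x = 0 → n = 0 ∨ x = 0) ∧
      (∀ x : WittRing F,
        x ∈ (fundamentalIdeal F) ^ j ↔ ∃ y ∈ (fundamentalIdeal F) ^ (j - 1), x = 2 * y)) := by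
  have hE : ∀ e : E, ∃ x y : F, e = algebraMap F E x + i * algebraMap F E y := by
    intro e
    have he : e ∈ Algebra.adjoin F ({i} : Set E) := by rw [hgen]; trivial
    induction he using Algebra.adjoin_induction with
    | mem x hx => rw [Set.mem_singleton_iff] at hx; exact ⟨0, 1, by simp [hx]⟩
    | algebraMap r => exact ⟨r, 0, by simp⟩
    | add a b _ _ ha hb =>
      obtain ⟨x, y, rfl⟩ := ha
      obtain ⟨x', y', rfl⟩ := hb
      exact ⟨x + x', y + y', by simp only [map_add]; ring⟩
    | mul a b _ _ ha hb =>
      obtain ⟨x, y, rfl⟩ := ha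
      obtain ⟨x', y', rfl⟩ := hb
      refine ⟨x * x' - y * y', x * y' + y * x', ?_⟩
      simp only [map_add, map_mul, map_sub]
      linear_combination algebraMap F E y * algebraMap F E y' * hi
  by_cases hsq : ∃ j : F, j ^ 2 = -1
  · obtain ⟨j, hj⟩ := hsq
    have two := WR.two_eq_zero hj
    have hij : ∃ j' : F, i = algebraMap F E j' := by
      have h : i ^ 2 = (algebraMap F E j) ^ 2 := by rw [hi, ← map_pow, hj]; simp
      rcases sq_eq_sq_iff_eq_or_eq_neg.1 h with h | h
      · exact ⟨j, h⟩
      · exact ⟨-j, by rw [h, map_neg]⟩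
    obtain ⟨j', hj'⟩ := hij
    have hbij : Function.Bijective (algebraMap F E) := by
      refine ⟨(algebraMap F E).injective, fun e => ?_⟩
      obtain ⟨x, y, rfl⟩ := hE e
      exact ⟨x + j' * y, by rw [hj', map_add, map_mul]⟩
    have φ : F ≃+* E := RingEquiv.ofBijective _ hbij
    constructor
    · intro H n hn
      have hb := WR.bot_of_bot (φ : F →+* E) (φ.symm : E →+* F) (by simp) n (H n hn)
      rw [hb]
      refine ⟨fun x hx _ _ => Or.inr (by simpa using hx), fun x => ⟨fun hx => ?_, ?_⟩⟩
      · exact ⟨0, zero_mem _, by simpa using hx⟩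
      · rintro ⟨y, _, rfl⟩
        rw [two, zero_mul]; exact zero_mem _
    · intro H n hn
      refine WR.bot_of_bot (φ.symm : E →+* F) (φ : F →+* E) (by simp) n ?_
      rw [eq_bot_iff]
      intro x hx
      rcases (H n hn).1 x hx 2 (by rw [zsmul_eq_mul]; push_cast; rw [two, zero_mul]) with h | h
      · norm_num at h
      · simpa using h
  · have X : WR.Ext (algebraMap F E) i := by
      refine ⟨h2, hi, hE, fun j hj => hsq ⟨j, hj⟩⟩
    constructor
    · intro H n hn
      have G : WR.Good F n := X.good n (by
        intro l hl
        have := WR.pf_mem l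
        rw [H _ (hn.trans hl)] at this
        simpa using this)
      refine ⟨fun x hx k hk => ?_, fun x => ⟨fun hx => G.div x hx, ?_⟩⟩
      · by_cases hk0 : k = 0
        · exact Or.inl hk0
        · right
          refine G.tors x hx k.natAbs (by simpa using hk0) ?_
          rw [← nsmul_eq_mul]
          rcases Int.natAbs_eq k with h | h
          · rw [h, natCast_zsmul] at hk; exact hk
          · rw [h, neg_zsmul, natCast_zsmul, neg_eq_zero] at hk; exact hk
      · rintro ⟨y, hy, rfl⟩
        exact WR.two_mul_mem n (by omega) y hy
    · intro H n hn
      obtain ⟨n, rfl⟩ : ∃ m, n = m + 1 := ⟨n - 1, by omega⟩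
      refine X.back n ?_ ?_
      · intro l hl h
        have hm := WR.pf_mem l
        rw [hl] at hm
        rcases (H _ hn).1 _ hm 2 (by rw [zsmul_eq_mul]; push_cast; exact h) with h | h
        · norm_num at h
        · exact h
      · intro l hl
        have hm := WR.pf_mem l
        rw [hl] at hm
        obtain ⟨y, _, hy⟩ := ((H _ hn).2 _).1 hm
        exact ⟨y, hy⟩
end
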